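/- There exists some ε₁ > 0 such that for any 0 < ε₂ < 1/5 there exists d₀ = d₀(ε₁,ε₂) such that the following holds for each n ≥ d ≥ d₀. Suppose G is an n-vertex TK_{d/2}^(2)-free bipartite (ε₁, ε₂·d)-expander with minimum degree δ(G) ≥ d. Let m = (800/ε₁)·log³ n, and suppose log^{10} n ≤ D ≤ exp((log log n)^{100}), 1 ≤ r ≤ 20m, and U ⊆ V(G) with |U| ≤ exp((log log n)^{100}). Then there is a (D, m, r)-adjuster in G − U. -/

import Mathlib

open Real

namespace Balanced

variable {V : Type*}

/-- The external neighbourhood of a vertex set `X` in `G`. -/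
def extNbr (G : SimpleGraph V) (X : Set V) : Set V := {v | v ∉ X ∧ ∃ u ∈ X, G.Adj u v}

/-- The Komlós–Szemerédi expansion function `ε(x, ε₁, k)`. -/
noncomputable def epsFn (ε₁ k x : ℝ) : ℝ :=
  if x < k / 5 then 0 else ε₁ / (Real.log (15 * x / k)) ^ 2

/-- `G` is an `(ε₁, k)`-expander. -/
def IsExpander (G : SimpleGraph V) (ε₁ k : ℝ) : Prop :=
  ∀ X : Set V, k / 2 ≤ (X.ncard : ℝ) → (X.ncard : ℝ) ≤ (Nat.card V : ℝ) / 2 →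
    epsFn ε₁ k (X.ncard : ℝ) * (X.ncard : ℝ) ≤ ((extNbr G X).ncard : ℝ)

/-- `G` is bipartite. -/
def IsBip (G : SimpleGraph V) : Prop := ∃ f : V → Bool, ∀ u v, G.Adj u v → f u ≠ f v

/-- The average degree `2|E(G)|/|V(G)|` of `G`. -/
noncomputable def avgDeg (G : SimpleGraph V) : ℝ :=
  2 * (Nat.card G.edgeSet : ℝ) / (Nat.card V : ℝ)

/-- The minimum degree of `G` is at least `d`. -/
def MinDegGE (G : SimpleGraph V) (d : ℝ) : Prop :=
  ∀ v : V, d ≤ ((G.neighborSet v).ncard : ℝ)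

/-- The support of a walk, as a set of vertices. -/
def suppSet {G : SimpleGraph V} {a b : V} (w : G.Walk a b) : Set V := {x | x ∈ w.support}

/-- `G` contains an `ℓ`-balanced subdivision `TK_k^(ℓ)` of the complete graph `K_k`:
there are `k` core vertices joined pairwise by internally vertex-disjoint paths of
length exactly `ℓ`, whose internal vertices avoid all core vertices. -/
def ContainsBalSub (G : SimpleGraph V) (k ℓ : ℕ) : Prop :=
  ∃ c : Fin k → V, Function.Injective c ∧
    ∃ P : ∀ i j : Fin k, i < j → G.Walk (c i) (c j),
      (∀ i j (h : i < j), (P i j h).IsPath ∧ (P i j h).length = ℓ) ∧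
      (∀ i j (h : i < j) (q : Fin k), c q ∈ (P i j h).support → q = i ∨ q = j) ∧
      (∀ i j (h : i < j) i' j' (h' : i' < j'), (i, j) ≠ (i', j') →
        ∀ x, x ∈ (P i j h).support → x ∈ (P i' j' h').support →
          (x = c i ∨ x = c j) ∧ (x = c i' ∨ x = c j'))

/-- The subgraph `F` of `G` is a `(D, m)`-expansion of the vertex `v`:
`|V(F)| = D` and every vertex of `F` is at distance at most `m` from `v` in `F`. -/
def IsExpansion (G : SimpleGraph V) (F : G.Subgraph) (v : V) (D m : ℝ) : Prop :=
  ∃ hv : v ∈ F.verts, ((F.verts.ncard : ℝ) = D ∧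
    ∀ u, ∀ hu : u ∈ F.verts, ∃ w : F.coe.Walk ⟨v, hv⟩ ⟨u, hu⟩, (w.length : ℝ) ≤ m)

/-- `G` contains a `(D, m, k)`-adjuster. -/
def HasAdjuster (G : SimpleGraph V) (D m : ℝ) (k : ℕ) : Prop :=
  ∃ (v₁ v₂ : V) (F₁ F₂ : G.Subgraph) (A : Set V),
    Disjoint A F₁.verts ∧ Disjoint A F₂.verts ∧ Disjoint F₁.verts F₂.verts ∧
    IsExpansion G F₁ v₁ D m ∧ IsExpansion G F₂ v₂ D m ∧
    (A.ncard : ℝ) ≤ 10 * m * (k : ℝ) ∧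
    ∃ ℓ : ℕ, ∀ i : ℕ, i ≤ k → ∃ w : G.Walk v₁ v₂, w.IsPath ∧
      w.length = ℓ + 2 * i ∧ ∀ x ∈ w.support, x ∈ A ∪ {v₁, v₂}

open Classical in
/-- `π(u, v, G)` for a connected bipartite graph `G`: `0` if `u = v`, `1` if `u, v`
lie in different classes of the bipartition (equivalently, are joined by an odd walk),
and `2` otherwise. -/
noncomputable def piVal (G : SimpleGraph V) (u v : V) : ℕ :=
  if u = v then 0 else if ∃ w : G.Walk u v, Odd w.length then 1 else 2

/-- The ball of radius `r` around `v` in the subgraph of `G` induced on `S`,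
viewed as a subset of `V`. -/
def ballIn (G : SimpleGraph V) (S : Set V) (v : V) (r : ℕ) : Set V :=
  {u | ∃ w : G.Walk v u, w.length ≤ r ∧ ∀ x ∈ w.support, x ∈ S}

/-- The ball of radius `r` around the set `Y` in the subgraph of `G` induced on `S`. -/
def ballSetIn (G : SimpleGraph V) (S : Set V) (Y : Set V) (r : ℕ) : Set V :=
  {u | ∃ y ∈ Y, ∃ w : G.Walk y u, w.length ≤ r ∧ ∀ x ∈ w.support, x ∈ S}

/-- `P 0, …, P (q-1)` are consecutive shortest paths from `v` in the vertex set `W`: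
each `P i` is a shortest path between its endpoints in the graph induced on
`(W \ ⋃_{j<i} V(P j)) ∪ {v}`. -/
def ConsecSP (G : SimpleGraph V) (v : V) (W : Set V) {q : ℕ}
    (P : Fin q → Σ u : V, G.Walk v u) : Prop :=
  ∀ i : Fin q,
    (∀ x ∈ suppSet (P i).2,
      x ∈ (W \ ⋃ (j : Fin q) (_ : j < i), suppSet (P j).2) ∪ {v}) ∧
    ((P i).2).IsPath ∧
    ∀ w' : G.Walk v (P i).1,
      (∀ x ∈ suppSet w',
        x ∈ (W \ ⋃ (j : Fin q) (_ : j < i), suppSet (P j).2) ∪ {v}) →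
      ((P i).2).length ≤ w'.length

/-- `v` is an end vertex of the path `p`. -/
def IsEnd (G : SimpleGraph V) (v : V) (p : Σ a b : V, G.Walk a b) : Prop :=
  v = p.1 ∨ v = p.2.1

/-- `t` is the subpath `p(v, r)` of `p` of length `r` having `v` as an end vertex. -/
def IsTrunc (G : SimpleGraph V) (r : ℕ) (p : Σ a b : V, G.Walk a b) (v : V)
    (t : Σ u : V, G.Walk v u) : Prop :=
  t.2.length = r ∧ ∃ (c : V) (w' : G.Walk t.1 c),
    (⟨v, c, t.2.append w'⟩ : Σ a b : V, G.Walk a b) = p ∨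
    (⟨v, c, t.2.append w'⟩ : Σ a b : V, G.Walk a b) = ⟨p.2.1, p.1, p.2.2.reverse⟩

section Reach
open scoped Classical
variable (G : SimpleGraph V)

/-- `F` is reachable from `Y` inside `F` within `ρ` steps, witnessed by a height function. -/
def Rk (Y F : Finset V) (ρ : ℕ) : Prop :=
  ∃ h : V → ℕ, ∀ x ∈ F, h x ≤ ρ ∧ (x ∈ Y ∨ ∃ z ∈ F, G.Adj z x ∧ h z < h x)

variable {G}

lemma rk_mono {Y Y' F : Finset V} {ρ ρ' : ℕ} (hY : Y ⊆ Y') (hρ : ρ ≤ ρ') (h : Rk G Y F ρ) :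
    Rk G Y' F ρ' := by
  obtain ⟨h, hh⟩ := h
  exact ⟨h, fun x hx => ⟨(hh x hx).1.trans hρ, (hh x hx).2.imp_left fun a => hY a⟩⟩

lemma rk_trans {Y F F' : Finset V} {a b : ℕ} (hF : F ⊆ F') (h₁ : Rk G Y F a)
    (h₂ : Rk G F F' b) : Rk G Y F' (a + b) := by
  obtain ⟨h, hh⟩ := h₁
  obtain ⟨k, hk⟩ := h₂
  refine ⟨fun x => if x ∈ F then h x else a + k x, fun x hx => ?_⟩
  by_cases hxF : x ∈ F
  · simp only [hxF, if_true]
    refine ⟨(hh x hxF).1.trans (Nat.le_add_right _ _), (hh x hxF).2.imp_right ?_⟩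
    rintro ⟨z, hz, hzx, hlt⟩
    exact ⟨z, hF hz, hzx, by simpa [hz] using hlt⟩
  · simp only [hxF, if_false]
    obtain ⟨h1, h2⟩ := hk x hx
    refine ⟨by omega, Or.inr ?_⟩
    obtain ⟨z, hz, hzx, hlt⟩ := h2.resolve_left hxF
    refine ⟨z, hz, hzx, ?_⟩
    by_cases hzF : z ∈ F
    · have := (hh z hzF).1
      simp only [hzF, if_true]
      omega
    · simp only [hzF, if_false]
      omega

lemma rk_refl (Y : Finset V) (ρ : ℕ) : Rk G Y Y ρ :=
  ⟨fun _ => 0, fun _ hx => ⟨Nat.zero_le _, Or.inl hx⟩⟩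

lemma rk_of_adj {Y F : Finset V} (h : ∀ x ∈ F, x ∈ Y ∨ ∃ z ∈ Y, G.Adj z x) (hYF : Y ⊆ F) :
    Rk G Y F 1 := by
  refine ⟨fun x => if x ∈ Y then 0 else 1, fun x hx => ⟨by dsimp only; split_ifs <;> simp, ?_⟩⟩
  by_cases hxY : x ∈ Y
  · exact Or.inl hxY
  · obtain ⟨z, hz, hzx⟩ := (h x hx).resolve_left hxY
    exact Or.inr ⟨z, hYF hz, hzx, by simp [hz, hxY]⟩

lemma rk_union_left {Y P Q : Finset V} {t : ℕ} (h : Rk G Y P t) (hY : Y ⊆ Q) :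
    Rk G Q (Q ∪ P) t := by
  obtain ⟨h, hh⟩ := h
  refine ⟨fun x => if x ∈ Q then 0 else h x, fun x hx => ?_⟩
  by_cases hxQ : x ∈ Q
  · exact ⟨by simp [hxQ], Or.inl hxQ⟩
  · obtain ⟨h1, h2⟩ := hh x ((Finset.mem_union.1 hx).resolve_left hxQ)
    refine ⟨by simpa [hxQ] using h1, Or.inr ?_⟩
    obtain ⟨z, hz, hzx, hlt⟩ := h2.resolve_left fun a => hxQ (hY a)
    refine ⟨z, Finset.mem_union_right _ hz, hzx, ?_⟩
    simp only [hxQ, if_false]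
    split_ifs <;> omega

lemma exists_path_of_rk {v : V} {F : Finset V} {ρ : ℕ} (h : Rk G {v} F ρ) {x : V} (hx : x ∈ F) :
    ∃ p : G.Walk v x, p.IsPath ∧ p.length ≤ ρ ∧ ∀ z ∈ p.support, z ∈ F := by
  obtain ⟨h, hh⟩ := h
  have key : ∀ n, ∀ x ∈ F, h x ≤ n → ∃ p : G.Walk v x, p.length ≤ n ∧ ∀ z ∈ p.support, z ∈ F := by
    intro n
    induction n with
    | zero =>
      intro x hx h0
      rcases (hh x hx).2 with hv | ⟨z, _, _, hlt⟩
      · obtain rfl := Finset.mem_singleton.1 hv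
        exact ⟨.nil, by simp, by simpa using hx⟩
      · omega
    | succ n ih =>
      intro x hx hn
      rcases (hh x hx).2 with hv | ⟨z, hz, hzx, hlt⟩
      · obtain rfl := Finset.mem_singleton.1 hv
        exact ⟨.nil, by simp, by simpa using hx⟩
      · obtain ⟨p, hp, hpF⟩ := ih z hz (by omega)
        refine ⟨p.concat hzx, by simpa using hp, fun w hw => ?_⟩
        rw [SimpleGraph.Walk.support_concat] at hw
        simp only [List.mem_append, List.mem_singleton] at hw
        rcases hw with hw | rfl
        · exact hpF w hw
        · exact hx
  obtain ⟨p, hp, hpF⟩ := key ρ x hx (hh x hx).1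
  exact ⟨p.bypass, p.bypass_isPath, p.length_bypass_le_length.trans hp,
    fun z hz => hpF z (p.support_bypass_subset_support hz)⟩

lemma exists_rk_trim {v : V} {F : Finset V} {ρ D : ℕ} (h : Rk G {v} F ρ) (hv : v ∈ F)
    (hD : 1 ≤ D) (hDF : D ≤ F.card) :
    ∃ F' ⊆ F, v ∈ F' ∧ F'.card = D ∧ Rk G {v} F' ρ := by
  obtain ⟨k, hk⟩ : ∃ k, F.card = D + k := ⟨F.card - D, by omega⟩
  induction k generalizing F with
  | zero => exact ⟨F, subset_rfl, hv, hk, h⟩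
  | succ k ih =>
    obtain ⟨h, hh⟩ := h
    have hne : (F.erase v).Nonempty := by
      rw [← Finset.card_pos, Finset.card_erase_of_mem hv]
      omega
    obtain ⟨w, hw, hmax⟩ := Finset.exists_max_image (F.erase v) h hne
    have hwF := Finset.mem_of_mem_erase hw
    have hwv := Finset.ne_of_mem_erase hw
    have hc : (F.erase w).card = D + k := by rw [Finset.card_erase_of_mem hwF]; omega
    have hR : Rk G {v} (F.erase w) ρ := by
      refine ⟨h, fun x hx => ?_⟩
      have hxF := Finset.mem_of_mem_erase hx
      refine ⟨(hh x hxF).1, ?_⟩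
      by_cases hxv : x = v
      · exact Or.inl (by simp [hxv])
      · refine (hh x hxF).2.imp_right ?_
        rintro ⟨z, hz, hzx, hlt⟩
        refine ⟨z, Finset.mem_erase.2 ⟨?_, hz⟩, hzx, hlt⟩
        rintro rfl
        have := hmax x (Finset.mem_erase.2 ⟨hxv, hxF⟩)
        omega
    obtain ⟨F', h1, h2, h3, h4⟩ := ih hR (Finset.mem_erase.2 ⟨hwv.symm, hv⟩) (by omega) hc
    exact ⟨F', h1.trans (Finset.erase_subset _ _), h2, h3, h4⟩

end Reach

section Growth
open scoped Classical
variable [Fintype V] (G : SimpleGraph V)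

/-- The external neighbourhood, as a finset. -/
noncomputable def nb (X : Finset V) : Finset V :=
  Finset.univ.filter fun v => v ∉ X ∧ ∃ u ∈ X, G.Adj u v

/-- The vertices reachable from `Y` in at most `t` steps, every step landing outside `O`. -/
noncomputable def grow (O Y : Finset V) : ℕ → Finset V
  | 0 => Y
  | t + 1 => grow O Y t ∪ (nb G (grow O Y t) \ O)

variable {G}

@[simp] lemma mem_nb {X : Finset V} {v : V} : v ∈ nb G X ↔ v ∉ X ∧ ∃ u ∈ X, G.Adj u v := by
  simp [nb]

@[simp] lemma grow_zero (O Y : Finset V) : grow G O Y 0 = Y := rfl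

lemma grow_succ (O Y : Finset V) (t : ℕ) :
    grow G O Y (t + 1) = grow G O Y t ∪ (nb G (grow G O Y t) \ O) := rfl

lemma mem_grow_succ {O Y : Finset V} {t : ℕ} {x : V} :
    x ∈ grow G O Y (t + 1) ↔ x ∈ grow G O Y t ∨ (x ∉ O ∧ ∃ u ∈ grow G O Y t, G.Adj u x) := by
  simp only [grow_succ, Finset.mem_union, Finset.mem_sdiff, mem_nb]
  tauto

lemma grow_subset_succ (O Y : Finset V) (t : ℕ) : grow G O Y t ⊆ grow G O Y (t + 1) :=
  fun _ hx => mem_grow_succ.2 (Or.inl hx)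

lemma grow_mono_time (O Y : Finset V) : Monotone (grow G O Y) :=
  monotone_nat_of_le_succ (grow_subset_succ O Y)

lemma subset_grow (O Y : Finset V) (t : ℕ) : Y ⊆ grow G O Y t :=
  grow_mono_time O Y (Nat.zero_le t)

lemma grow_mono {O O' Y Y' : Finset V} (hO : O' ⊆ O) (hY : Y ⊆ Y') (t : ℕ) :
    grow G O Y t ⊆ grow G O' Y' t := by
  induction t with
  | zero => simpa
  | succ t ih =>
    intro x hx
    rw [mem_grow_succ] at hx ⊢
    rcases hx with hx | ⟨hx, u, hu, hux⟩
    · exact Or.inl (ih hx)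
    · exact Or.inr ⟨fun h => hx (hO h), u, ih hu, hux⟩

lemma grow_add (O Y : Finset V) (s t : ℕ) :
    grow G O (grow G O Y s) t = grow G O Y (s + t) := by
  induction t with
  | zero => rfl
  | succ t ih => rw [grow_succ, ih, ← add_assoc, grow_succ]

lemma grow_disjoint {O Y : Finset V} (h : Disjoint Y O) (t : ℕ) : Disjoint (grow G O Y t) O := by
  induction t with
  | zero => simpa
  | succ t ih =>
    rw [grow_succ, Finset.disjoint_union_left]
    exact ⟨ih, Finset.sdiff_disjoint⟩

lemma exists_mem_grow_reverse {O Y : Finset V} (hd : Disjoint Y O) {t : ℕ} {x : V}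
    (hx : x ∈ grow G O Y t) : ∃ y ∈ Y, y ∈ grow G O {x} t := by
  induction t generalizing x with
  | zero => exact ⟨x, hx, by simp⟩
  | succ t ih =>
    rcases mem_grow_succ.1 hx with hx | ⟨hxO, u, hu, hux⟩
    · obtain ⟨y, hy, h⟩ := ih hx
      exact ⟨y, hy, grow_subset_succ _ _ _ h⟩
    · obtain ⟨y, hy, h⟩ := ih hu
      refine ⟨y, hy, ?_⟩
      have huO : u ∉ O := fun h => (Finset.disjoint_left.1 (grow_disjoint hd t)) hu h
      have h1 : ({u} : Finset V) ⊆ grow G O {x} 1 := by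
        rw [Finset.singleton_subset_iff, mem_grow_succ]
        exact Or.inr ⟨huO, x, by simp, hux.symm⟩
      have := grow_mono (G := G) subset_rfl h1 t h
      rwa [grow_add, add_comm] at this

lemma rk_grow (O Y : Finset V) (t : ℕ) : Rk G Y (grow G O Y t) t := by
  induction t with
  | zero => exact rk_refl _ _
  | succ t ih =>
    refine rk_trans (grow_subset_succ _ _ _) ih (rk_of_adj (fun x hx => ?_)
      (grow_subset_succ _ _ _))
    rw [mem_grow_succ] at hx
    exact hx.imp_right fun h => h.2

lemma exists_geodesic {O Y : Finset V} {t : ℕ} {x : V} (hx : x ∈ grow G O Y t) :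
    ∃ y ∈ Y, ∃ P : Finset V, x ∈ P ∧ y ∈ P ∧ P ⊆ grow G O Y t ∧ (∀ z ∈ P, z ∈ Y → z = y) ∧
      Rk G {y} P t ∧ (∀ j, (P ∩ grow G O Y j).card ≤ j + 1) ∧
      ∀ z ∈ P, z = x ∨ ∃ j < t, z ∈ grow G O Y j := by
  induction t generalizing x with
  | zero =>
    refine ⟨x, hx, {x}, by simp, by simp, by simpa using hx, by simp, rk_refl _ _, fun j => ?_,
      by simp⟩
    exact (Finset.card_le_card Finset.inter_subset_left).trans (by simp)
  | succ t ih =>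
    by_cases hxt : x ∈ grow G O Y t
    · obtain ⟨y, hy, P, h1, h2, h3, h4, h5, h6, h7⟩ := ih hxt
      refine ⟨y, hy, P, h1, h2, h3.trans (grow_subset_succ _ _ _), h4,
        rk_mono subset_rfl (Nat.le_succ t) h5, h6, fun z hz => (h7 z hz).imp_right ?_⟩
      rintro ⟨j, hj, hz⟩
      exact ⟨j, by omega, hz⟩
    · obtain ⟨hxO, u, hu, hux⟩ := (mem_grow_succ.1 hx).resolve_left hxt
      obtain ⟨y, hy, P, h1, h2, h3, h4, h5, h6, h7⟩ := ih hu
      have hPc : P.card ≤ t + 1 := by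
        have := h6 t
        rwa [Finset.inter_eq_left.2 h3] at this
      refine ⟨y, hy, insert x P, by simp, by simp [h2], ?_, ?_, ?_, fun j => ?_, ?_⟩
      · rw [Finset.insert_subset_iff]
        exact ⟨hx, h3.trans (grow_subset_succ _ _ _)⟩
      · intro z hz hzY
        rcases Finset.mem_insert.1 hz with rfl | hz
        · exact absurd (subset_grow _ _ _ hzY) hxt
        · exact h4 z hz hzY
      · refine rk_trans (Finset.subset_insert _ _) h5 (rk_of_adj (fun z hz => ?_)
          (Finset.subset_insert _ _))
        rcases Finset.mem_insert.1 hz with rfl | hz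
        · exact Or.inr ⟨u, h1, hux⟩
        · exact Or.inl hz
      · rcases Nat.lt_or_ge t j with hj | hj
        · calc _ ≤ (insert x P).card := Finset.card_le_card Finset.inter_subset_left
            _ ≤ P.card + 1 := Finset.card_insert_le _ _
            _ ≤ j + 1 := by omega
        · have : x ∉ grow G O Y j := fun h => hxt (grow_mono_time _ _ hj h)
          rw [Finset.insert_inter_of_notMem this]
          exact h6 j
      · intro z hz
        rcases Finset.mem_insert.1 hz with rfl | hz
        · exact Or.inl rfl
        · exact Or.inr ⟨t, by omega, h3 hz⟩

lemma card_grow_geodesic_le {O Y P : Finset V} {t : ℕ} (h : P ⊆ grow G O Y t)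
    (h' : ∀ j, (P ∩ grow G O Y j).card ≤ j + 1) : P.card ≤ t + 1 := by
  have := h' t
  rwa [Finset.inter_eq_left.2 h] at this

end Growth

section Paths
variable {G : SimpleGraph V}

lemma isPath_append {a b c : V} {p : G.Walk a b} {q : G.Walk b c} (hp : p.IsPath) (hq : q.IsPath)
    (h : ∀ x ∈ p.support, x ∈ q.support → x = b) : (p.append q).IsPath := by
  rw [SimpleGraph.Walk.isPath_def, SimpleGraph.Walk.support_append, List.nodup_append']
  refine ⟨hp.support_nodup, hq.support_nodup.tail, fun x hx hx' => ?_⟩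
  have hxb := h x hx (List.mem_of_mem_tail hx')
  subst hxb
  have := hq.support_nodup
  rw [← SimpleGraph.Walk.cons_tail_support] at this
  exact (List.nodup_cons.1 this).1 hx'

end Paths

section Expansion
open scoped Classical
variable [Fintype V] {G : SimpleGraph V}

/-- Every set of size between `κ` and `N` has at least a `1/q` fraction of its size as
external neighbours. -/
def Expands (G : SimpleGraph V) (κ N q : ℕ) : Prop :=
  ∀ X : Finset V, κ ≤ X.card → X.card ≤ N → X.card ≤ q * (nb G X).card

lemma coe_extNbr (X : Finset V) : extNbr G (X : Set V) = (nb G X : Set V) := by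
  ext v
  simp [extNbr]

lemma card_le_log_sq_mul_nb {k : ℝ} (hk : 0 < k) (hG : IsExpander G 1 k) {X : Finset V}
    (h₁ : k / 2 ≤ X.card) (h₂ : (X.card : ℝ) ≤ (Fintype.card V : ℝ) / 2) :
    (X.card : ℝ) ≤ Real.log (15 * X.card / k) ^ 2 * (nb G X).card := by
  have h := hG (X : Set V) (by simpa using h₁) (by simpa [Nat.card_eq_fintype_card] using h₂)
  rw [coe_extNbr, Set.ncard_coe_finset, Set.ncard_coe_finset, epsFn,
    if_neg (by push Not; linarith)] at h
  have h7 : 1 < 15 * (X.card : ℝ) / k := by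
    rw [lt_div_iff₀ hk]
    linarith
  have hpos : 0 < Real.log (15 * X.card / k) ^ 2 := by
    have := Real.log_pos h7
    positivity
  rw [div_mul_eq_mul_div, one_mul, div_le_iff₀ hpos] at h
  linarith

lemma card_le_mul_nb {k : ℝ} (hk : 15 ≤ k) (hG : IsExpander G 1 k) {X : Finset V}
    (h₁ : k / 2 ≤ X.card) (h₂ : (X.card : ℝ) ≤ (Fintype.card V : ℝ) / 2) {q : ℕ}
    (hq : Real.log X.card ^ 2 ≤ q) : X.card ≤ q * (nb G X).card := by
  have h := card_le_log_sq_mul_nb (by linarith) hG h₁ h₂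
  have hk0 : 0 < k := by linarith
  have h7 : 1 ≤ 15 * (X.card : ℝ) / k := by
    rw [le_div_iff₀ hk0]
    linarith
  have h8 : 15 * (X.card : ℝ) / k ≤ X.card := by
    rw [div_le_iff₀ hk0]
    nlinarith [Nat.cast_nonneg (α := ℝ) X.card]
  have h9 : Real.log (15 * X.card / k) ^ 2 ≤ Real.log X.card ^ 2 :=
    pow_le_pow_left₀ (Real.log_nonneg h7) (Real.log_le_log (by linarith) h8) 2
  have : (X.card : ℝ) ≤ q * (nb G X).card :=
    h.trans (mul_le_mul_of_nonneg_right (h9.trans hq) (Nat.cast_nonneg _))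
  exact_mod_cast this

lemma geometric_growth (y : ℕ → ℝ) {B q c p : ℝ} {n : ℕ} (hq : 1 ≤ q) (hB : 0 ≤ B)
    (h0 : B ≤ y 0) (hc : 2 * q * c ≤ B) (hp : 4 * q ^ 2 * p ≤ B)
    (hstep : ∀ t < n, y t ≤ q * (c + t * p + (y (t + 1) - y t))) :
    ∀ t ≤ n, B * (1 + 1 / (2 * q)) ^ t ≤ y t := by
  intro t
  induction t with
  | zero => intro _; simpa using h0
  | succ t ih =>
    intro ht
    have hy := ih (by omega)
    have hs := hstep t (by omega)
    have hbern : 1 + (t : ℝ) * (1 / (2 * q)) ≤ (1 + 1 / (2 * q)) ^ t :=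
      one_add_mul_le_pow (by have : 0 ≤ 1 / (2 * q) := by positivity
                             linarith) t
    have h1 : B * (1 + (t : ℝ) * (1 / (2 * q))) ≤ y t :=
      (mul_le_mul_of_nonneg_left hbern hB).trans hy
    have h2 : q * (c + t * p) ≤ y t / 2 := by
      have h3 : q * (t * p) ≤ B * (t * (1 / (2 * q))) / 2 := by
        have : B * (t * (1 / (2 * q))) / 2 = t * B / (4 * q) := by field_simp; ring
        rw [this, le_div_iff₀ (by positivity)]
        nlinarith [Nat.cast_nonneg (α := ℝ) t]
      nlinarith
    have h4 : y t * (1 + 1 / (2 * q)) ≤ y (t + 1) := by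
      have : y t / 2 ≤ q * (y (t + 1) - y t) := by linarith
      have h5 : y t / (2 * q) ≤ y (t + 1) - y t := by
        rw [div_le_iff₀ (by positivity)]
        linarith
      have : y t * (1 + 1 / (2 * q)) = y t + y t / (2 * q) := by ring
      linarith
    calc B * (1 + 1 / (2 * q)) ^ (t + 1) = (B * (1 + 1 / (2 * q)) ^ t) * (1 + 1 / (2 * q)) := by
          ring
      _ ≤ y t * (1 + 1 / (2 * q)) := by gcongr
      _ ≤ _ := h4

lemma two_pow_le_one_add_pow {q : ℕ} (hq : 1 ≤ q) (j : ℕ) :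
    (2 : ℝ) ^ j ≤ (1 + 1 / (2 * (q : ℝ))) ^ (2 * q * j) := by
  rw [pow_mul]
  have hq' : (1 : ℝ) ≤ q := by exact_mod_cast hq
  refine pow_le_pow_left₀ (by norm_num) ?_ j
  have := one_add_mul_le_pow (a := 1 / (2 * (q : ℝ))) (by
    have : 0 ≤ 1 / (2 * (q : ℝ)) := by positivity
    linarith) (2 * q)
  refine le_trans (le_of_eq ?_) this
  push_cast
  field_simp
  norm_num

lemma exists_large_grow {ι : Type*} {κ N q : ℕ} (hexp : Expands G κ N q) (hq : 1 ≤ q)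
    (I : Finset ι) (hI : I.Nonempty) (U : Finset V) (Y O : ι → Finset V) (o : ι → ℕ)
    (hcon : ∀ i ∈ I, ∀ t, (nb G (grow G (U ∪ O i) (Y i) t) ∩ O i).card ≤ o i + t)
    {T j B : ℕ} (hB : B ≤ (I.biUnion Y).card) (hκ : κ ≤ B)
    (h₁ : 2 * q * (U.card + ∑ i ∈ I, o i) ≤ B) (h₂ : 4 * q ^ 2 * I.card ≤ B)
    (hN : I.card * (T - 1) ≤ N) (hT : I.card * T ≤ B * 2 ^ j) (hT1 : 1 ≤ T) :
    ∃ i ∈ I, T ≤ (grow G (U ∪ O i) (Y i) (2 * q * j)).card := by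
  by_contra! hlt
  set Z : ℕ → Finset V := fun t => I.biUnion fun i => grow G (U ∪ O i) (Y i) t with hZ
  have hmono : Monotone Z := fun s t hst =>
    Finset.biUnion_mono fun i _ => grow_mono_time _ _ hst
  have hup : ∀ t ≤ 2 * q * j, (Z t).card ≤ I.card * (T - 1) := by
    intro t ht
    refine Finset.card_biUnion_le_card_mul _ _ _ fun i hi => ?_
    have := hlt i hi
    have := Finset.card_le_card (grow_mono_time (G := G) (U ∪ O i) (Y i) ht)
    omega
  have h0 : B ≤ (Z 0).card := by simpa [hZ] using hB
  have hgrow := geometric_growth (fun t => ((Z t).card : ℝ)) (B := B) (q := q)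
    (c := U.card + ∑ i ∈ I, o i) (p := I.card) (n := 2 * q * j) (by exact_mod_cast hq)
    (by positivity) (by exact_mod_cast h0) (by exact_mod_cast h₁) (by exact_mod_cast h₂) (by
      intro t ht
      have hle := hexp (Z t) (hκ.trans (h0.trans (Finset.card_le_card (hmono (Nat.zero_le t)))))
        ((hup t ht.le).trans hN)
      have hsub : nb G (Z t) ⊆ U ∪ (I.biUnion fun i => nb G (grow G (U ∪ O i) (Y i) t) ∩ O i) ∪
          (Z (t + 1) \ Z t) := by
        intro v hv
        obtain ⟨hvZ, u, hu, huv⟩ := mem_nb.1 hv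
        obtain ⟨i, hi, hui⟩ := Finset.mem_biUnion.1 hu
        have hvi : v ∉ grow G (U ∪ O i) (Y i) t := fun h =>
          hvZ (Finset.mem_biUnion.2 ⟨i, hi, h⟩)
        by_cases hvU : v ∈ U
        · exact Finset.mem_union_left _ (Finset.mem_union_left _ hvU)
        by_cases hvO : v ∈ O i
        · refine Finset.mem_union_left _ (Finset.mem_union_right _ ?_)
          exact Finset.mem_biUnion.2 ⟨i, hi, Finset.mem_inter.2
            ⟨mem_nb.2 ⟨hvi, u, hui, huv⟩, hvO⟩⟩
        · refine Finset.mem_union_right _ (Finset.mem_sdiff.2 ⟨?_, hvZ⟩)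
          refine Finset.mem_biUnion.2 ⟨i, hi, mem_grow_succ.2 (Or.inr ⟨?_, u, hui, huv⟩)⟩
          simp [hvU, hvO]
      have hcard : (nb G (Z t)).card ≤ U.card + (∑ i ∈ I, o i + t * I.card) +
          ((Z (t + 1)).card - (Z t).card) := by
        refine (Finset.card_le_card hsub).trans ((Finset.card_union_le _ _).trans ?_)
        rw [Finset.card_sdiff_of_subset (hmono (Nat.le_succ t))]
        refine Nat.add_le_add_right ((Finset.card_union_le _ _).trans ?_) _
        refine Nat.add_le_add_left ?_ _
        refine Finset.card_biUnion_le.trans ((Finset.sum_le_sum fun i hi => hcon i hi t).trans ?_)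
        rw [Finset.sum_add_distrib, Finset.sum_const, smul_eq_mul, mul_comm]
      have hm := Finset.card_le_card (hmono (Nat.le_succ t))
      have h3 := hle.trans (Nat.mul_le_mul_left q hcard)
      have h4 : ((Z t).card : ℝ) ≤ q * (U.card + (∑ i ∈ I, o i + t * I.card) +
          (((Z (t + 1)).card - (Z t).card : ℕ) : ℝ)) := by exact_mod_cast h3
      rw [Nat.cast_sub hm] at h4
      refine h4.trans (le_of_eq ?_)
      ring)
  have hlast := hgrow (2 * q * j) le_rfl
  have hpow := two_pow_le_one_add_pow hq j
  have : (B : ℝ) * 2 ^ j ≤ (Z (2 * q * j)).card :=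
    (mul_le_mul_of_nonneg_left hpow (by positivity)).trans hlast
  have h5 : B * 2 ^ j ≤ (Z (2 * q * j)).card := by exact_mod_cast this
  have h6 := hup _ le_rfl
  have h7 := hI.card_pos
  have : I.card * (T - 1) < I.card * T := Nat.mul_lt_mul_of_pos_left (by omega) h7
  omega

/-- The number of steps after which a large set has reached more than half of the vertices. -/
def halfTime (n q : ℕ) : ℕ := 2 * q * (Nat.log 2 n + 1)

lemma half_lt_card_grow {κ q : ℕ} (hexp : Expands G κ (Fintype.card V / 2) q) (hq : 1 ≤ q)
    {W X : Finset V} (hκ : κ ≤ X.card) (hW : 2 * q * W.card ≤ X.card)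
    (hX : 4 * q ^ 2 ≤ X.card) :
    Fintype.card V / 2 + 1 ≤
      (grow G W X (halfTime (Fintype.card V) q)).card := by
  obtain ⟨i, -, h⟩ := exists_large_grow hexp hq ({()} : Finset Unit) (by simp) W (fun _ => X)
    (fun _ => ∅) (fun _ => 0) (by simp) (T := Fintype.card V / 2 + 1)
    (j := Nat.log 2 (Fintype.card V) + 1) (B := X.card) (by simp) hκ (by simpa using hW)
    (by simpa using hX) (by simp) (by
      have h1 := Nat.lt_pow_succ_log_self (b := 2) (by norm_num) (Fintype.card V)
      have h2 : 1 ≤ X.card := by nlinarith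
      simp only [Finset.card_singleton, one_mul]
      have h3 : Fintype.card V / 2 + 1 ≤ 2 ^ (Nat.log 2 (Fintype.card V) + 1) := by
        have := Nat.div_le_self (Fintype.card V) 2
        simp only [Nat.succ_eq_add_one] at h1
        omega
      exact h3.trans (Nat.le_mul_of_pos_left _ h2)) (by omega)
  simpa [halfTime] using h

lemma exists_link {W X₁ X₂ : Finset V} (hd₁ : Disjoint X₁ W) (hd₂ : Disjoint X₂ W) {a b : ℕ}
    (h₁ : Fintype.card V / 2 + 1 ≤ (grow G W X₁ a).card)
    (h₂ : Fintype.card V / 2 + 1 ≤ (grow G W X₂ b).card) :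
    ∃ x₁ ∈ X₁, ∃ x₂ ∈ X₂, ∃ P : Finset V, x₁ ∈ P ∧ x₂ ∈ P ∧ Disjoint P W ∧
      (∀ z ∈ P, z ∈ X₁ → z = x₁) ∧ (∀ z ∈ P, z ∈ X₂ → z = x₂) ∧
      Rk G {x₁} P (a + b) ∧ P.card ≤ a + b + 1 ∧
      ∀ j, (P ∩ grow G W X₁ j).card ≤ j + 1 := by
  have hjoin : ∃ x ∈ X₂, x ∈ grow G W X₁ (a + b) := by
    have : ¬ Disjoint (grow G W X₁ a) (grow G W X₂ b) := by
      intro hdis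
      have := Finset.card_le_univ (grow G W X₁ a ∪ grow G W X₂ b)
      rw [Finset.card_union_of_disjoint hdis] at this
      omega
    obtain ⟨z, hz₁, hz₂⟩ := Finset.not_disjoint_iff.1 this
    obtain ⟨x, hx, hxz⟩ := exists_mem_grow_reverse hd₂ hz₂
    refine ⟨x, hx, ?_⟩
    rw [← grow_add]
    exact grow_mono subset_rfl (Finset.singleton_subset_iff.2 hz₁) _ hxz
  have hex : ∃ t, ∃ x ∈ X₂, x ∈ grow G W X₁ t := ⟨_, hjoin⟩
  have hle : Nat.find hex ≤ a + b := Nat.find_min' hex hjoin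
  obtain ⟨x, hx, hxg⟩ := Nat.find_spec hex
  obtain ⟨y, hy, P, hxP, hyP, hP, hPX, hR, hc, hlast⟩ := exists_geodesic hxg
  have hcard := card_grow_geodesic_le hP hc
  refine ⟨y, hy, x, hx, P, hyP, hxP, (grow_disjoint hd₁ _).mono_left hP, hPX, ?_,
    rk_mono subset_rfl hle hR, by omega, hc⟩
  intro z hz hzX
  rcases hlast z hz with h | ⟨j, hj, hzj⟩
  · exact h
  · exact absurd ⟨z, hzX, hzj⟩ (Nat.find_min hex hj)

end Expansion

section Degrees
open scoped Classical
variable [Fintype V] {G : SimpleGraph V}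

/-- The number of neighbours of `v` in `W`. -/
noncomputable def degIn (G : SimpleGraph V) (W : Finset V) (v : V) : ℕ := (W.filter (G.Adj v)).card

lemma card_heavy_le_sq {k : ℕ} (hG : ¬ ContainsBalSub G k 2) (W : Finset V) :
    (Finset.univ.filter fun b => b ∉ W ∧ k ≤ degIn G W b).card ≤ W.card ^ 2 := by
  by_contra! hlt
  set B := Finset.univ.filter fun b => b ∉ W ∧ k ≤ degIn G W b with hB
  let valid : Finset ((V × V) × V) → Prop := fun M =>
    (∀ e ∈ M, e.1.1 ∈ W ∧ e.1.2 ∈ W ∧ G.Adj e.1.1 e.2 ∧ G.Adj e.2 e.1.2 ∧ e.2 ∉ W) ∧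
    (∀ e ∈ M, ∀ e' ∈ M, (e.1 = e'.1 ∨ e.2 = e'.2) → e = e')
  obtain ⟨M, hM, hmax⟩ := Finset.exists_max_image (Finset.univ.filter valid) Finset.card
    ⟨∅, by simp [valid]⟩
  replace hM : valid M := (Finset.mem_filter.1 hM).2
  have hMc : M.card ≤ W.card ^ 2 := by
    rw [pow_two, ← Finset.card_product]
    refine Finset.card_le_card_of_injOn Prod.fst (fun e he => ?_) (fun e he e' he' h =>
      hM.2 e he e' he' (Or.inl h))
    exact Finset.mem_product.2 ⟨(hM.1 e he).1, (hM.1 e he).2.1⟩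
  obtain ⟨b, hb, hbM⟩ : ∃ b ∈ B, b ∉ M.image Prod.snd := by
    by_contra! hall
    have := Finset.card_le_card (s := B) (t := M.image Prod.snd) hall
    have := Finset.card_image_le (s := M) (f := Prod.snd)
    omega
  obtain ⟨-, hbW, hbk⟩ := Finset.mem_filter.1 hb
  have hfull : ∀ x ∈ W, ∀ y ∈ W, G.Adj b x → G.Adj b y → ∃ c, ((x, y), c) ∈ M := by
    intro x hx y hy hbx hby
    by_contra! hno
    have hval : valid (insert ((x, y), b) M) := by
      refine ⟨fun e he => ?_, ?_⟩
      · rcases Finset.mem_insert.1 he with rfl | he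
        · exact ⟨hx, hy, hbx.symm, hby, hbW⟩
        · exact hM.1 e he
      · have hne : ∀ e ∈ M, ¬ (e.1 = (x, y) ∨ e.2 = b) := by
          rintro e he (h | h)
          · exact hno e.2 (by rwa [← h])
          · exact hbM (Finset.mem_image.2 ⟨e, he, h⟩)
        intro e he e' he' h
        rcases Finset.mem_insert.1 he with rfl | he <;>
          rcases Finset.mem_insert.1 he' with rfl | he'
        · rfl
        · exact absurd (h.imp Eq.symm Eq.symm) (hne e' he')
        · exact absurd h (hne e he)
        · exact hM.2 e he e' he' h
    have := hmax _ (Finset.mem_filter.2 ⟨Finset.mem_univ _, hval⟩)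
    rw [Finset.card_insert_of_notMem (hno b)] at this
    omega
  obtain ⟨f⟩ : Nonempty (Fin k ↪ {x // x ∈ W.filter (G.Adj b)}) :=
    Function.Embedding.nonempty_of_card_le (by rw [Fintype.card_fin, Fintype.card_coe]; exact hbk)
  have hfW : ∀ i, (f i : V) ∈ W := fun i => (Finset.mem_filter.1 (f i).2).1
  have hfb : ∀ i, G.Adj b (f i) := fun i => (Finset.mem_filter.1 (f i).2).2
  have hinj : ∀ i j, (f i : V) = f j → i = j := fun i j h => f.injective (Subtype.ext h)
  choose g hg using fun i j => hfull _ (hfW i) _ (hfW j) (hfb i) (hfb j)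
  have hgW : ∀ i j, g i j ∉ W := fun i j => (hM.1 _ (hg i j)).2.2.2.2
  refine hG ⟨fun i => f i, fun i j h => hinj i j h, fun i j _ =>
    .cons (hM.1 _ (hg i j)).2.2.1 (.cons (hM.1 _ (hg i j)).2.2.2.1 .nil), ?_, ?_, ?_⟩
  · intro i j hij
    refine ⟨?_, rfl⟩
    have h1 : (f i : V) ≠ g i j := fun h => hgW i j (h ▸ hfW i)
    have h2 : (f j : V) ≠ g i j := fun h => hgW i j (h ▸ hfW j)
    have h3 : (f i : V) ≠ f j := fun h => hij.ne (hinj i j h)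
    simp [SimpleGraph.Walk.cons_isPath_iff, h1, h2.symm, h3]
  · intro i j hij q hq
    simp only [SimpleGraph.Walk.support_cons, SimpleGraph.Walk.support_nil, List.mem_cons,
      List.not_mem_nil, or_false] at hq
    rcases hq with h | h | h
    · exact Or.inl (hinj _ _ h)
    · exact absurd (h ▸ hfW q) (hgW i j)
    · exact Or.inr (hinj _ _ h)
  · intro i j hij i' j' hij' hne x hx hx'
    simp only [SimpleGraph.Walk.support_cons, SimpleGraph.Walk.support_nil, List.mem_cons,
      List.not_mem_nil, or_false] at hx hx'
    rcases hx with h | h | h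
    · rcases hx' with h' | h' | h'
      · exact ⟨Or.inl h, Or.inl h'⟩
      · exact absurd (h' ▸ h ▸ hfW i) (hgW i' j')
      · exact ⟨Or.inl h, Or.inr h'⟩
    · rcases hx' with h' | h' | h'
      · exact absurd (h ▸ h' ▸ hfW i') (hgW i j)
      · have := hM.2 _ (hg i j) _ (hg i' j') (Or.inr (h.symm.trans h'))
        simp only [Prod.mk.injEq] at this
        exact absurd (Prod.ext (hinj _ _ this.1.1) (hinj _ _ this.1.2)) hne
      · exact absurd (h ▸ h' ▸ hfW j') (hgW i j)
    · rcases hx' with h' | h' | h'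
      · exact ⟨Or.inr h, Or.inl h'⟩
      · exact absurd (h' ▸ h ▸ hfW j) (hgW i' j')
      · exact ⟨Or.inr h, Or.inr h'⟩

omit [Fintype V] in
lemma degIn_le_card (W : Finset V) (v : V) : degIn G W v ≤ W.card := Finset.card_filter_le _ _

lemma degIn_univ_le (W : Finset V) (v : V) :
    degIn G Finset.univ v ≤ degIn G W v + degIn G (Finset.univ \ W) v := by
  unfold degIn
  refine (Finset.card_le_card ?_).trans (Finset.card_union_le _ _)
  intro x hx
  by_cases h : x ∈ W <;> simp_all

omit [Fintype V] in
lemma exists_minDeg_subset {δ : ℕ} (_hδ : 0 < δ) {Z : Finset V} (hZ : Z.Nonempty)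
    (hsum : 2 * δ * Z.card ≤ ∑ x ∈ Z, degIn G Z x) :
    ∃ Z' ⊆ Z, Z'.Nonempty ∧ ∀ x ∈ Z', δ ≤ degIn G Z' x := by
  induction hn : Z.card generalizing Z with
  | zero => simp_all
  | succ n ih =>
    by_cases hall : ∀ x ∈ Z, δ ≤ degIn G Z x
    · exact ⟨Z, subset_rfl, hZ, hall⟩
    push Not at hall
    obtain ⟨x, hx, hxδ⟩ := hall
    have hsplit : ∀ y ∈ Z.erase x, degIn G Z y = degIn G (Z.erase x) y +
        if G.Adj x y then 1 else 0 := by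
      intro y hy
      unfold degIn
      conv_lhs => rw [← Finset.insert_erase hx]
      rw [Finset.filter_insert]
      by_cases h : G.Adj x y
      · simp [h, h.symm]
      · have h' : ¬ G.Adj y x := fun a => h a.symm
        simp [h, h']
    have hdx : ∑ y ∈ Z.erase x, (if G.Adj x y then 1 else 0) = degIn G Z x := by
      rw [← Finset.card_filter, degIn]
      congr 1
      ext y
      simp only [Finset.mem_filter, Finset.mem_erase]
      exact ⟨fun h => ⟨h.1.2, h.2⟩, fun h => ⟨⟨h.2.ne', h.1⟩, h.2⟩⟩
    have htot : ∑ y ∈ Z, degIn G Z y = ∑ y ∈ Z.erase x, degIn G (Z.erase x) y +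
        2 * degIn G Z x := by
      rw [← Finset.sum_erase_add _ _ hx, Finset.sum_congr rfl hsplit, Finset.sum_add_distrib, hdx]
      ring
    have hc : (Z.erase x).card = n := by rw [Finset.card_erase_of_mem hx, hn]; rfl
    have hne : (Z.erase x).Nonempty := by
      rw [Finset.nonempty_iff_ne_empty]
      intro h0
      rw [h0] at htot
      simp only [Finset.sum_empty] at htot
      have : 1 ≤ Z.card := by omega
      nlinarith
    rw [htot] at hsum
    obtain ⟨Z', h1, h2⟩ := ih hne (by rw [hc]; rw [hn] at hsum; nlinarith) hc
    exact ⟨Z', h1.trans (Finset.erase_subset _ _), h2⟩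

lemma exists_minDeg_avoiding {k e δ : ℕ} (hG : ¬ ContainsBalSub G k 2) (hk : 2 * k ≤ e + 1)
    (hdeg : ∀ v, e ≤ degIn G Finset.univ v) (hδ : 0 < δ) (hδe : 8 * δ ≤ e) {W : Finset V}
    (hW : 2 * (W.card + W.card ^ 2) < Fintype.card V) :
    ∃ Z : Finset V, Disjoint Z W ∧ Z.Nonempty ∧ ∀ x ∈ Z, δ ≤ degIn G Z x := by
  set H := Finset.univ.filter fun b => b ∉ W ∧ k ≤ degIn G W b with hH
  have hHc := card_heavy_le_sq hG W
  set Z := Finset.univ \ W with hZ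
  have hgood : Fintype.card V ≤ 2 * (Z \ H).card := by
    have h1 := Finset.le_card_sdiff H Z
    have h2 := Finset.le_card_sdiff W (Finset.univ : Finset V)
    rw [Finset.card_univ, ← hZ] at h2
    rw [← hH] at hHc
    omega
  have hne : Z.Nonempty := by
    by_contra h
    rw [Finset.not_nonempty_iff_eq_empty] at h
    rw [h] at hgood
    simp at hgood
    omega
  have hg : ∀ x ∈ Z \ H, e ≤ 2 * degIn G Z x := by
    intro x hx
    obtain ⟨hxZ, hxH⟩ := Finset.mem_sdiff.1 hx
    have hxW : x ∉ W := (Finset.mem_sdiff.1 hxZ).2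
    have hlt : degIn G W x < k := by
      by_contra! h
      exact hxH (Finset.mem_filter.2 ⟨Finset.mem_univ _, hxW, h⟩)
    have h1 := degIn_univ_le (G := G) W x
    have h2 := hdeg x
    rw [← hZ] at h1
    omega
  have hs : (Z \ H).card * e ≤ 2 * ∑ x ∈ Z, degIn G Z x := by
    rw [Finset.mul_sum, ← smul_eq_mul]
    refine (Finset.card_nsmul_le_sum _ _ _ hg).trans ?_
    exact Finset.sum_le_sum_of_subset Finset.sdiff_subset
  obtain ⟨Z', h1, h2, h3⟩ := exists_minDeg_subset (G := G) hδ hne (by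
    have hZc : Z.card ≤ Fintype.card V := Finset.card_le_univ _
    nlinarith)
  exact ⟨Z', Finset.sdiff_disjoint.mono_left h1, h2, h3⟩

end Degrees

section Cycles
open scoped Classical
variable {H : SimpleGraph V}

/-- Every cycle of `H` has length at least `L`. -/
def GirthGE (H : SimpleGraph V) (L : ℕ) : Prop := ∀ a (c : H.Walk a a), c.IsCycle → L ≤ c.length

lemma GirthGE.le_add_of_ne {L : ℕ} (hH : GirthGE H L) {a b : V} {p q : H.Walk a b}
    (hp : p.IsPath) (hq : q.IsPath) (hne : p ≠ q) : L ≤ p.length + q.length := by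
  obtain ⟨u, v, p', q', h₁, h₂, hc⟩ := hp.exists_isCycle_of_ne hq hne
  have h := hH _ _ hc
  obtain ⟨r, s, rfl⟩ := h₁
  obtain ⟨r', s', rfl⟩ := h₂
  simp only [SimpleGraph.Walk.length_append, SimpleGraph.Walk.length_reverse] at h ⊢
  omega

lemma GirthGE.mono {H' : SimpleGraph V} {L : ℕ} (hH : GirthGE H L) (h : H' ≤ H) :
    GirthGE H' L := fun a c hc => by
  simpa using hH a (c.mapLe h) (hc.mapLe h)

/-- The end vertices of the paths of length `j` from `v`. -/
noncomputable def pathEnds [Fintype V] (H : SimpleGraph V) (v : V) (j : ℕ) : Finset V :=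
  Finset.univ.filter fun x => ∃ p : H.Walk v x, p.IsPath ∧ p.length = j

lemma two_pow_le_card_pathEnds [Fintype V] {L : ℕ} (hH : GirthGE H L) {Z : Finset V}
    (hZ : ∀ x y, H.Adj x y → y ∈ Z) (hdeg : ∀ x ∈ Z, 3 ≤ degIn H Finset.univ x) {v : V}
    (hv : v ∈ Z) {j : ℕ} (hj : 2 * j < L) : 2 ^ j ≤ (pathEnds H v j).card := by
  induction j with
  | zero =>
    refine Finset.card_pos.2 ⟨v, ?_⟩
    exact Finset.mem_filter.2 ⟨Finset.mem_univ _, .nil, by simp, rfl⟩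
  | succ j ih =>
    have ih := ih (by omega)
    have hex : ∀ x ∈ pathEnds H v j, ∃ N : Finset V, 2 ≤ N.card ∧ ∀ y ∈ N, ∃ p : H.Walk v y,
        p.IsPath ∧ p.length = j + 1 ∧ p.penultimate = x := by
      intro x hx
      obtain ⟨-, p, hp, hpj⟩ := Finset.mem_filter.1 hx
      have hxZ : x ∈ Z := by
        by_cases hn : p.Nil
        · rwa [← hn.eq]
        · exact hZ _ _ (p.adj_penultimate hn)
      refine ⟨(Finset.univ.filter (H.Adj x)).erase p.penultimate, ?_, fun y hy => ?_⟩
      · have := hdeg x hxZ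
        unfold degIn at this
        have := Finset.pred_card_le_card_erase (s := Finset.univ.filter (H.Adj x))
          (a := p.penultimate)
        omega
      · obtain ⟨hyp, hxy⟩ := Finset.mem_erase.1 hy
        replace hxy := (Finset.mem_filter.1 hxy).2
        have hys : y ∉ p.support := by
          intro hys
          have hq : (p.dropUntil y hys).IsPath := hp.dropUntil hys
          have he : (SimpleGraph.Walk.cons hxy.symm .nil : H.Walk y x).IsPath := by
            simp [SimpleGraph.Walk.cons_isPath_iff, hxy.ne']
          by_cases heq : p.dropUntil y hys = .cons hxy.symm .nil
          · apply hyp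
            refine hp.eq_penultimate_of_mem_edges ?_
            refine p.edges_dropUntil_subset_edges hys ?_
            rw [heq]
            simp [Sym2.eq_swap]
          · have h1 := hH.le_add_of_ne hq he heq
            have h2 := p.length_dropUntil_le_length hys
            simp only [SimpleGraph.Walk.length_cons, SimpleGraph.Walk.length_nil] at h1
            omega
        refine ⟨p.concat hxy, hp.concat hys hxy, by simp [hpj], by simp⟩
    choose! N hN2 hN using hex
    have hsub : (pathEnds H v j).biUnion N ⊆ pathEnds H v (j + 1) := by
      intro y hy
      obtain ⟨x, hx, hy⟩ := Finset.mem_biUnion.1 hy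
      obtain ⟨p, hp, hl, -⟩ := hN x hx y hy
      exact Finset.mem_filter.2 ⟨Finset.mem_univ _, p, hp, hl⟩
    refine le_trans ?_ (Finset.card_le_card hsub)
    rw [Finset.card_biUnion]
    · calc 2 ^ (j + 1) = 2 ^ j * 2 := pow_succ _ _
        _ ≤ (pathEnds H v j).card * 2 := Nat.mul_le_mul_right _ ih
        _ ≤ _ := by
          rw [← smul_eq_mul]
          exact Finset.card_nsmul_le_sum _ _ _ hN2
    · intro x hx x' hx' hne
      refine Finset.disjoint_left.2 fun y hy hy' => ?_
      obtain ⟨p, hp, hl, hpx⟩ := hN x hx y hy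
      obtain ⟨p', hp', hl', hpx'⟩ := hN x' hx' y hy'
      have hpp : p ≠ p' := by
        rintro rfl
        exact hne (hpx.symm.trans hpx')
      have := hH.le_add_of_ne hp hp' hpp
      omega

lemma exists_short_path_on_cycle {a : V} {c : H.Walk a a} (hc : c.IsCycle) {ℓ : ℕ}
    (hl : c.length = 2 * ℓ) {x y : V} (hx : x ∈ c.support) (hy : y ∈ c.support) (hxy : x ≠ y) :
    ∃ q : H.Walk x y, q.IsPath ∧ q.length ≤ ℓ ∧ ∀ e ∈ q.edges, e ∈ c.edges := by
  have hc' := hc.rotate hx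
  have hy' : y ∈ (c.rotate x hx).support := by
    rw [SimpleGraph.Walk.mem_support_rotate_iff]
    exact hy
  have hedge : ∀ e ∈ (c.rotate x hx).edges, e ∈ c.edges := fun e he =>
    (c.rotate_edges x hx).perm.mem_iff.1 he
  have hsum : ((c.rotate x hx).takeUntil y hy').length + ((c.rotate x hx).dropUntil y hy').length
      = 2 * ℓ := by
    rw [← SimpleGraph.Walk.length_append, SimpleGraph.Walk.take_spec,
      SimpleGraph.Walk.length_rotate, hl]
  have hspec := (c.rotate x hx).take_spec hy'
  rcases le_total ((c.rotate x hx).takeUntil y hy').length ℓ with h | h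
  · exact ⟨_, hc'.isPath_takeUntil hy', h, fun e he =>
      hedge e ((c.rotate x hx).edges_takeUntil_subset_edges hy' he)⟩
  · refine ⟨((c.rotate x hx).dropUntil y hy').reverse, ?_, by simp; omega, fun e he => ?_⟩
    · rw [SimpleGraph.Walk.isPath_reverse_iff]
      rw [← hspec] at hc'
      exact hc'.isPath_of_append_right (SimpleGraph.Walk.not_nil_of_ne hxy)
    · rw [SimpleGraph.Walk.edges_reverse, List.mem_reverse] at he
      exact hedge e ((c.rotate x hx).edges_dropUntil_subset_edges hy' he)

/-- The vertices at distance at most `ρ` from `v`. -/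
noncomputable def distBall [Fintype V] (H : SimpleGraph V) (v : V) (ρ : ℕ) : Finset V :=
  Finset.univ.filter fun x => ∃ p : H.Walk v x, p.length ≤ ρ

lemma rk_distBall [Fintype V] {G : SimpleGraph V} (hHG : H ≤ G) (v : V) (ρ : ℕ) :
    Rk G {v} (distBall H v ρ) ρ := by
  refine ⟨fun x => H.dist v x, fun x hx => ?_⟩
  obtain ⟨-, p, hp⟩ := Finset.mem_filter.1 hx
  refine ⟨(SimpleGraph.dist_le p).trans hp, ?_⟩
  obtain ⟨q, hq⟩ := p.reachable.exists_walk_length_eq_dist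
  have hqp : q.length ≤ p.length := hq ▸ SimpleGraph.dist_le p
  by_cases hn : q.Nil
  · exact Or.inl (by simp [hn.eq])
  · have hlen := q.length_dropLast_add_one hn
    refine Or.inr ⟨q.penultimate, Finset.mem_filter.2 ⟨Finset.mem_univ _, q.dropLast, by omega⟩,
      hHG (q.adj_penultimate hn), ?_⟩
    have := SimpleGraph.dist_le q.dropLast
    dsimp only
    omega

end Cycles

section Pieces
open scoped Classical

/-- A flexible link: `v₁, v₂` are joined through `A` by paths of lengths `ℓ - 1` and `ℓ + 1`, and
are the roots of disjoint sets `S₁, S₂` of size `g`. -/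
structure Piece (G : SimpleGraph V) where
  (v₁ v₂ : V)
  (A S₁ S₂ : Finset V)
  (ℓ g : ℕ)
  two_le : 2 ≤ ℓ
  mem₁ : v₁ ∈ S₁
  mem₂ : v₂ ∈ S₂
  disj : Disjoint S₁ S₂
  disj₁ : Disjoint A S₁
  disj₂ : Disjoint A S₂
  card_A : A.card ≤ 2 * ℓ
  card₁ : S₁.card = g
  card₂ : S₂.card = g
  rk₁ : Rk G {v₁} S₁ ℓ
  rk₂ : Rk G {v₂} S₂ ℓ
  short : ∃ p : G.Walk v₁ v₂, p.IsPath ∧ p.length + 1 = ℓ ∧ ∀ x ∈ p.support, x ∈ A ∨ x = v₁ ∨ x = v₂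
  long : ∃ p : G.Walk v₁ v₂, p.IsPath ∧ p.length = ℓ + 1 ∧ ∀ x ∈ p.support, x ∈ A ∨ x = v₁ ∨ x = v₂

/-- All vertices of a piece. -/
noncomputable def Piece.verts {G : SimpleGraph V} (P : Piece G) : Finset V := P.A ∪ (P.S₁ ∪ P.S₂)

/-- A piece with the two sides exchanged. -/
def Piece.swap {G : SimpleGraph V} (P : Piece G) : Piece G where
  v₁ := P.v₂
  v₂ := P.v₁
  A := P.A
  S₁ := P.S₂
  S₂ := P.S₁
  ℓ := P.ℓ
  g := P.g
  two_le := P.two_le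
  mem₁ := P.mem₂
  mem₂ := P.mem₁
  disj := P.disj.symm
  disj₁ := P.disj₂
  disj₂ := P.disj₁
  card_A := P.card_A
  card₁ := P.card₂
  card₂ := P.card₁
  rk₁ := P.rk₂
  rk₂ := P.rk₁
  short := by
    obtain ⟨p, h1, h2, h3⟩ := P.short
    exact ⟨p.reverse, h1.reverse, by simpa using h2, fun x hx => by
      have := h3 x (by simpa using hx)
      tauto⟩
  long := by
    obtain ⟨p, h1, h2, h3⟩ := P.long
    exact ⟨p.reverse, h1.reverse, by simpa using h2, fun x hx => by
      have := h3 x (by simpa using hx)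
      tauto⟩

/-- The subgraph of `G` induced on `Z`, as a graph on all vertices. -/
def within (G : SimpleGraph V) (Z : Finset V) : SimpleGraph V where
  Adj u v := G.Adj u v ∧ u ∈ Z ∧ v ∈ Z
  symm := ⟨fun _ _ h => ⟨h.1.symm, h.2.2, h.2.1⟩⟩
  loopless := ⟨fun _ h => h.1.ne rfl⟩

lemma within_le (G : SimpleGraph V) (Z : Finset V) : within G Z ≤ G := fun _ _ h => h.1

lemma mem_of_mem_support {H : SimpleGraph V} {Z : Finset V} (hZ : ∀ x y, H.Adj x y → y ∈ Z)
    {a b : V} (p : H.Walk a b) (ha : a ∈ Z) : ∀ x ∈ p.support, x ∈ Z := by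
  induction p with
  | nil => simpa
  | cons h p ih =>
    intro x hx
    rw [SimpleGraph.Walk.support_cons, List.mem_cons] at hx
    rcases hx with rfl | hx
    · exact ha
    · exact ih (hZ _ _ h) x hx

lemma even_of_isBip {G : SimpleGraph V} (hG : IsBip G) {a : V} (p : G.Walk a a) :
    Even p.length := by
  obtain ⟨f, hf⟩ := hG
  exact (SimpleGraph.Coloring.even_length_iff_congr
    (SimpleGraph.Coloring.mk f fun {u v} h => hf u v h) p).2 Iff.rfl

variable [Fintype V] {G : SimpleGraph V}

lemma degIn_within {Z : Finset V} {x : V} (hx : x ∈ Z) :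
    degIn (within G Z) Finset.univ x = degIn G Z x := by
  unfold degIn
  congr 1
  ext y
  simp [within, hx, and_comm]

lemma exists_shortest_cycle (hbip : IsBip G) {Z : Finset V} (hZ : Z.Nonempty)
    (hdeg : ∀ x ∈ Z, 3 ≤ degIn G Z x) :
    ∃ (ℓ : ℕ) (a : V) (c : (within G Z).Walk a a), c.IsCycle ∧ c.length = 2 * ℓ ∧ 2 ≤ ℓ ∧ a ∈ Z ∧
      ℓ ≤ Nat.log 2 (Fintype.card V) + 1 ∧ GirthGE (within G Z) (2 * ℓ) := by
  obtain ⟨v, hv⟩ := hZ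
  have hdeg' : ∀ x ∈ Z, 3 ≤ degIn (within G Z) Finset.univ x := fun x hx => by
    rw [degIn_within hx]; exact hdeg x hx
  have hZ' : ∀ x y, (within G Z).Adj x y → y ∈ Z := fun x y h => h.2.2
  have hex : ∃ L, ∃ (a : V) (c : (within G Z).Walk a a), c.IsCycle ∧ c.length = L := by
    by_contra! hno
    have hg : GirthGE (within G Z) (2 * (Fintype.card V + 1) + 1) := fun a c hc =>
      absurd rfl (hno _ a c hc)
    have h1 := two_pow_le_card_pathEnds hg hZ' hdeg' hv (j := Fintype.card V + 1) (by omega)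
    have h2 : (pathEnds (within G Z) v (Fintype.card V + 1)).card ≤ Fintype.card V :=
      Finset.card_le_univ _
    have h3 := Nat.lt_two_pow_self (n := Fintype.card V + 1)
    omega
  obtain ⟨a, c, hc, hl⟩ := Nat.find_spec hex
  have hgirth : GirthGE (within G Z) (Nat.find hex) := fun b c' hc' =>
    Nat.find_min' hex ⟨b, c', hc', rfl⟩
  obtain ⟨ℓ, hℓ⟩ : ∃ ℓ, c.length = 2 * ℓ := by
    have := even_of_isBip hbip (c.mapLe (within_le G Z))
    obtain ⟨r, hr⟩ := this
    refine ⟨r, ?_⟩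
    simp at hr
    omega
  have h3 := hc.three_le_length
  rw [← hl, hℓ] at hgirth
  refine ⟨ℓ, a, c, hc, hℓ, by omega, (c.adj_snd hc.not_nil).2.1, ?_, hgirth⟩
  have h1 := two_pow_le_card_pathEnds hgirth hZ' hdeg' hv (j := ℓ - 1) (by omega)
  have h2 : (pathEnds (within G Z) v (ℓ - 1)).card ≤ Fintype.card V := Finset.card_le_univ _
  have := Nat.le_log_of_pow_le (b := 2) (by norm_num) (h1.trans h2)
  omega

omit [Fintype V] in
lemma exists_star {Z C : Finset V} {v : V} (hv : v ∈ Z) {g : ℕ} (hg : 1 ≤ g)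
    (hd : g + C.card ≤ degIn G Z v + 1) :
    ∃ S ⊆ Z, v ∈ S ∧ S.card = g ∧ Rk G {v} S 1 ∧ ∀ x ∈ S, x ∈ C → x = v := by
  have : g - 1 ≤ (Z.filter (G.Adj v) \ C).card := by
    have := Finset.le_card_sdiff C (Z.filter (G.Adj v))
    unfold degIn at hd
    omega
  obtain ⟨N, hN, hNc⟩ := Finset.exists_subset_card_eq this
  have hmem : ∀ x ∈ N, x ∈ Z ∧ G.Adj v x ∧ x ∉ C := fun x hx => by
    have := hN hx
    simp only [Finset.mem_sdiff, Finset.mem_filter] at this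
    tauto
  have hvN : v ∉ N := fun h => (hmem v h).2.1.ne rfl
  refine ⟨insert v N, ?_, by simp, by rw [Finset.card_insert_of_notMem hvN]; omega, ?_, ?_⟩
  · intro x hx
    rcases Finset.mem_insert.1 hx with rfl | hx
    · exact hv
    · exact (hmem x hx).1
  · refine rk_of_adj (fun x hx => ?_) (by simp)
    rcases Finset.mem_insert.1 hx with rfl | hx
    · simp
    · exact Or.inr ⟨v, by simp, (hmem x hx).2.1⟩
  · intro x hx hxC
    rcases Finset.mem_insert.1 hx with rfl | hx
    · rfl
    · exact absurd hxC (hmem x hx).2.2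

lemma exists_trees {H : SimpleGraph V} {Z : Finset V} {δ ℓ : ℕ} (hHG : H ≤ G)
    (hZ : ∀ x y, H.Adj x y → y ∈ Z) (hδ : 5 ≤ δ) (hdeg : ∀ x ∈ Z, δ ≤ degIn H Finset.univ x)
    {a b : V} {c : H.Walk a a} (hc : c.IsCycle) (hl : c.length = 2 * ℓ) (hℓ : 2 ≤ ℓ)
    (ha : a ∈ Z) (hg : GirthGE H (2 * ℓ)) {q : H.Walk a b} (hq : q.IsPath)
    (hql : q.length + 1 = ℓ) (hqc : ∀ e ∈ q.edges, e ∈ c.edges) (hbc : b ∈ c.support) (hab : a ≠ b)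
    {g : ℕ} (hg1 : 1 ≤ g) (hg2 : g ≤ 2 ^ (ℓ / 2)) :
    ∃ S₁ S₂ : Finset V, S₁ ⊆ Z ∧ S₂ ⊆ Z ∧ a ∈ S₁ ∧ b ∈ S₂ ∧ Disjoint S₁ S₂ ∧ S₁.card = g ∧
      S₂.card = g ∧ Rk G {a} S₁ ℓ ∧ Rk G {b} S₂ ℓ ∧ (∀ x ∈ S₁, x ∈ c.support → x = a) ∧
      ∀ x ∈ S₂, x ∈ c.support → x = b := by
  set H' := H.deleteEdges {e | e ∈ c.edges} with hH'
  have hH'H : H' ≤ H := SimpleGraph.deleteEdges_le _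
  have hadj : ∀ x y, H'.Adj x y ↔ H.Adj x y ∧ s(x, y) ∉ c.edges := fun x y => by
    simp [hH', SimpleGraph.deleteEdges_adj]
  have hlong : ∀ x y : V, x ≠ y → ∀ (p : H'.Walk x y) (r : H.Walk x y), r.IsPath →
      (∀ e ∈ r.edges, e ∈ c.edges) → 2 * ℓ ≤ p.length + r.length := by
    intro x y hxy p r hr hrc
    have hp : (p.bypass.mapLe hH'H).IsPath := p.bypass_isPath.mapLe hH'H
    have hne : p.bypass.mapLe hH'H ≠ r := by
      intro h
      have hnil : ¬ r.Nil := SimpleGraph.Walk.not_nil_of_ne hxy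
      have he : s(x, r.snd) ∈ r.edges := SimpleGraph.Walk.mk_start_snd_mem_edges hnil
      have he' : s(x, r.snd) ∈ (p.bypass.mapLe hH'H).edges := h ▸ he
      rw [SimpleGraph.Walk.edges_mapLe_eq_edges] at he'
      have := p.bypass.adj_of_mem_edges he'
      exact ((hadj _ _).1 this).2 (hrc _ he)
    have h1 := hg.le_add_of_ne hp hr hne
    have h2 := p.length_bypass_le_length
    simp only [SimpleGraph.Walk.length_map] at h1
    omega
  have hZ' : ∀ x y, H'.Adj x y → y ∈ Z := fun x y h => hZ _ _ (hH'H h)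
  have hdeg' : ∀ x ∈ Z, 3 ≤ degIn H' Finset.univ x := by
    intro x hx
    have h1 : degIn H Finset.univ x ≤ degIn H' Finset.univ x +
        (Finset.univ.filter fun y => s(x, y) ∈ c.edges).card := by
      unfold degIn
      refine (Finset.card_le_card ?_).trans (Finset.card_union_le _ _)
      intro y hy
      replace hy := (Finset.mem_filter.1 hy).2
      by_cases h : s(x, y) ∈ c.edges
      · exact Finset.mem_union_right _ (by simpa using h)
      · exact Finset.mem_union_left _ (by simpa using (hadj x y).2 ⟨hy, h⟩)
    have h2 : (Finset.univ.filter fun y => s(x, y) ∈ c.edges).card ≤ 2 := by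
      by_cases hxc : x ∈ c.support
      · rw [← hc.ncard_neighborSet_toSubgraph_eq_two hxc, ← Set.ncard_coe_finset]
        refine le_of_eq (congrArg _ ?_)
        ext y
        simp [SimpleGraph.Subgraph.mem_neighborSet, SimpleGraph.Walk.adj_toSubgraph_iff_mem_edges]
      · rw [Finset.card_eq_zero.2]
        · omega
        · refine Finset.filter_eq_empty_iff.2 fun y _ h => hxc ?_
          exact c.fst_mem_support_of_mem_edges h
    have h3 := hdeg x hx
    omega
  have hball : ∀ v ∈ Z, v ∈ c.support → ∃ S ⊆ distBall H' v (ℓ / 2), S ⊆ Z ∧ v ∈ S ∧ S.card = g ∧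
      Rk G {v} S ℓ ∧ ∀ x ∈ S, x ∈ c.support → x = v := by
    intro v hv hvc
    have h1 := two_pow_le_card_pathEnds (hg.mono hH'H) hZ' hdeg' hv (j := ℓ / 2) (by omega)
    have h2 : pathEnds H' v (ℓ / 2) ⊆ distBall H' v (ℓ / 2) := by
      intro x hx
      obtain ⟨-, p, -, hp⟩ := Finset.mem_filter.1 hx
      exact Finset.mem_filter.2 ⟨Finset.mem_univ _, p, hp.le⟩
    obtain ⟨S, hS, hvS, hSc, hR⟩ := exists_rk_trim (rk_distBall (hH'H.trans hHG) v (ℓ / 2))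
      (Finset.mem_filter.2 ⟨Finset.mem_univ _, .nil, by simp⟩) hg1
      (hg2.trans (h1.trans (Finset.card_le_card h2)))
    refine ⟨S, hS, fun x hx => ?_, hvS, hSc, rk_mono subset_rfl (Nat.div_le_self _ _) hR, ?_⟩
    · obtain ⟨-, p, -⟩ := Finset.mem_filter.1 (hS hx)
      exact mem_of_mem_support hZ' p hv x (by simp)
    · intro x hx hxc
      by_contra hne
      obtain ⟨-, p, hp⟩ := Finset.mem_filter.1 (hS hx)
      obtain ⟨r, hr, hrl, hrc⟩ := exists_short_path_on_cycle hc hl hvc hxc (Ne.symm hne)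
      have := hlong v x (Ne.symm hne) p r hr hrc
      omega
  obtain ⟨S₁, h11, h12, h13, h14, h15, h16⟩ := hball a ha (by simp)
  obtain ⟨S₂, h21, h22, h23, h24, h25, h26⟩ := hball b (mem_of_mem_support hZ c ha b hbc) hbc
  refine ⟨S₁, S₂, h12, h22, h13, h23, ?_, h14, h24, h15, h25, h16, h26⟩
  refine Finset.disjoint_left.2 fun z hz₁ hz₂ => ?_
  obtain ⟨-, p₁, hp₁⟩ := Finset.mem_filter.1 (h11 hz₁)
  obtain ⟨-, p₂, hp₂⟩ := Finset.mem_filter.1 (h21 hz₂)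
  have := hlong a b hab (p₁.append p₂.reverse) q hq hqc
  simp only [SimpleGraph.Walk.length_append, SimpleGraph.Walk.length_reverse] at this
  omega

lemma exists_piece (hbip : IsBip G) {Z : Finset V} (hZ : Z.Nonempty) {δ : ℕ} (hδ : 5 ≤ δ)
    (hdeg : ∀ x ∈ Z, δ ≤ degIn G Z x) :
    ∃ ℓ, 2 ≤ ℓ ∧ ℓ ≤ Nat.log 2 (Fintype.card V) + 1 ∧ ∀ g, 1 ≤ g →
      (2 * g + 2 * ℓ ≤ δ ∨ g ≤ 2 ^ (ℓ / 2)) → ∃ P : Piece G, P.ℓ = ℓ ∧ P.g = g ∧ P.verts ⊆ Z := by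
  obtain ⟨ℓ, a, c, hc, hl, hℓ, ha, hℓn, hg⟩ := exists_shortest_cycle hbip hZ fun x hx =>
    le_trans (by omega) (hdeg x hx)
  refine ⟨ℓ, hℓ, hℓn, fun g hg1 hor => ?_⟩
  have hHG := within_le G Z
  have hZ' : ∀ x y, (within G Z).Adj x y → y ∈ Z := fun x y h => h.2.2
  have hdeg' : ∀ x ∈ Z, δ ≤ degIn (within G Z) Finset.univ x := fun x hx => by
    rw [degIn_within hx]; exact hdeg x hx
  have hdeg'' : ∀ x ∈ Z, δ ≤ degIn G Z x := hdeg
  generalize within G Z = H at *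
  have key : ∀ (b : V) (p : H.Walk a b) (q : H.Walk b a), p.append q = c → p.length + 1 = ℓ →
      ∃ P : Piece G, P.ℓ = ℓ ∧ P.g = g ∧ P.verts ⊆ Z := by
    rintro b p q rfl hpl
    have hql : q.length = ℓ + 1 := by
      rw [SimpleGraph.Walk.length_append] at hl
      omega
    have hp : p.IsPath := hc.isPath_of_append_left (by
      rw [← SimpleGraph.Walk.length_eq_zero_iff]; omega)
    have hq : q.IsPath := hc.isPath_of_append_right (by
      rw [← SimpleGraph.Walk.length_eq_zero_iff]; omega)
    have hab : a ≠ b := by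
      rintro rfl
      rw [SimpleGraph.Walk.isPath_iff_nil] at hp
      have := SimpleGraph.Walk.length_eq_zero_iff.2 hp
      omega
    have hcZ := mem_of_mem_support hZ' (p.append q) ha
    have hbc : b ∈ (p.append q).support := by simp
    have hCc : (p.append q).support.toFinset.card ≤ 2 * ℓ := by
      have h : (p.append q).support.toFinset ⊆ (p.append q).support.tail.toFinset := by
        intro x hx
        rw [List.mem_toFinset, SimpleGraph.Walk.mem_support_iff] at hx
        rw [List.mem_toFinset]
        rcases hx with rfl | hx
        · exact SimpleGraph.Walk.end_mem_tail_support hc.not_nil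
        · exact hx
      refine (Finset.card_le_card h).trans ((List.toFinset_card_le _).trans ?_)
      rw [List.length_tail, SimpleGraph.Walk.length_support, hl]
      omega
    obtain ⟨S₁, S₂, h1Z, h2Z, h1, h2, h12, h1c, h2c, hR1, hR2, h1C, h2C⟩ :
        ∃ S₁ S₂ : Finset V, S₁ ⊆ Z ∧ S₂ ⊆ Z ∧ a ∈ S₁ ∧ b ∈ S₂ ∧ Disjoint S₁ S₂ ∧ S₁.card = g ∧
        S₂.card = g ∧ Rk G {a} S₁ ℓ ∧ Rk G {b} S₂ ℓ ∧
        (∀ x ∈ S₁, x ∈ (p.append q).support → x = a) ∧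
        ∀ x ∈ S₂, x ∈ (p.append q).support → x = b := by
      rcases hor with hor | hor
      · obtain ⟨S₁, h1Z, h1, h1c, hR1, h1C⟩ := exists_star (G := G) (Z := Z)
          (C := (p.append q).support.toFinset) (v := a) ha hg1 (by have := hdeg'' a ha; omega)
        have hb := hcZ b hbc
        obtain ⟨S₂, h2Z, h2, h2c, hR2, h2C⟩ := exists_star (G := G) (Z := Z)
          (C := (p.append q).support.toFinset ∪ S₁) (v := b) hb hg1 (by
            have := hdeg'' b hb
            have := Finset.card_union_le (p.append q).support.toFinset S₁
            omega)
        refine ⟨S₁, S₂, h1Z, h2Z, h1, h2, ?_, h1c, h2c, rk_mono subset_rfl (by omega) hR1,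
          rk_mono subset_rfl (by omega) hR2, fun x hx h => h1C x hx (by simpa using h),
          fun x hx h => h2C x hx (Finset.mem_union_left _ (by simpa using h))⟩
        refine Finset.disjoint_left.2 fun z hz1 hz2 => hab ?_
        have := h2C z hz2 (Finset.mem_union_right _ hz1)
        subst this
        exact (h1C z hz1 (by simp)).symm
      · exact exists_trees hHG hZ' hδ hdeg' hc hl hℓ ha hg hp hpl
          (fun e he => by simp [SimpleGraph.Walk.edges_append, he]) hbc hab hg1 hor
    have hA1 : Disjoint ((p.append q).support.toFinset \ {a, b}) S₁ :=
      Finset.disjoint_left.2 fun z hz hz1 => by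
        simp only [Finset.mem_sdiff, List.mem_toFinset, Finset.mem_insert,
          Finset.mem_singleton, not_or] at hz
        exact hz.2.1 (h1C z hz1 hz.1)
    have hA2 : Disjoint ((p.append q).support.toFinset \ {a, b}) S₂ :=
      Finset.disjoint_left.2 fun z hz hz1 => by
        simp only [Finset.mem_sdiff, List.mem_toFinset, Finset.mem_insert,
          Finset.mem_singleton, not_or] at hz
        exact hz.2.2 (h2C z hz1 hz.1)
    refine ⟨⟨a, b, (p.append q).support.toFinset \ {a, b}, S₁, S₂, ℓ, g, hℓ, h1, h2, h12, hA1, hA2,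
      (Finset.card_le_card Finset.sdiff_subset).trans hCc, h1c, h2c, hR1, hR2,
      ⟨p.mapLe hHG, hp.mapLe hHG, by simpa using hpl, fun x hx => ?_⟩,
      ⟨(q.mapLe hHG).reverse, (hq.mapLe hHG).reverse, by simpa using hql, fun x hx => ?_⟩⟩,
      rfl, rfl, ?_⟩
    · have : x ∈ p.support := by simpa using hx
      simp [SimpleGraph.Walk.mem_support_append_iff, this]
      tauto
    · have : x ∈ q.support := by simpa using hx
      simp [SimpleGraph.Walk.mem_support_append_iff, this]
      tauto
    · refine Finset.union_subset (fun x hx => hcZ x ?_) (Finset.union_subset h1Z h2Z)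
      simpa using (Finset.mem_sdiff.1 hx).1
  exact key _ (c.take (ℓ - 1)) (c.drop (ℓ - 1)) (c.append_take_drop_eq _) (by
    rw [SimpleGraph.Walk.take_length]
    omega)

end Pieces

section Stuck
open scoped Classical

lemma card_powerset_card_le (W : Finset V) (k : ℕ) :
    (W.powerset.filter fun R => R.card ≤ k).card ≤ (W.card + 1) ^ k := by
  induction k with
  | zero =>
    rw [pow_zero, Finset.card_le_one]
    intro a ha b hb
    simp only [Finset.mem_filter, nonpos_iff_eq_zero, Finset.card_eq_zero] at ha hb
    rw [ha.2, hb.2]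
  | succ k ih =>
    have hsub : (W.powerset.filter fun R => R.card ≤ k + 1) ⊆
        (W.powerset.filter fun R => R.card ≤ k) ∪
          (W ×ˢ W.powerset.filter fun R => R.card ≤ k).image fun p => insert p.1 p.2 := by
      intro R hR
      simp only [Finset.mem_filter, Finset.mem_powerset] at hR
      by_cases h : R.card ≤ k
      · exact Finset.mem_union_left _ (by simp [hR.1, h])
      · obtain ⟨x, hx⟩ : R.Nonempty := Finset.card_pos.1 (by omega)
        refine Finset.mem_union_right _ (Finset.mem_image.2 ⟨(x, R.erase x), ?_, by simp [hx]⟩)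
        simp only [Finset.mem_product, Finset.mem_filter, Finset.mem_powerset,
          Finset.card_erase_of_mem hx]
        exact ⟨hR.1 hx, (Finset.erase_subset _ _).trans hR.1, by omega⟩
    have h1 := (Finset.card_le_card hsub).trans (Finset.card_union_le _ _)
    have h2 := Finset.card_image_le (s := W ×ˢ W.powerset.filter fun R => R.card ≤ k)
      (f := fun p => insert p.1 p.2)
    rw [Finset.card_product] at h2
    calc _ ≤ _ := h1
      _ ≤ (W.card + 1) ^ k + W.card * (W.card + 1) ^ k :=
        Nat.add_le_add ih (h2.trans (Nat.mul_le_mul_left _ ih))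
      _ = _ := by ring

variable [Fintype V] {G : SimpleGraph V}

/-- Disjoint union of many copies of a set whose neighbourhood is mostly the same violates local
expansion, so there are only few sets with few neighbours outside `W`. -/
lemma card_stuck_le {ι : Type*} {e s₀ s₁ N : ℕ} {W : Finset V}
    (hloc : ∀ s, s₀ ≤ s → ∀ X : Finset V, X.card = s * (s * e) → X.card ≤ N →
      s * e * (1 + Nat.sqrt (64 * s)) < (nb G X).card)
    (hN : s₁ * (s₁ * e) ≤ N) (I : Finset ι) (S : ι → Finset V)
    (hdis : ∀ i ∈ I, ∀ j ∈ I, i ≠ j → Disjoint (S i) (S j))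
    (h₀ : ∀ i ∈ I, s₀ ≤ (S i).card) (h₁ : ∀ i ∈ I, (S i).card < s₁)
    (hdeg : ∀ i ∈ I, ∀ x ∈ S i, degIn G W x ≤ e)
    (hout : ∀ i ∈ I, (nb G (S i) \ W).card ^ 2 ≤ 64 * (S i).card) :
    I.card ≤ s₁ * (W.card + 1) ^ (s₁ * e) * (s₁ * e) := by
  by_contra! hlt
  set types := Finset.range s₁ ×ˢ W.powerset.filter fun R => R.card ≤ s₁ * e with htypes
  have hR : ∀ i ∈ I, (nb G (S i) ∩ W).card ≤ (S i).card * e := by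
    intro i hi
    have : nb G (S i) ∩ W ⊆ (S i).biUnion fun x => W.filter (G.Adj x) := by
      intro v hv
      obtain ⟨hv, hvW⟩ := Finset.mem_inter.1 hv
      obtain ⟨-, x, hx, hxv⟩ := mem_nb.1 hv
      exact Finset.mem_biUnion.2 ⟨x, hx, Finset.mem_filter.2 ⟨hvW, hxv⟩⟩
    exact (Finset.card_le_card this).trans
      (Finset.card_biUnion_le_card_mul _ _ _ fun x hx => hdeg i hi x hx)
  have hmaps : ∀ i ∈ I, ((S i).card, nb G (S i) ∩ W) ∈ types := by
    intro i hi
    have h := h₁ i hi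
    simp only [htypes, Finset.mem_product, Finset.mem_range, Finset.mem_filter,
      Finset.mem_powerset]
    exact ⟨h, Finset.inter_subset_right, (hR i hi).trans (Nat.mul_le_mul_right _ h.le)⟩
  have hcard : types.card ≤ s₁ * (W.card + 1) ^ (s₁ * e) := by
    rw [htypes, Finset.card_product, Finset.card_range]
    exact Nat.mul_le_mul_left _ (card_powerset_card_le _ _)
  obtain ⟨⟨s, R⟩, -, hfib⟩ := Finset.exists_lt_card_fiber_of_mul_lt_card_of_maps_to hmaps
    (lt_of_le_of_lt (Nat.mul_le_mul_right _ hcard) hlt)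
  have hfib' : s * e ≤ (I.filter fun i => ((S i).card, nb G (S i) ∩ W) = (s, R)).card := by
    obtain ⟨i, hi⟩ := Finset.card_pos.1 (lt_of_le_of_lt (Nat.zero_le _) hfib)
    simp only [Finset.mem_filter, Prod.mk.injEq] at hi
    have := h₁ i hi.1
    exact (Nat.mul_le_mul_right _ (by omega)).trans hfib.le
  obtain ⟨J, hJ, hJc⟩ := Finset.exists_subset_card_eq hfib'
  have hJm : ∀ i ∈ J, i ∈ I ∧ (S i).card = s ∧ nb G (S i) ∩ W = R := fun i hi => by
    have := hJ hi
    simpa only [Finset.mem_filter, Prod.mk.injEq] using this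
  obtain ⟨i₀, hi₀⟩ := Finset.card_pos.1 (lt_of_le_of_lt (Nat.zero_le _) hfib)
  simp only [Finset.mem_filter, Prod.mk.injEq] at hi₀
  obtain ⟨hi₀, hs, hsR⟩ := hi₀
  have hX : (J.biUnion S).card = s * (s * e) := by
    rw [Finset.card_biUnion fun i hi j hj => hdis i (hJm i hi).1 j (hJm j hj).1,
      Finset.sum_congr rfl fun i hi => (hJm i hi).2.1, Finset.sum_const, hJc, smul_eq_mul]
    ring
  have hs₁ : s ≤ s₁ := by have := h₁ i₀ hi₀; omega
  have hlower := hloc s (by have := h₀ i₀ hi₀; omega) _ hX (by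
    rw [hX]
    exact (Nat.mul_le_mul hs₁ (Nat.mul_le_mul_right _ hs₁)).trans hN)
  have hupper : (nb G (J.biUnion S)).card ≤ s * e + s * e * Nat.sqrt (64 * s) := by
    have hsub : nb G (J.biUnion S) ⊆ R ∪ J.biUnion fun i => nb G (S i) \ W := by
      intro v hv
      obtain ⟨hvX, x, hx, hxv⟩ := mem_nb.1 hv
      obtain ⟨i, hi, hxi⟩ := Finset.mem_biUnion.1 hx
      have hvi : v ∈ nb G (S i) :=
        mem_nb.2 ⟨fun h => hvX (Finset.mem_biUnion.2 ⟨i, hi, h⟩), x, hxi, hxv⟩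
      by_cases hvW : v ∈ W
      · refine Finset.mem_union_left _ ?_
        rw [← (hJm i hi).2.2]
        exact Finset.mem_inter.2 ⟨hvi, hvW⟩
      · exact Finset.mem_union_right _
          (Finset.mem_biUnion.2 ⟨i, hi, Finset.mem_sdiff.2 ⟨hvi, hvW⟩⟩)
    refine (Finset.card_le_card hsub).trans ((Finset.card_union_le _ _).trans ?_)
    refine Nat.add_le_add ?_ ?_
    · rw [← hsR, ← hs]
      exact hR i₀ hi₀
    · rw [← hJc]
      refine Finset.card_biUnion_le_card_mul _ _ _ fun i hi => ?_
      rw [Nat.le_sqrt', ← (hJm i hi).2.1]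
      exact hout i (hJm i hi).1
  rw [Nat.mul_add, mul_one] at hlower
  omega

lemma exists_stuck {O W Y : Finset V} {ℓ o t₀ : ℕ}
    (hcon : ∀ t, (nb G (grow G (W ∪ O) Y t) ∩ O).card ≤ o + t) (ho : o ≤ 4 * (ℓ + 1))
    (hY : (ℓ + 1) ^ 2 ≤ Y.card) (hlt : (grow G (W ∪ O) Y t₀).card < t₀ ^ 2) :
    ∃ t ≤ t₀, (nb G (grow G (W ∪ O) Y t) \ W).card ^ 2 ≤ 64 * (grow G (W ∪ O) Y t).card := by
  have hex : ∃ t, (grow G (W ∪ O) Y t).card < Y.card + t ^ 2 := ⟨t₀, by omega⟩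
  have hle := Nat.find_min' hex (show (grow G (W ∪ O) Y t₀).card < Y.card + t₀ ^ 2 by omega)
  have hspec := Nat.find_spec hex
  obtain ⟨t, ht⟩ : ∃ t, Nat.find hex = t + 1 := by
    refine Nat.exists_eq_succ_of_ne_zero fun h => ?_
    rw [h] at hspec
    simp at hspec
  have hmin := Nat.find_min hex (m := t) (by omega)
  rw [ht] at hspec
  refine ⟨t, by omega, ?_⟩
  have hsub : nb G (grow G (W ∪ O) Y t) \ W ⊆ (nb G (grow G (W ∪ O) Y t) ∩ O) ∪
      (grow G (W ∪ O) Y (t + 1) \ grow G (W ∪ O) Y t) := by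
    intro v hv
    obtain ⟨hv, hvW⟩ := Finset.mem_sdiff.1 hv
    obtain ⟨hvg, x, hx, hxv⟩ := mem_nb.1 hv
    by_cases hvO : v ∈ O
    · exact Finset.mem_union_left _ (Finset.mem_inter.2 ⟨hv, hvO⟩)
    · exact Finset.mem_union_right _ (Finset.mem_sdiff.2
        ⟨mem_grow_succ.2 (Or.inr ⟨by simp [hvW, hvO], x, hx, hxv⟩), hvg⟩)
  have hc := (Finset.card_le_card hsub).trans (Finset.card_union_le _ _)
  rw [Finset.card_sdiff_of_subset (grow_mono_time _ _ (Nat.le_succ t))] at hc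
  simp only [Nat.succ_eq_add_one] at hc
  have h1 := hcon t
  have h3 : (t + 1) ^ 2 = t ^ 2 + 2 * t + 1 := by ring
  have hw : (nb G (grow G (W ∪ O) Y t) \ W).card ≤ 4 * (ℓ + 1) + 3 * t := by omega
  calc _ ≤ (4 * (ℓ + 1) + 3 * t) ^ 2 := Nat.pow_le_pow_left hw 2
    _ ≤ 64 * ((ℓ + 1) ^ 2 + t ^ 2) := by nlinarith [sq_nonneg ((ℓ + 1 : ℤ) - t)]
    _ ≤ _ := by omega

lemma grow_subset_grow_sdiff {O W Y H : Finset V} {t : ℕ} (h : Disjoint (grow G (W ∪ O) Y t) H) :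
    grow G (W ∪ O) Y t ⊆ grow G (W ∪ H) (Y \ H) t := by
  induction t with
  | zero =>
    intro x hx
    exact Finset.mem_sdiff.2 ⟨hx, Finset.disjoint_left.1 h hx⟩
  | succ t ih =>
    intro x hx
    have ih := ih (h.mono_left (grow_subset_succ _ _ _))
    rcases mem_grow_succ.1 hx with hx' | ⟨hxO, y, hy, hyx⟩
    · exact grow_subset_succ _ _ _ (ih hx')
    · refine mem_grow_succ.2 (Or.inr ⟨?_, y, ih hy, hyx⟩)
      have := Finset.disjoint_left.1 h hx
      simp only [Finset.mem_union, not_or] at hxO ⊢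
      exact ⟨hxO.1, this⟩

end Stuck

section Far
open scoped Classical

/-- The relative sizes of the two scales used for polylogarithmic (`μ`) and for larger (`u`)
quantities. -/
structure Scale (μ u : ℕ) : Prop where
  le_μ : 64 ≤ μ
  pow_le : μ ^ 30 ≤ u
  pow_le_two_pow : u ^ 20 ≤ 2 ^ μ

lemma Scale.pow_le_u {μ u : ℕ} (hs : Scale μ u) {k : ℕ} (hk : k ≤ 30) : μ ^ k ≤ u :=
  (Nat.pow_le_pow_right (by have := hs.le_μ; omega) hk).trans hs.pow_le

lemma Scale.le_u {μ u : ℕ} (hs : Scale μ u) : 64 ≤ u :=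
  hs.le_μ.trans ((pow_one μ).symm.le.trans (hs.pow_le_u (by norm_num)))

lemma Scale.stuck_add_lt {μ u w e : ℕ} (hs : Scale μ u) (hw : w + 1 ≤ u ^ 5) (he : e ≤ μ ^ 5) :
    μ ^ 6 * (w + 1) ^ (μ ^ 6 * e) * (μ ^ 6 * e) + w ^ 2 + u ^ 6 < u ^ (μ ^ 12) := by
  have hu := hs.le_u
  have hμ := hs.le_μ
  have he' : μ ^ 6 * e ≤ μ ^ 11 := by
    calc μ ^ 6 * e ≤ μ ^ 6 * μ ^ 5 := Nat.mul_le_mul_left _ he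
      _ = μ ^ 11 := by ring
  have h11 : 64 ^ 11 ≤ μ ^ 11 := Nat.pow_le_pow_left hμ 11
  have h1 : μ ^ 6 * (w + 1) ^ (μ ^ 6 * e) * (μ ^ 6 * e) ≤ u ^ (5 * μ ^ 11 + 2) := by
    calc _ ≤ u * (u ^ 5) ^ (μ ^ 11) * u := by
          gcongr
          · exact hs.pow_le_u (by norm_num)
          · exact Nat.one_le_pow _ _ (by omega)
          · exact he'.trans (hs.pow_le_u (by norm_num))
      _ = _ := by rw [← pow_mul, ← pow_succ', ← pow_succ]
  have h2 : w ^ 2 ≤ u ^ (5 * μ ^ 11 + 2) := by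
    calc w ^ 2 ≤ (u ^ 5) ^ 2 := Nat.pow_le_pow_left (by omega) 2
      _ = u ^ 10 := by rw [← pow_mul]
      _ ≤ _ := Nat.pow_le_pow_right (by omega) (by omega)
  have h3 : u ^ 6 ≤ u ^ (5 * μ ^ 11 + 2) := Nat.pow_le_pow_right (by omega) (by omega)
  calc _ ≤ u ^ (5 * μ ^ 11 + 2) * 3 := by omega
    _ < u ^ (5 * μ ^ 11 + 2) * u :=
      Nat.mul_lt_mul_of_pos_left (by omega) (Nat.pow_pos (by omega))
    _ = u ^ (5 * μ ^ 11 + 3) := (pow_succ _ _).symm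
    _ ≤ u ^ (μ ^ 12) := by
      refine Nat.pow_le_pow_right (by omega) ?_
      calc 5 * μ ^ 11 + 3 ≤ μ ^ 11 * 64 := by omega
        _ ≤ μ ^ 11 * μ := Nat.mul_le_mul_left _ hμ
        _ = μ ^ 12 := by ring

variable [Fintype V] {G : SimpleGraph V}

/-- The vertices with at least `Δ` neighbours outside `W`. -/
noncomputable def high (G : SimpleGraph V) (W : Finset V) (Δ : ℕ) : Finset V :=
  Finset.univ.filter fun x => x ∉ W ∧ Δ ≤ degIn G (Finset.univ \ W) x

lemma le_card_grow_succ_of_high {W O Y : Finset V} {Δ c t : ℕ} {x : V} (hx : x ∈ high G W Δ)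
    (hxg : x ∈ grow G (W ∪ O) Y t) (hcon : (nb G (grow G (W ∪ O) Y t) ∩ O).card ≤ c) :
    Δ ≤ (grow G (W ∪ O) Y (t + 1)).card + c := by
  have h := (Finset.mem_filter.1 hx).2.2
  refine h.trans (le_trans (Finset.card_le_card (t := grow G (W ∪ O) Y (t + 1) ∪
    (nb G (grow G (W ∪ O) Y t) ∩ O)) fun v hv => ?_)
    ((Finset.card_union_le _ _).trans (Nat.add_le_add_left hcon _)))
  obtain ⟨hvW, hxv⟩ := Finset.mem_filter.1 hv
  have hvW := (Finset.mem_sdiff.1 hvW).2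
  by_cases hvg : v ∈ grow G (W ∪ O) Y t
  · exact Finset.mem_union_left _ (grow_subset_succ _ _ _ hvg)
  by_cases hvO : v ∈ O
  · exact Finset.mem_union_right _ (Finset.mem_inter.2 ⟨mem_nb.2 ⟨hvg, x, hxg, hxv⟩, hvO⟩)
  · exact Finset.mem_union_left _ (mem_grow_succ.2 (Or.inr ⟨by simp [hvW, hvO], x, hxg, hxv⟩))

lemma exists_large_grow_of_far {ι : Type*} {μ u κ k e s₀ : ℕ} (hs : Scale μ u)
    (hexp : Expands G κ (u ^ 20) μ) (hκ : κ ≤ u ^ 2) (hfree : ¬ ContainsBalSub G k 2)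
    (hke : k ≤ e) (he : e ≤ μ ^ 5)
    (hloc : ∀ s, s₀ ≤ s → ∀ X : Finset V, X.card = s * (s * e) → X.card ≤ u ^ 20 →
      s * e * (1 + Nat.sqrt (64 * s)) < (nb G X).card)
    {W : Finset V} (hW : W.card + 1 ≤ u ^ 5) (I : Finset ι) (hI : u ^ (μ ^ 12) ≤ I.card)
    (Y O : ι → Finset V) (ℓ : ι → ℕ) (hYW : ∀ i ∈ I, Disjoint (Y i) W)
    (hℓ : ∀ i ∈ I, ℓ i ≤ μ)
    (hcon : ∀ i ∈ I, ∀ t, (nb G (grow G (W ∪ O i) (Y i) t) ∩ O i).card ≤ 4 * (ℓ i + 1) + t)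
    (hY : ∀ i ∈ I, (ℓ i + 1) ^ 2 ≤ (Y i).card) (hY₀ : ∀ i ∈ I, s₀ ≤ (Y i).card)
    (hfar : ∀ i ∈ I, ∀ j ∈ I, i ≠ j →
      Disjoint (grow G (W ∪ high G W (u ^ 5)) (Y i \ high G W (u ^ 5)) (μ ^ 3))
        (grow G (W ∪ high G W (u ^ 5)) (Y j \ high G W (u ^ 5)) (μ ^ 3))) :
    ∃ i ∈ I, u ^ 4 ≤ (grow G (W ∪ O i) (Y i) (μ ^ 4)).card := by
  have hu := hs.le_u
  have hμ := hs.le_μ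
  have hμ2 : 0 < μ ^ 2 := Nat.pow_pos (by omega)
  have hμ3 : 0 < μ ^ 3 := Nat.pow_pos (by omega)
  have hμ1 : μ ^ 3 + 2 * μ * μ ≤ μ ^ 4 := by nlinarith
  by_contra! hlt
  set H := high G W (u ^ 5) with hH
  have hlow : ∀ i ∈ I, Disjoint (grow G (W ∪ O i) (Y i) (μ ^ 3)) H := by
    intro i hi
    refine Finset.disjoint_left.2 fun x hx hxH => ?_
    have h1 := le_card_grow_succ_of_high hxH hx (hcon i hi (μ ^ 3))
    have h2 : (grow G (W ∪ O i) (Y i) (μ ^ 3 + 1)).card < u ^ 4 :=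
      lt_of_le_of_lt (Finset.card_le_card (grow_mono_time _ _ (by nlinarith))) (hlt i hi)
    have h3 := hℓ i hi
    have h4 : 4 * (ℓ i + 1) + μ ^ 3 ≤ u ^ 4 := by
      calc _ ≤ μ ^ 4 := by nlinarith
        _ ≤ u := hs.pow_le_u (by norm_num)
        _ ≤ u ^ 4 := Nat.le_self_pow (by norm_num) _
    have h5 : u ^ 5 = u ^ 4 * u := pow_succ _ _
    have h6 : u ^ 4 * 64 ≤ u ^ 4 * u := Nat.mul_le_mul_left _ hu
    omega
  have hsub : ∀ i ∈ I, grow G (W ∪ O i) (Y i) (μ ^ 3) ⊆ grow G (W ∪ H) (Y i \ H) (μ ^ 3) :=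
    fun i hi => grow_subset_grow_sdiff (hlow i hi)
  have hdis : ∀ i ∈ I, ∀ j ∈ I, i ≠ j →
      Disjoint (grow G (W ∪ O i) (Y i) (μ ^ 3)) (grow G (W ∪ O j) (Y j) (μ ^ 3)) :=
    fun i hi j hj hij => (hfar i hi j hj hij).mono (hsub i hi) (hsub j hj)
  set big := I.filter fun i => μ ^ 6 ≤ (grow G (W ∪ O i) (Y i) (μ ^ 3)).card with hbig
  set small := I.filter fun i => ¬ μ ^ 6 ≤ (grow G (W ∪ O i) (Y i) (μ ^ 3)).card with hsmall
  have hbigc : big.card < u ^ 6 := by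
    by_contra! hge
    obtain ⟨J, hJ, hJc⟩ := Finset.exists_subset_card_eq hge
    have hJm : ∀ i ∈ J, i ∈ I ∧ μ ^ 6 ≤ (grow G (W ∪ O i) (Y i) (μ ^ 3)).card := fun i hi => by
      have := hJ hi
      simpa only [hbig, Finset.mem_filter] using this
    have hJB : u ^ 6 * μ ^ 6 ≤ (J.biUnion fun i => grow G (W ∪ O i) (Y i) (μ ^ 3)).card := by
      rw [Finset.card_biUnion fun i hi j hj => hdis i (hJm i hi).1 j (hJm j hj).1, ← hJc,
        ← smul_eq_mul]
      exact Finset.card_nsmul_le_sum _ _ _ fun i hi => (hJm i hi).2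
    have hu6 : 0 < u ^ 6 := Nat.pow_pos (by omega)
    have hmono : u ^ 5 ≤ u ^ 6 := Nat.pow_le_pow_right (by omega) (by norm_num)
    obtain ⟨i, hi, hbigi⟩ := exists_large_grow hexp (by omega) J
      (Finset.card_pos.1 (by omega)) W
      (fun i => grow G (W ∪ O i) (Y i) (μ ^ 3)) O (fun i => 4 * (ℓ i + 1) + μ ^ 3)
      (T := u ^ 4) (j := μ) (B := u ^ 6 * μ ^ 6) (fun i hi t => by
        rw [grow_add]
        have := hcon i (hJm i hi).1 (μ ^ 3 + t)
        omega) hJB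
      (by
        calc κ ≤ u ^ 2 := hκ
          _ ≤ u ^ 6 := Nat.pow_le_pow_right (by omega) (by norm_num)
          _ ≤ _ := Nat.le_mul_of_pos_right _ (Nat.pow_pos (by omega)))
      (by
        have hsum : ∑ i ∈ J, (4 * (ℓ i + 1) + μ ^ 3) ≤ u ^ 6 * (μ ^ 3 + 5 * μ) := by
          rw [← hJc, ← smul_eq_mul]
          refine Finset.sum_le_card_nsmul _ _ _ fun i hi => ?_
          have := hℓ i (hJm i hi).1
          omega
        calc 2 * μ * (W.card + ∑ i ∈ J, (4 * (ℓ i + 1) + μ ^ 3))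
            ≤ 2 * μ * (u ^ 6 + u ^ 6 * (μ ^ 3 + 5 * μ)) :=
              Nat.mul_le_mul_left _ (Nat.add_le_add (by omega) hsum)
          _ = u ^ 6 * (2 * μ * (1 + μ ^ 3 + 5 * μ)) := by ring
          _ ≤ u ^ 6 * μ ^ 6 := by
            refine Nat.mul_le_mul_left _ ?_
            calc 2 * μ * (1 + μ ^ 3 + 5 * μ) ≤ μ ^ 2 * μ ^ 4 := by
                  refine Nat.mul_le_mul (by nlinarith) ?_
                  nlinarith
              _ = μ ^ 6 := by ring)
      (by
        rw [hJc, mul_comm]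
        refine Nat.mul_le_mul_left _ ?_
        calc 4 * μ ^ 2 ≤ μ * μ ^ 2 := Nat.mul_le_mul_right _ (by omega)
          _ = μ ^ 3 := by ring
          _ ≤ μ ^ 6 := Nat.pow_le_pow_right (by omega) (by norm_num))
      (by
        rw [hJc]
        calc u ^ 6 * (u ^ 4 - 1) ≤ u ^ 6 * u ^ 4 := Nat.mul_le_mul_left _ (Nat.sub_le _ _)
          _ = u ^ 10 := by ring
          _ ≤ _ := Nat.pow_le_pow_right (by omega) (by norm_num))
      (by
        rw [hJc]
        refine Nat.mul_le_mul (Nat.le_mul_of_pos_right _ (Nat.pow_pos (by omega))) ?_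
        exact (Nat.pow_le_pow_right (by omega) (by norm_num)).trans hs.pow_le_two_pow)
      (Nat.pow_pos (by omega))
    rw [grow_add] at hbigi
    have := hlt i (hJm i hi).1
    have := Finset.card_le_card (grow_mono_time (G := G) (W ∪ O i) (Y i) hμ1)
    omega
  obtain ⟨Heavy, hHeavy⟩ : ∃ P : ι → Prop, ∀ i, P i ↔
      ∃ x ∈ grow G (W ∪ O i) (Y i) (μ ^ 3), k ≤ degIn G W x := ⟨_, fun _ => Iff.rfl⟩
  set heavy := small.filter Heavy with hheavy
  have hheavyc : heavy.card ≤ W.card ^ 2 := by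
    have hex : ∀ i, ∃ x, i ∈ heavy → x ∈ grow G (W ∪ O i) (Y i) (μ ^ 3) ∧ k ≤ degIn G W x := by
      intro i
      by_cases hi : i ∈ heavy
      · obtain ⟨x, hx⟩ := (hHeavy i).1 (Finset.mem_filter.1 hi).2
        exact ⟨x, fun _ => hx⟩
      · by_cases hV : Nonempty V
        · exact ⟨hV.some, fun h => absurd h hi⟩
        · exfalso
          have hIp : 0 < I.card := lt_of_lt_of_le (Nat.pow_pos (by omega)) hI
          obtain ⟨j, hj⟩ := Finset.card_pos.1 hIp
          have h1 := hY j hj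
          have h2 : 0 < (Y j).card := lt_of_lt_of_le (Nat.pow_pos (by omega)) h1
          obtain ⟨y, -⟩ := Finset.card_pos.1 h2
          exact hV ⟨y⟩
    choose f hf using hex
    refine le_trans ?_ (card_heavy_le_sq hfree W)
    refine Finset.card_le_card_of_injOn f (fun i hi => ?_) (fun i hi j hj hij => ?_)
    · have hiI : i ∈ I := (Finset.mem_filter.1 (Finset.mem_filter.1 hi).1).1
      have hd : Disjoint (grow G W (Y i) (μ ^ 3)) W := grow_disjoint (hYW i hiI) _
      have := Finset.disjoint_left.1 hd
        (grow_mono (Finset.subset_union_left (s₂ := O i)) subset_rfl _ (hf i hi).1)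
      simpa using ⟨this, (hf i hi).2⟩
    · by_contra hne
      have hiI : i ∈ I := (Finset.mem_filter.1 (Finset.mem_filter.1 hi).1).1
      have hjI : j ∈ I := (Finset.mem_filter.1 (Finset.mem_filter.1 hj).1).1
      exact Finset.disjoint_left.1 (hdis i hiI j hjI hne) (hf i hi).1 (hij ▸ (hf j hj).1)
  have hrest : (small \ heavy).card ≤ μ ^ 6 * (W.card + 1) ^ (μ ^ 6 * e) * (μ ^ 6 * e) := by
    have hm : ∀ i ∈ small \ heavy, i ∈ I ∧
        (grow G (W ∪ O i) (Y i) (μ ^ 3)).card < (μ ^ 3) ^ 2 ∧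
        ∀ x ∈ grow G (W ∪ O i) (Y i) (μ ^ 3), degIn G W x ≤ e := by
      intro i hi
      obtain ⟨hi1, hi2⟩ := Finset.mem_sdiff.1 hi
      obtain ⟨hi3, hi4⟩ := Finset.mem_filter.1 hi1
      refine ⟨hi3, by rw [← pow_mul]; exact not_le.1 hi4, fun x hx => ?_⟩
      by_contra! hgt
      exact hi2 (Finset.mem_filter.2 ⟨hi1, (hHeavy i).2 ⟨x, hx, by omega⟩⟩)
    have hst : ∀ i, ∃ t ≤ μ ^ 3, i ∈ small \ heavy →
        (nb G (grow G (W ∪ O i) (Y i) t) \ W).card ^ 2 ≤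
          64 * (grow G (W ∪ O i) (Y i) t).card := by
      intro i
      by_cases hi : i ∈ small \ heavy
      · obtain ⟨hiI, hi1, -⟩ := hm i hi
        obtain ⟨t, ht, h⟩ := exists_stuck (hcon i hiI) le_rfl (hY i hiI) hi1
        exact ⟨t, ht, fun _ => h⟩
      · exact ⟨0, Nat.zero_le _, fun h => absurd h hi⟩
    choose τ hτ hτs using hst
    have hsubτ : ∀ i, grow G (W ∪ O i) (Y i) (τ i) ⊆ grow G (W ∪ O i) (Y i) (μ ^ 3) :=
      fun i => grow_mono_time _ _ (hτ i)
    refine card_stuck_le hloc (N := u ^ 20) ?_ (small \ heavy)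
      (fun i => grow G (W ∪ O i) (Y i) (τ i)) ?_ ?_ ?_ ?_ ?_
    · calc μ ^ 6 * (μ ^ 6 * e) ≤ μ ^ 6 * (μ ^ 6 * μ ^ 5) := by gcongr
        _ = μ ^ 17 := by ring
        _ ≤ u := hs.pow_le_u (by norm_num)
        _ ≤ _ := Nat.le_self_pow (by norm_num) _
    · exact fun i hi j hj hij =>
        (hdis i (hm i hi).1 j (hm j hj).1 hij).mono (hsubτ i) (hsubτ j)
    · exact fun i hi => (hY₀ i (hm i hi).1).trans (Finset.card_le_card (subset_grow _ _ _))
    · intro i hi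
      have := (hm i hi).2.1
      rw [← pow_mul] at this
      exact lt_of_le_of_lt (Finset.card_le_card (hsubτ i)) this
    · exact fun i hi x hx => (hm i hi).2.2 x (hsubτ i hx)
    · exact fun i hi => hτs i hi
  have h1 : big.card + small.card = I.card := Finset.card_filter_add_card_filter_not _
  have h2 := Finset.le_card_sdiff heavy small
  have h3 := hs.stuck_add_lt hW he
  omega

end Far

section Family
open scoped Classical

lemma four_pow_le_two_pow {j : ℕ} (hj : 32 ≤ j) : (2 * j + 2) ^ 4 ≤ 2 ^ j := by
  induction j, hj using Nat.le_induction with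
  | base => norm_num
  | succ j hj ih =>
    rw [pow_succ 2 j]
    have h2 : 4 * (2 * (j + 1) + 2) ^ 2 ≤ 5 * (2 * j + 2) ^ 2 := by nlinarith
    have h3 := Nat.mul_le_mul h2 h2
    have h4 : (2 * (j + 1) + 2) ^ 4 = (2 * (j + 1) + 2) ^ 2 * (2 * (j + 1) + 2) ^ 2 := by ring
    have h5 : (2 * j + 2) ^ 4 = (2 * j + 2) ^ 2 * (2 * j + 2) ^ 2 := by ring
    rw [h4]
    rw [h5] at ih
    nlinarith

lemma two_pow_ge_sq {ℓ : ℕ} (hℓ : 23 ≤ ℓ) : (ℓ + 1) ^ 2 ≤ 2 ^ (ℓ / 2) := by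
  have key : ∀ j, 11 ≤ j → (2 * j + 2) ^ 2 ≤ 2 ^ j := by
    intro j hj
    induction j, hj using Nat.le_induction with
    | base => norm_num
    | succ j hj ih =>
      rw [pow_succ 2 j]
      nlinarith
  exact (Nat.pow_le_pow_left (by omega) 2).trans (key (ℓ / 2) (by omega))

lemma two_pow_ge_cube {μ ℓ : ℕ} (hμ : 64 ≤ μ) (hℓ : μ < ℓ) : μ ^ 3 * (ℓ + 1) ≤ 2 ^ (ℓ / 2) := by
  refine le_trans ?_ (four_pow_le_two_pow (j := ℓ / 2) (by omega))
  calc μ ^ 3 * (ℓ + 1) ≤ (2 * (ℓ / 2) + 2) ^ 3 * (2 * (ℓ / 2) + 2) := by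
        exact Nat.mul_le_mul (Nat.pow_le_pow_left (by omega) 3) (by omega)
    _ = _ := by ring

lemma exists_sequence {α : Type*} (verts low : α → Finset V) (Good : α → Prop) {b w N : ℕ}
    (hlow : ∀ a, Good a → (low a).card ≤ b)
    (h : ∀ W : Finset V, W.card ≤ w → ∃ a, Good a ∧ Disjoint (verts a) W) (W : Finset V)
    (hN : W.card + N * b ≤ w) :
    ∃ P : ℕ → α, ∀ i < N, Good (P i) ∧ Disjoint (verts (P i)) W ∧
      ∀ j < i, Disjoint (verts (P i)) (low (P j)) := by
  induction N with
  | zero =>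
    obtain ⟨a, -⟩ := h W (by simpa using hN)
    exact ⟨fun _ => a, fun i hi => absurd hi (by omega)⟩
  | succ N ih =>
    rw [Nat.add_mul, one_mul] at hN
    obtain ⟨P, hP⟩ := ih (by omega)
    obtain ⟨a, ha, haW⟩ := h (W ∪ (Finset.range N).biUnion fun i => low (P i)) (by
      have h1 : ((Finset.range N).biUnion fun i => low (P i)).card ≤ N * b := by
        have := Finset.card_biUnion_le_card_mul (Finset.range N) (fun i => low (P i)) b
          fun i hi => hlow _ (hP i (Finset.mem_range.1 hi)).1
        simpa using this
      have := Finset.card_union_le W ((Finset.range N).biUnion fun i => low (P i))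
      omega)
    rw [Finset.disjoint_union_right] at haW
    refine ⟨Function.update P N a, fun i hi => ?_⟩
    rcases Nat.lt_succ_iff_lt_or_eq.1 hi with hi | rfl
    · rw [Function.update_of_ne hi.ne]
      refine ⟨(hP i hi).1, (hP i hi).2.1, fun j hj => ?_⟩
      rw [Function.update_of_ne (hj.trans hi).ne]
      exact (hP i hi).2.2 j hj
    · rw [Function.update_self]
      refine ⟨ha, haW.1, fun j hj => ?_⟩
      rw [Function.update_of_ne hj.ne]
      exact haW.2.mono_right (Finset.subset_biUnion_of_mem (fun i => low (P i))
        (Finset.mem_range.2 hj))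

variable [Fintype V] {G : SimpleGraph V}

lemma card_grow_low_le {W Y : Finset V} {Δ : ℕ} (hY : Disjoint Y (W ∪ high G W Δ)) (t : ℕ) :
    (grow G (W ∪ high G W Δ) Y t).card ≤ Y.card * (Δ + 1) ^ t := by
  induction t with
  | zero => simp
  | succ t ih =>
    have hsub : grow G (W ∪ high G W Δ) Y (t + 1) ⊆ grow G (W ∪ high G W Δ) Y t ∪
        (grow G (W ∪ high G W Δ) Y t).biUnion fun x => (Finset.univ \ W).filter (G.Adj x) := by
      intro v hv
      rcases mem_grow_succ.1 hv with hv | ⟨hvO, x, hx, hxv⟩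
      · exact Finset.mem_union_left _ hv
      · refine Finset.mem_union_right _ (Finset.mem_biUnion.2 ⟨x, hx, ?_⟩)
        simp only [Finset.mem_union, not_or] at hvO
        simpa [hxv] using hvO.1
    have hb : ((grow G (W ∪ high G W Δ) Y t).biUnion fun x =>
        (Finset.univ \ W).filter (G.Adj x)).card ≤ (grow G (W ∪ high G W Δ) Y t).card * Δ := by
      refine Finset.card_biUnion_le_card_mul _ _ _ fun x hx => ?_
      have h1 := Finset.disjoint_left.1 (grow_disjoint hY t) hx
      simp only [Finset.mem_union, not_or, high, Finset.mem_filter, Finset.mem_univ, true_and,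
        not_and, not_le] at h1
      exact (h1.2 h1.1).le
    calc _ ≤ _ := Finset.card_le_card hsub
      _ ≤ (grow G (W ∪ high G W Δ) Y t).card + (grow G (W ∪ high G W Δ) Y t).card * Δ :=
        (Finset.card_union_le _ _).trans (Nat.add_le_add_left hb _)
      _ = (grow G (W ∪ high G W Δ) Y t).card * (Δ + 1) := by ring
      _ ≤ Y.card * (Δ + 1) ^ t * (Δ + 1) := Nat.mul_le_mul_right _ ih
      _ = _ := by ring

lemma exists_large_grow_of_large {ι : Type*} {μ u κ : ℕ} (hs : Scale μ u)
    (hexp : Expands G κ (u ^ 20) μ) (hκ : κ ≤ u ^ 2) {W : Finset V} (hW : W.card + 1 ≤ u ^ 5)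
    (I : Finset ι) (hI : u ^ 6 ≤ I.card) (Y O : ι → Finset V) (ℓ : ι → ℕ)
    (hcon : ∀ i ∈ I, ∀ t, (nb G (grow G (W ∪ O i) (Y i) t) ∩ O i).card ≤ 4 * (ℓ i + 1) + t)
    (hY : ∀ i ∈ I, μ ^ 3 * (ℓ i + 1) ≤ (Y i).card)
    (hdis : ∀ i ∈ I, ∀ j ∈ I, i ≠ j → Disjoint (Y i) (Y j)) :
    ∃ i ∈ I, u ^ 4 ≤ (grow G (W ∪ O i) (Y i) (μ ^ 4)).card := by
  have hu := hs.le_u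
  have hμ := hs.le_μ
  have hμ2 : 0 < μ ^ 2 := Nat.pow_pos (by omega)
  have hμ3 : 0 < μ ^ 3 := Nat.pow_pos (by omega)
  have hμ1 : 2 * μ * μ ≤ μ ^ 4 := by nlinarith
  obtain ⟨J, hJ, hJc⟩ := Finset.exists_subset_card_eq hI
  set S := ∑ i ∈ J, (ℓ i + 1) with hS
  have hSJ : u ^ 6 ≤ S := by
    rw [← hJc, Finset.card_eq_sum_ones]
    exact Finset.sum_le_sum fun i _ => Nat.le_add_left _ _
  have hmono : u ^ 5 ≤ u ^ 6 := Nat.pow_le_pow_right (by omega) (by norm_num)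
  have hu6 : 0 < u ^ 6 := Nat.pow_pos (by omega)
  obtain ⟨i, hi, hbig⟩ := exists_large_grow hexp (by omega) J (Finset.card_pos.1 (by omega)) W Y O
    (fun i => 4 * (ℓ i + 1)) (T := u ^ 4) (j := μ) (B := μ ^ 3 * S)
    (fun i hi => hcon i (hJ hi))
    (by
      rw [Finset.card_biUnion fun i hi j hj => hdis i (hJ hi) j (hJ hj), hS, Finset.mul_sum]
      exact Finset.sum_le_sum fun i hi => hY i (hJ hi))
    (by
      calc κ ≤ u ^ 2 := hκ
        _ ≤ u ^ 6 := Nat.pow_le_pow_right (by omega) (by norm_num)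
        _ ≤ S := hSJ
        _ ≤ _ := Nat.le_mul_of_pos_left _ hμ3)
    (by
      rw [← Finset.mul_sum, ← hS]
      calc 2 * μ * (W.card + 4 * S) ≤ 2 * μ * (5 * S) := Nat.mul_le_mul_left _ (by omega)
        _ = 10 * μ * S := by ring
        _ ≤ μ ^ 3 * S := by
          refine Nat.mul_le_mul_right _ ?_
          nlinarith)
    (by
      rw [hJc]
      refine Nat.mul_le_mul ?_ hSJ
      nlinarith)
    (by
      rw [hJc]
      calc u ^ 6 * (u ^ 4 - 1) ≤ u ^ 6 * u ^ 4 := Nat.mul_le_mul_left _ (Nat.sub_le _ _)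
        _ = u ^ 10 := by ring
        _ ≤ _ := Nat.pow_le_pow_right (by omega) (by norm_num))
    (by
      rw [hJc]
      refine Nat.mul_le_mul (hSJ.trans (Nat.le_mul_of_pos_left _ hμ3)) ?_
      exact (Nat.pow_le_pow_right (by omega) (by norm_num)).trans hs.pow_le_two_pow)
    (Nat.pow_pos (by omega))
  exact ⟨i, hJ hi, hbig.trans (Finset.card_le_card (grow_mono_time _ _ hμ1))⟩

end Family

section Growing
open scoped Classical

lemma Piece.card_verts_le {G : SimpleGraph V} (P : Piece G) : P.verts.card ≤ 2 * P.ℓ + 2 * P.g := by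
  have h1 := Finset.card_union_le P.A (P.S₁ ∪ P.S₂)
  have h2 := Finset.card_union_le P.S₁ P.S₂
  have h3 := P.card_A
  have h4 := P.card₁
  have h5 := P.card₂
  unfold Piece.verts
  omega

lemma Piece.sides_subset {G : SimpleGraph V} (P : Piece G) : P.S₁ ∪ P.S₂ ⊆ P.verts :=
  Finset.subset_union_right

lemma Scale.large_sum_le {μ u w : ℕ} (hs : Scale μ u) (hw : w + 1 ≤ u ^ 5) :
    w + 2 * u ^ (μ ^ 12) * u ^ 3 ≤ u ^ (μ ^ 13) := by
  have hu := hs.le_u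
  have hμ := hs.le_μ
  have h12 : 5 ≤ μ ^ 12 := le_trans (by omega) (Nat.le_self_pow (by norm_num) μ)
  calc w + 2 * u ^ (μ ^ 12) * u ^ 3 ≤ u ^ (μ ^ 12) * u ^ 3 + 2 * u ^ (μ ^ 12) * u ^ 3 := by
        refine Nat.add_le_add_right ?_ _
        have h1 : u ^ 5 ≤ u ^ (μ ^ 12) := Nat.pow_le_pow_right (by omega) h12
        have h2 : u ^ (μ ^ 12) ≤ u ^ (μ ^ 12) * u ^ 3 :=
          Nat.le_mul_of_pos_right _ (Nat.pow_pos (by omega))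
        omega
    _ = u ^ (μ ^ 12) * u ^ 3 * 3 := by ring
    _ ≤ u ^ (μ ^ 12) * u ^ 3 * u := Nat.mul_le_mul_left _ (by omega)
    _ = u ^ (μ ^ 12 + 4) := by rw [← pow_add, ← pow_succ]
    _ ≤ u ^ (μ ^ 13) := by
      refine Nat.pow_le_pow_right (by omega) ?_
      calc μ ^ 12 + 4 ≤ μ ^ 12 * 2 := by omega
        _ ≤ μ ^ 12 * μ := Nat.mul_le_mul_left _ (by omega)
        _ = μ ^ 13 := by ring

lemma Scale.far_sum_le {μ u w : ℕ} (hs : Scale μ u) (hw : w + 1 ≤ u ^ 5) :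
    w + 2 * u ^ (μ ^ 12) * (μ ^ 6 * (u ^ 5 + 1) ^ (2 * μ ^ 3) + μ ^ 6) ≤ u ^ (μ ^ 13) := by
  have hu := hs.le_u
  have hμ := hs.le_μ
  have h1 : μ ^ 6 * (u ^ 5 + 1) ^ (2 * μ ^ 3) + μ ^ 6 ≤ u ^ (12 * μ ^ 3 + 2) := by
    calc _ ≤ u * (u ^ 6) ^ (2 * μ ^ 3) + u * (u ^ 6) ^ (2 * μ ^ 3) := by
          have h6 := hs.pow_le_u (k := 6) (by norm_num)
          refine Nat.add_le_add (Nat.mul_le_mul h6 (Nat.pow_le_pow_left ?_ _))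
            (h6.trans (Nat.le_mul_of_pos_right _ (Nat.pow_pos (Nat.pow_pos (by omega)))))
          rw [pow_succ u 5]
          have : 0 < u ^ 5 := Nat.pow_pos (by omega)
          nlinarith
      _ = (u ^ 6) ^ (2 * μ ^ 3) * u * 2 := by ring
      _ ≤ (u ^ 6) ^ (2 * μ ^ 3) * u * u := Nat.mul_le_mul_left _ (by omega)
      _ = u ^ (6 * (2 * μ ^ 3) + 2) := by rw [← pow_mul]; ring
      _ = _ := by congr 1; ring
  have h2 : w + 2 * u ^ (μ ^ 12) * u ^ (12 * μ ^ 3 + 2) ≤ u ^ (μ ^ 12 + 12 * μ ^ 3 + 3) := by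
    have h12 : 5 ≤ μ ^ 12 := le_trans (by omega) (Nat.le_self_pow (by norm_num) μ)
    have h1 : u ^ 5 ≤ u ^ (μ ^ 12) := Nat.pow_le_pow_right (by omega) h12
    have h2 : u ^ (μ ^ 12) ≤ u ^ (μ ^ 12) * u ^ (12 * μ ^ 3 + 2) :=
      Nat.le_mul_of_pos_right _ (Nat.pow_pos (by omega))
    calc _ ≤ u ^ (μ ^ 12) * u ^ (12 * μ ^ 3 + 2) * 3 := by
          rw [mul_assoc]
          omega
      _ ≤ u ^ (μ ^ 12) * u ^ (12 * μ ^ 3 + 2) * u := Nat.mul_le_mul_left _ (by omega)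
      _ = _ := by rw [← pow_add, ← pow_succ]; ring
  refine (Nat.add_le_add_left (Nat.mul_le_mul_left _ h1) _).trans (h2.trans ?_)
  refine Nat.pow_le_pow_right (by omega) ?_
  have h3 : μ ^ 3 ≤ μ ^ 12 := Nat.pow_le_pow_right (by omega) (by norm_num)
  have h4 : 0 < μ ^ 12 := Nat.pow_pos (by omega)
  calc μ ^ 12 + 12 * μ ^ 3 + 3 ≤ μ ^ 12 * 64 := by omega
    _ ≤ μ ^ 12 * μ := Nat.mul_le_mul_left _ hμ
    _ = μ ^ 13 := by ring

variable [Fintype V]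

/-- There are `2 * Q` pieces avoiding `W` such that, among any `Q` of them, some side (or both
sides together) grows to size `T` within `s` steps, even if obstacles touching its neighbourhoods
in few vertices are removed. -/
def GrowingFamily (G : SimpleGraph V) (W : Finset V) (lmax Q T s : ℕ) : Prop :=
  ∃ P : ℕ → Piece G,
    (∀ i < 2 * Q, Disjoint (P i).verts W ∧ (P i).ℓ ≤ lmax) ∧
    ∀ I ⊆ Finset.range (2 * Q), Q ≤ I.card → ∀ Y O : ℕ → Finset V,
      (∀ i ∈ I, Y i ⊆ (P i).S₁ ∪ (P i).S₂ ∧ (P i).g ≤ (Y i).card) →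
      (∀ i ∈ I, ∀ t, (nb G (grow G (W ∪ O i) (Y i) t) ∩ O i).card ≤ 4 * ((P i).ℓ + 1) + t) →
      ∃ i ∈ I, T ≤ (grow G (W ∪ O i) (Y i) s).card

variable {G : SimpleGraph V}

lemma disjoint_grow_of_disjoint_grow {X Y₁ Y₂ : Finset V} {t : ℕ} (hX : Disjoint Y₂ X)
    (h : Disjoint Y₂ (grow G X Y₁ (t + t))) : Disjoint (grow G X Y₁ t) (grow G X Y₂ t) := by
  refine Finset.disjoint_left.2 fun z hz₁ hz₂ => ?_
  obtain ⟨y, hy, hyz⟩ := exists_mem_grow_reverse hX hz₂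
  refine Finset.disjoint_left.1 h hy ?_
  rw [← grow_add]
  exact grow_mono subset_rfl (Finset.singleton_subset_iff.2 hz₁) _ hyz

lemma exists_growing_family {μ u κ k e lmax : ℕ} (hs : Scale μ u)
    (hexp : Expands G κ (u ^ 20) μ) (hκ : κ ≤ u ^ 2) (hfree : ¬ ContainsBalSub G k 2)
    (hke : k ≤ e) (he : 12696 ≤ e) (hlmax : lmax + 1 ≤ u)
    (hloc : e ≤ μ ^ 5 → ∀ s, e / 8 / 3 ≤ s → ∀ X : Finset V, X.card = s * (s * e) →
      X.card ≤ u ^ 20 → s * e * (1 + Nat.sqrt (64 * s)) < (nb G X).card)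
    (hsup : ∀ W : Finset V, W.card ≤ u ^ (μ ^ 14) → ∃ ℓ, ℓ ≤ lmax ∧ ∀ g, 1 ≤ g →
      (2 * g + 2 * ℓ ≤ e / 8 ∨ g ≤ 2 ^ (ℓ / 2)) →
        ∃ P : Piece G, P.ℓ = ℓ ∧ P.g = g ∧ Disjoint P.verts W)
    {W : Finset V} (hW : W.card + 1 ≤ u ^ 5) :
    GrowingFamily G W lmax (u ^ (μ ^ 12)) (u ^ 4) (μ ^ 4) := by
  have hu := hs.le_u
  have hμ := hs.le_μ
  by_cases hA : ∀ W' : Finset V, W'.card ≤ u ^ (μ ^ 13) →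
      ∃ P : Piece G, (P.ℓ ≤ lmax ∧ P.g = μ ^ 3 * (P.ℓ + 1)) ∧ Disjoint P.verts W'
  · obtain ⟨P, hP⟩ := exists_sequence (fun P : Piece G => P.verts) (fun P => P.verts)
      (fun P => P.ℓ ≤ lmax ∧ P.g = μ ^ 3 * (P.ℓ + 1)) (b := u ^ 3) (fun P hP => by
        refine P.card_verts_le.trans ?_
        rw [hP.2]
        have h1 : μ ^ 3 * (P.ℓ + 1) ≤ u * u :=
          Nat.mul_le_mul (hs.pow_le_u (by norm_num)) (by omega)
        have h2 : u * u * 64 ≤ u * u * u := Nat.mul_le_mul_left _ hu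
        have h3 : u ^ 3 = u * u * u := by ring
        have h4 : u ≤ u * u := Nat.le_mul_of_pos_left _ (by omega)
        omega) hA W (N := 2 * u ^ (μ ^ 12)) (hs.large_sum_le hW)
    refine ⟨P, fun i hi => ⟨(hP i hi).2.1, (hP i hi).1.1⟩, fun I hI hIc Y O hY hcon => ?_⟩
    have hI' : ∀ i ∈ I, i < 2 * u ^ (μ ^ 12) := fun i hi => Finset.mem_range.1 (hI hi)
    have hd : ∀ i ∈ I, ∀ j ∈ I, j < i → Disjoint (Y i) (Y j) := fun i hi j hj hji =>
      ((hP i (hI' i hi)).2.2 j hji).mono ((hY i hi).1.trans (P i).sides_subset)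
        ((hY j hj).1.trans (P j).sides_subset)
    refine exists_large_grow_of_large hs hexp hκ hW I (le_trans ?_ hIc) Y O (fun i => (P i).ℓ) hcon
      (fun i hi => ?_) (fun i hi j hj hij => ?_)
    · exact Nat.pow_le_pow_right (by omega)
        (le_trans (by omega) (Nat.le_self_pow (by norm_num) μ))
    · rw [← (hP i (hI' i hi)).1.2]
      exact (hY i hi).2
    · rcases lt_or_gt_of_ne hij with h | h
      · exact (hd j hj i hi h).symm
      · exact hd i hi j hj h
  · push Not at hA
    obtain ⟨W₀, hW₀, hno⟩ := hA
    have h14 : 2 * u ^ (μ ^ 13) ≤ u ^ (μ ^ 14) := by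
      calc 2 * u ^ (μ ^ 13) ≤ u * u ^ (μ ^ 13) := Nat.mul_le_mul_right _ (by omega)
        _ = u ^ (μ ^ 13 + 1) := (pow_succ' u (μ ^ 13)).symm
        _ ≤ _ := by
          refine Nat.pow_le_pow_right (by omega) ?_
          have : 0 < μ ^ 13 := Nat.pow_pos (by omega)
          rw [pow_succ μ 13]
          nlinarith
    have hsmall : ∀ W' : Finset V, W'.card ≤ u ^ (μ ^ 13) → ∃ ℓ, (ℓ ≤ lmax ∧ ∀ g, 1 ≤ g →
        (2 * g + 2 * ℓ ≤ e / 8 ∨ g ≤ 2 ^ (ℓ / 2)) →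
          ∃ P : Piece G, P.ℓ = ℓ ∧ P.g = g ∧ Disjoint P.verts W') ∧ ℓ ≤ μ ∧
          e / 8 < 2 * (μ ^ 3 * (ℓ + 1)) + 2 * ℓ := by
      intro W' hW'
      obtain ⟨ℓ, hℓ, h⟩ := hsup (W' ∪ W₀) ((Finset.card_union_le _ _).trans (by omega))
      have hnot : ¬ (2 * (μ ^ 3 * (ℓ + 1)) + 2 * ℓ ≤ e / 8 ∨ μ ^ 3 * (ℓ + 1) ≤ 2 ^ (ℓ / 2)) := by
        intro hor
        obtain ⟨P, h1, h2, h3⟩ := h _ (Nat.mul_pos (Nat.pow_pos (by omega)) (by omega)) hor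
        exact hno P ⟨by omega, by rw [h2, h1]⟩ (h3.mono_right Finset.subset_union_right)
      push Not at hnot
      refine ⟨ℓ, ⟨hℓ, fun g hg hor => ?_⟩, ?_, hnot.1⟩
      · obtain ⟨P, h1, h2, h3⟩ := h g hg hor
        exact ⟨P, h1, h2, h3.mono_right Finset.subset_union_left⟩
      · by_contra! hlt
        exact absurd (two_pow_ge_cube hμ hlt) (not_le.2 hnot.2)
    have heμ : e ≤ μ ^ 5 := by
      obtain ⟨ℓ, -, hℓμ, hlt⟩ := hsmall ∅ (by simp)
      have h1 : μ ^ 3 * (ℓ + 1) ≤ μ ^ 3 * (μ + 1) := Nat.mul_le_mul_left _ (by omega)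
      have h3 : μ ≤ μ ^ 3 := Nat.le_self_pow (by norm_num) μ
      have h4 : e ≤ 32 * (μ ^ 3 * (μ + 1)) := by
        have : μ ^ 3 * 64 ≤ μ ^ 3 * (μ + 1) := Nat.mul_le_mul_left _ (by omega)
        omega
      calc e ≤ 32 * (μ ^ 3 * (μ + 1)) := h4
        _ ≤ μ ^ 3 * (μ * μ) := by
          rw [← mul_assoc, mul_comm 32, mul_assoc]
          refine Nat.mul_le_mul_left _ ?_
          nlinarith
        _ = μ ^ 5 := by ring
    set s₀ := e / 8 / 3 with hs₀
    obtain ⟨P, hP⟩ := exists_sequence (fun P : Piece G => P.verts)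
      (fun P => grow G (W ∪ high G W (u ^ 5)) (P.verts \ (W ∪ high G W (u ^ 5))) (μ ^ 3 + μ ^ 3))
      (fun P => P.ℓ ≤ lmax ∧ P.ℓ ≤ μ ∧ P.g = max s₀ ((P.ℓ + 1) ^ 2))
      (b := μ ^ 6 * (u ^ 5 + 1) ^ (2 * μ ^ 3) + μ ^ 6) (w := u ^ (μ ^ 13)) (fun P hP => by
        refine le_trans ?_ (Nat.le_add_right _ _)
        refine (card_grow_low_le Finset.sdiff_disjoint _).trans ?_
        rw [← two_mul]
        refine Nat.mul_le_mul_right _ ((Finset.card_le_card Finset.sdiff_subset).trans ?_)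
        refine P.card_verts_le.trans ?_
        rw [hP.2.2]
        have h1 : (P.ℓ + 1) ^ 2 ≤ (μ + 1) ^ 2 := Nat.pow_le_pow_left (by omega) 2
        have h2 : (μ + 1) ^ 2 ≤ μ ^ 5 := by
          calc (μ + 1) ^ 2 ≤ (μ * μ) ^ 2 := Nat.pow_le_pow_left (by nlinarith) 2
            _ = μ ^ 4 := by ring
            _ ≤ _ := Nat.pow_le_pow_right (by omega) (by norm_num)
        have h3 : max s₀ ((P.ℓ + 1) ^ 2) ≤ μ ^ 5 := max_le (by omega) (h1.trans h2)
        have h4 : μ ≤ μ ^ 5 := Nat.le_self_pow (by norm_num) μ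
        have h5 : μ ^ 5 * 64 ≤ μ ^ 6 := by
          rw [pow_succ μ 5]
          exact Nat.mul_le_mul_left _ hμ
        omega)
      (fun W' hW' => by
        obtain ⟨ℓ, ⟨hℓ, h⟩, hℓμ, -⟩ := hsmall W' hW'
        obtain ⟨P, h1, h2, h3⟩ := h (max s₀ ((ℓ + 1) ^ 2))
          (le_max_of_le_right (Nat.pow_pos (by omega))) (by
            rcases le_or_gt ((ℓ + 1) ^ 2) s₀ with hle | hle
            · rw [max_eq_left hle]
              left
              have : 2 * ℓ ≤ (ℓ + 1) ^ 2 := by nlinarith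
              omega
            · rw [max_eq_right hle.le]
              right
              refine two_pow_ge_sq ?_
              by_contra! hlt
              have : (ℓ + 1) ^ 2 ≤ 23 ^ 2 := Nat.pow_le_pow_left (by omega) 2
              omega)
        exact ⟨P, ⟨by omega, by omega, by rw [h2, h1]⟩, h3⟩) W (N := 2 * u ^ (μ ^ 12))
      (hs.far_sum_le hW)
    refine ⟨P, fun i hi => ⟨(hP i hi).2.1, (hP i hi).1.1⟩, fun I hI hIc Y O hY hcon => ?_⟩
    have hI' : ∀ i ∈ I, i < 2 * u ^ (μ ^ 12) := fun i hi => Finset.mem_range.1 (hI hi)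
    have hYv : ∀ i ∈ I, Y i ⊆ (P i).verts := fun i hi => (hY i hi).1.trans (P i).sides_subset
    have hYW : ∀ i ∈ I, Disjoint (Y i) W := fun i hi => (hP i (hI' i hi)).2.1.mono_left (hYv i hi)
    have hYd : ∀ i ∈ I, Disjoint (Y i \ high G W (u ^ 5)) (W ∪ high G W (u ^ 5)) := fun i hi =>
      Finset.disjoint_union_right.2
        ⟨(hYW i hi).mono_left Finset.sdiff_subset, Finset.sdiff_disjoint⟩
    have hfar : ∀ i ∈ I, ∀ j ∈ I, i < j →
        Disjoint (grow G (W ∪ high G W (u ^ 5)) (Y i \ high G W (u ^ 5)) (μ ^ 3))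
          (grow G (W ∪ high G W (u ^ 5)) (Y j \ high G W (u ^ 5)) (μ ^ 3)) := by
      intro i hi j hj hij
      refine disjoint_grow_of_disjoint_grow (hYd j hj) ?_
      refine ((hP j (hI' j hj)).2.2 i hij).mono (Finset.sdiff_subset.trans (hYv j hj))
        (grow_mono subset_rfl (fun x hx => Finset.mem_sdiff.2
          ⟨hYv i hi (Finset.mem_sdiff.1 hx).1, Finset.disjoint_left.1 (hYd i hi) hx⟩) _)
    refine exists_large_grow_of_far hs hexp hκ hfree hke heμ (hloc heμ) hW I hIc Y O
      (fun i => (P i).ℓ) hYW (fun i hi => (hP i (hI' i hi)).1.2.1) hcon (fun i hi => ?_)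
      (fun i hi => ?_) (fun i hi j hj hij => ?_)
    · exact le_trans (by rw [(hP i (hI' i hi)).1.2.2]; exact le_max_right _ _) (hY i hi).2
    · exact le_trans (by rw [(hP i (hI' i hi)).1.2.2]; exact le_max_left _ _) (hY i hi).2
    · rcases lt_or_gt_of_ne hij with h | h
      · exact hfar i hi j hj h
      · exact (hfar j hj i hi h).symm

end Growing

section Gadgets
open scoped Classical

/-- An adjuster avoiding `U` with ends `v₁, v₂`: the sets `F₁, F₂` rooted at the ends have size `M`
and radius `ρ`, and `r` is the range of adjustment of the set `A`. -/
structure IsGadget (G : SimpleGraph V) (U : Finset V) (M ρ r : ℕ) (v₁ v₂ : V)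
    (F₁ F₂ A : Finset V) : Prop where
  mem₁ : v₁ ∈ F₁
  mem₂ : v₂ ∈ F₂
  disj₁ : Disjoint A F₁
  disj₂ : Disjoint A F₂
  disj : Disjoint F₁ F₂
  avoid : Disjoint A U
  avoid₁ : Disjoint F₁ U
  avoid₂ : Disjoint F₂ U
  card₁ : F₁.card = M
  card₂ : F₂.card = M
  rk₁ : Rk G {v₁} F₁ ρ
  rk₂ : Rk G {v₂} F₂ ρ
  paths : ∃ ℓ : ℕ, ∀ i ≤ r, ∃ p : G.Walk v₁ v₂, p.IsPath ∧ p.length = ℓ + 2 * i ∧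
    ∀ x ∈ p.support, x ∈ A ∨ x = v₁ ∨ x = v₂

/-- The existence of an adjuster avoiding `U` whose adjusting set has at most `a` elements. -/
def Gadget (G : SimpleGraph V) (U : Finset V) (M ρ a r : ℕ) : Prop :=
  ∃ (v₁ v₂ : V) (F₁ F₂ A : Finset V), IsGadget G U M ρ r v₁ v₂ F₁ F₂ A ∧ A.card ≤ a

variable {G : SimpleGraph V}

lemma gadget_of_le {U F₁ F₂ A : Finset V} {M ρ a r ℓ : ℕ} {v₁ v₂ : V} (hM : 1 ≤ M)
    (h₁ : v₁ ∈ F₁) (h₂ : v₂ ∈ F₂) (hA₁ : Disjoint A F₁) (hA₂ : Disjoint A F₂)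
    (hF : Disjoint F₁ F₂) (hAU : Disjoint A U) (hU₁ : Disjoint F₁ U) (hU₂ : Disjoint F₂ U)
    (hM₁ : M ≤ F₁.card) (hM₂ : M ≤ F₂.card) (hR₁ : Rk G {v₁} F₁ ρ) (hR₂ : Rk G {v₂} F₂ ρ)
    (hA : A.card ≤ a) (hp : ∀ i ≤ r, ∃ p : G.Walk v₁ v₂, p.IsPath ∧ p.length = ℓ + 2 * i ∧
      ∀ x ∈ p.support, x ∈ A ∨ x = v₁ ∨ x = v₂) : Gadget G U M ρ a r := by
  obtain ⟨E₁, hE₁, hv₁, hc₁, hr₁⟩ := exists_rk_trim hR₁ h₁ hM hM₁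
  obtain ⟨E₂, hE₂, hv₂, hc₂, hr₂⟩ := exists_rk_trim hR₂ h₂ hM hM₂
  exact ⟨v₁, v₂, E₁, E₂, A, ⟨hv₁, hv₂, hA₁.mono_right hE₁, hA₂.mono_right hE₂, hF.mono hE₁ hE₂,
    hAU, hU₁.mono_left hE₁, hU₂.mono_left hE₂, hc₁, hc₂, hr₁, hr₂, ℓ, hp⟩, hA⟩

lemma rk_support {a b : V} (p : G.Walk a b) : Rk G {a} p.support.toFinset p.length := by
  induction p with
  | nil => simpa using rk_refl _ _
  | @cons u v w h p ih =>
    have h1 : Rk G {u} {u, v} 1 := rk_of_adj (fun x hx => by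
      simp only [Finset.mem_insert, Finset.mem_singleton] at hx
      rcases hx with rfl | rfl
      · simp
      · exact Or.inr ⟨u, by simp, h⟩) (by simp)
    have h2 := rk_union_left ih (Q := {u, v}) (by simp)
    have h3 : ({u, v} : Finset V) ∪ p.support.toFinset =
        (SimpleGraph.Walk.cons h p).support.toFinset := by
      ext x
      simp only [Finset.mem_union, Finset.mem_insert, Finset.mem_singleton, List.mem_toFinset,
        SimpleGraph.Walk.support_cons, List.mem_cons]
      constructor
      · rintro ((rfl | rfl) | h)
        · simp
        · simp
        · exact Or.inr h
      · tauto
    rw [h3] at h2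
    refine rk_mono subset_rfl (by simp; omega) (rk_trans ?_ h1 h2)
    rw [← h3]
    exact Finset.subset_union_left

lemma exists_rk_path {v x : V} {F : Finset V} {ρ : ℕ} (h : Rk G {v} F ρ) (hx : x ∈ F) :
    ∃ Q ⊆ F, v ∈ Q ∧ x ∈ Q ∧ Q.card ≤ ρ + 1 ∧ Rk G {v} Q ρ ∧ Rk G {x} Q ρ := by
  obtain ⟨p, -, hl, hp⟩ := exists_path_of_rk h hx
  refine ⟨p.support.toFinset, fun z hz => hp z (by simpa using hz), by simp, by simp, ?_,
    rk_mono subset_rfl hl (rk_support p), ?_⟩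
  · refine (List.toFinset_card_le _).trans ?_
    rw [SimpleGraph.Walk.length_support]
    omega
  · have := rk_support p.reverse
    rw [SimpleGraph.Walk.support_reverse, List.toFinset_reverse,
      SimpleGraph.Walk.length_reverse] at this
    exact rk_mono subset_rfl hl this

lemma rk_reroot {v x : V} {F : Finset V} {ρ : ℕ} (h : Rk G {v} F ρ) (hx : x ∈ F) :
    Rk G {x} F (ρ + ρ) := by
  obtain ⟨Q, hQ, hv, -, -, -, hR⟩ := exists_rk_path h hx
  have h1 := rk_union_left h (Q := Q) (by simpa using hv)
  rw [Finset.union_eq_right.2 hQ] at h1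
  exact rk_trans hQ hR h1

lemma rk_chain {v x y : V} {Q P F : Finset V} {a b c : ℕ} (hQ : Rk G {v} Q a) (hyQ : y ∈ Q)
    (hP : Rk G {y} P b) (hxP : x ∈ P) (hF : Rk G {x} F c) : Rk G {v} (Q ∪ P ∪ F) (a + b + c) :=
  rk_trans Finset.subset_union_left
    (rk_trans Finset.subset_union_left hQ (rk_union_left hP (by simpa using hyQ)))
    (rk_union_left hF (by simpa using Or.inr hxP))

lemma Piece.gadget (R : Piece G) {U F₁ F₂ : Finset V} {M ρ lmax : ℕ} (hM : 1 ≤ M)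
    (h₁ : R.v₁ ∈ F₁) (h₂ : R.v₂ ∈ F₂) (hA₁ : Disjoint R.A F₁) (hA₂ : Disjoint R.A F₂)
    (hF : Disjoint F₁ F₂) (hAU : Disjoint R.A U) (hU₁ : Disjoint F₁ U) (hU₂ : Disjoint F₂ U)
    (hM₁ : M ≤ F₁.card) (hM₂ : M ≤ F₂.card) (hR₁ : Rk G {R.v₁} F₁ ρ)
    (hR₂ : Rk G {R.v₂} F₂ ρ) (hℓ : R.ℓ ≤ lmax) : Gadget G U M ρ (2 * lmax) 1 := by
  refine gadget_of_le (ℓ := R.ℓ - 1) hM h₁ h₂ hA₁ hA₂ hF hAU hU₁ hU₂ hM₁ hM₂ hR₁ hR₂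
    (R.card_A.trans (by omega)) fun i hi => ?_
  have h2 := R.two_le
  interval_cases i
  · obtain ⟨p, hp, hl, hs⟩ := R.short
    exact ⟨p, hp, by omega, hs⟩
  · obtain ⟨p, hp, hl, hs⟩ := R.long
    exact ⟨p, hp, by omega, hs⟩

variable [Fintype V]

lemma Piece.exists_link (R : Piece G) {U B : Finset V} {a b c : ℕ} {x₀ : V}
    (hRU : Disjoint R.verts (U ∪ B)) (hBU : Disjoint B U) (hB : Rk G {x₀} B c)
    (h₁ : Fintype.card V / 2 + 1 ≤ (grow G (U ∪ R.A) (R.S₁ ∪ R.S₂) a).card)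
    (h₂ : Fintype.card V / 2 + 1 ≤ (grow G (U ∪ R.A) B b).card) :
    ∃ R' : Piece G, (R' = R ∨ R' = R.swap) ∧ ∃ O F : Finset V,
      R'.v₁ ∈ F ∧ B ⊆ F ∧ F ⊆ O ∪ B ∧ Rk G {R'.v₁} F (R.ℓ + (a + b) + (c + c)) ∧
      Disjoint O R'.S₂ ∧ R'.A ⊆ O ∧ Disjoint R'.A F ∧ Disjoint F U ∧
      ∀ t, (nb G (grow G (U ∪ B ∪ O) R'.S₂ t) ∩ O).card ≤ 4 * (R'.ℓ + 1) + t := by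
  have hRA : Disjoint R.A (U ∪ B) := hRU.mono_left Finset.subset_union_left
  have hRS : Disjoint (R.S₁ ∪ R.S₂) (U ∪ B) := hRU.mono_left R.sides_subset
  have hAS : Disjoint (R.S₁ ∪ R.S₂) R.A :=
    Finset.disjoint_union_left.2 ⟨R.disj₁.symm, R.disj₂.symm⟩
  rw [Finset.disjoint_union_right] at hRA hRS
  obtain ⟨y, hy, x, hx, P, hyP, hxP, hPW, hPX, hPB, hPR, -, hPj⟩ := Balanced.exists_link
    (Finset.disjoint_union_right.2 ⟨hRS.1, hAS⟩) (Finset.disjoint_union_right.2 ⟨hBU, hRA.2.symm⟩)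
    h₁ h₂
  have main : ∀ R' : Piece G, (R' = R ∨ R' = R.swap) → R'.A = R.A → R'.ℓ = R.ℓ →
      R'.S₁ ∪ R'.S₂ = R.S₁ ∪ R.S₂ → y ∈ R'.S₁ → ∃ R' : Piece G, (R' = R ∨ R' = R.swap) ∧
      ∃ O F : Finset V,
      R'.v₁ ∈ F ∧ B ⊆ F ∧ F ⊆ O ∪ B ∧ Rk G {R'.v₁} F (R.ℓ + (a + b) + (c + c)) ∧
      Disjoint O R'.S₂ ∧ R'.A ⊆ O ∧ Disjoint R'.A F ∧ Disjoint F U ∧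
      ∀ t, (nb G (grow G (U ∪ B ∪ O) R'.S₂ t) ∩ O).card ≤ 4 * (R'.ℓ + 1) + t := by
    intro R' hR' hA hℓ hS hyS
    obtain ⟨Q, hQS, hvQ, hyQ, hQc, hQR, -⟩ := exists_rk_path R'.rk₁ hyS
    rw [← hA] at hPW hRA hPj
    rw [← hS] at hPX hRS hPj
    rw [← hℓ]
    rw [Finset.disjoint_union_right] at hPW
    rw [Finset.disjoint_union_left, Finset.disjoint_union_left] at hRS
    have hPS : Disjoint P R'.S₂ := Finset.disjoint_left.2 fun z hz hz₂ => by
      have := hPX z hz (Finset.mem_union_right _ hz₂)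
      subst this
      exact Finset.disjoint_left.1 R'.disj hyS hz₂
    refine ⟨R', hR', R'.A ∪ (Q ∪ P), Q ∪ P ∪ B, ?_, Finset.subset_union_right, ?_, ?_, ?_,
      Finset.subset_union_left, ?_, ?_, fun t => ?_⟩
    · simp [hvQ]
    · exact Finset.union_subset_union_left Finset.subset_union_right
    · exact rk_chain hQR hyQ hPR hxP (rk_reroot hB hx)
    · simp only [Finset.disjoint_union_left]
      exact ⟨R'.disj₂, R'.disj.mono_left hQS, hPS⟩
    · simp only [Finset.disjoint_union_right]
      exact ⟨⟨R'.disj₁.mono_right hQS, hPW.2.symm⟩, hRA.2⟩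
    · simp only [Finset.disjoint_union_left]
      exact ⟨⟨hRS.1.1.mono_left hQS, hPW.1⟩, hBU⟩
    · have hsub : nb G (grow G (U ∪ B ∪ (R'.A ∪ (Q ∪ P))) R'.S₂ t) ∩ P ⊆
          P ∩ grow G (U ∪ R'.A) (R'.S₁ ∪ R'.S₂) (t + 1) := by
        intro z hz
        obtain ⟨hzn, hzP⟩ := Finset.mem_inter.1 hz
        refine Finset.mem_inter.2 ⟨hzP, mem_grow_succ.2 (Or.inr ⟨?_, ?_⟩)⟩
        · rw [Finset.mem_union, not_or]
          exact ⟨Finset.disjoint_left.1 hPW.1 hzP, Finset.disjoint_left.1 hPW.2 hzP⟩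
        · obtain ⟨-, u, hu, huz⟩ := mem_nb.1 hzn
          refine ⟨u, grow_mono ?_ Finset.subset_union_right t hu, huz⟩
          exact Finset.union_subset_union Finset.subset_union_left Finset.subset_union_left
      have h1 := (Finset.card_le_card hsub).trans (hPj (t + 1))
      rw [Finset.inter_union_distrib_left, Finset.inter_union_distrib_left]
      refine (Finset.card_union_le _ _).trans ?_
      have h2 := Finset.card_union_le
        (nb G (grow G (U ∪ B ∪ (R'.A ∪ (Q ∪ P))) R'.S₂ t) ∩ Q)
        (nb G (grow G (U ∪ B ∪ (R'.A ∪ (Q ∪ P))) R'.S₂ t) ∩ P)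
      have h3 := Finset.card_le_card (Finset.inter_subset_right
        (s₁ := nb G (grow G (U ∪ B ∪ (R'.A ∪ (Q ∪ P))) R'.S₂ t)) (s₂ := R'.A))
      have h4 := Finset.card_le_card (Finset.inter_subset_right
        (s₁ := nb G (grow G (U ∪ B ∪ (R'.A ∪ (Q ∪ P))) R'.S₂ t)) (s₂ := Q))
      have h5 := R'.card_A
      omega
  rcases Finset.mem_union.1 hy with hy | hy
  · exact main R (Or.inl rfl) rfl rfl rfl hy
  · exact main R.swap (Or.inr rfl) rfl rfl (Finset.union_comm _ _) hy

end Gadgets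

section Sparse
open scoped Classical
variable [Fintype V] {G : SimpleGraph V}

lemma exists_blob {W : Finset V} {lmax Q T s : ℕ} (hfam : GrowingFamily G W lmax Q T s)
    (hQ : 1 ≤ Q) (hT : 1 ≤ T) : ∃ (x : V) (B : Finset V),
      Disjoint B W ∧ B.card = T ∧ Rk G {x} B (lmax + s) := by
  obtain ⟨P, hP, h⟩ := hfam
  obtain ⟨i, hi, hc⟩ := h (Finset.range Q) (Finset.range_subset_range.2 (by omega)) (by simp)
    (fun i => (P i).S₁) (fun _ => ∅)
    (fun i _ => ⟨Finset.subset_union_left, (P i).card₁.ge⟩) (by simp)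
  have hi' : i < 2 * Q := by have := Finset.mem_range.1 hi; omega
  have hW : Disjoint (P i).S₁ (W ∪ ∅) := by
    rw [Finset.union_empty]
    exact (hP i hi').1.mono_left (Finset.subset_union_left.trans (P i).sides_subset)
  obtain ⟨B, hB, -, hBT, hBR⟩ := exists_rk_trim
    (rk_trans (subset_grow (W ∪ ∅) _ s) (P i).rk₁ (rk_grow (G := G) (W ∪ ∅) (P i).S₁ s))
    (subset_grow _ _ _ (P i).mem₁) hT hc
  refine ⟨(P i).v₁, B, ?_, hBT, rk_mono subset_rfl (by have := (hP i hi').2; omega) hBR⟩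
  have := (grow_disjoint hW s (G := G)).mono_left hB
  rwa [Finset.union_empty] at this

lemma exists_gadget_of_growingFamily {U : Finset V} {M κ q w lmax Q T s : ℕ}
    (hexp : Expands G κ (Fintype.card V / 2) q) (hq : 1 ≤ q) (hκ : κ ≤ T)
    (hT : 2 * q * (w + 2 * lmax) ≤ T) (hT' : 4 * q ^ 2 ≤ T) (hQ : 1 ≤ Q) (hM : 1 ≤ M)
    (hMT : M ≤ T) (hfam : ∀ W : Finset V, W.card ≤ w + T → GrowingFamily G W lmax Q T s)
    (hU : U.card ≤ w) :
    Gadget G U M (lmax + (s + 2 * halfTime (Fintype.card V) q) + 2 * (lmax + s)) (2 * lmax) 1 := by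
  obtain ⟨x₀, B, hBU, hBT, hBR⟩ := exists_blob (hfam U (by omega)) hQ (by omega)
  obtain ⟨P, hP, hgrow⟩ := hfam (U ∪ B) ((Finset.card_union_le _ _).trans (by omega))
  set tb := halfTime (Fintype.card V) q with htb
  have hlarge : ∀ i < 2 * Q, ∀ X : Finset V, T ≤ X.card →
      Fintype.card V / 2 + 1 ≤ (grow G (U ∪ (P i).A) X tb).card := by
    intro i hi X hX
    refine half_lt_card_grow hexp hq (hκ.trans hX) (le_trans ?_ (hT.trans hX)) (hT'.trans hX)
    refine Nat.mul_le_mul_left _ ((Finset.card_union_le _ _).trans ?_)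
    have h1 := (P i).card_A
    have h2 := (hP i hi).2
    omega
  obtain ⟨Good, hGood⟩ : ∃ p : ℕ → Prop, ∀ i, p i ↔
      T ≤ (grow G (U ∪ (P i).A) ((P i).S₁ ∪ (P i).S₂) s).card := ⟨_, fun _ => Iff.rfl⟩
  have hbad : ((Finset.range (2 * Q)).filter fun i => ¬ Good i).card < Q := by
    by_contra! hle
    obtain ⟨i, hi, hc⟩ := hgrow _ (Finset.filter_subset _ _) hle (fun i => (P i).S₁ ∪ (P i).S₂)
      (fun i => (P i).A) (fun i _ => ⟨subset_rfl, by
        rw [← (P i).card₁]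
        exact Finset.card_le_card Finset.subset_union_left⟩) (fun i _ t => by
        have h1 := Finset.card_le_card (Finset.inter_subset_right
          (s₁ := nb G (grow G (U ∪ B ∪ (P i).A) ((P i).S₁ ∪ (P i).S₂) t)) (s₂ := (P i).A))
        have h2 := (P i).card_A
        omega)
    refine (Finset.mem_filter.1 hi).2 ((hGood i).2 (hc.trans (Finset.card_le_card ?_)))
    exact grow_mono (Finset.union_subset_union_left Finset.subset_union_left) subset_rfl _
  have hgood : Q ≤ ((Finset.range (2 * Q)).filter fun i => Good i).card := by
    have := Finset.card_filter_add_card_filter_not (s := Finset.range (2 * Q))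
      (p := fun i => Good i)
    rw [Finset.card_range] at this
    omega
  have hlink : ∀ i, ∃ R' : Piece G, i ∈ (Finset.range (2 * Q)).filter (fun i => Good i) →
      (R' = P i ∨ R' = (P i).swap) ∧ ∃ O F : Finset V,
      R'.v₁ ∈ F ∧ B ⊆ F ∧ F ⊆ O ∪ B ∧
      Rk G {R'.v₁} F ((P i).ℓ + (s + tb + tb) + (lmax + s + (lmax + s))) ∧
      Disjoint O R'.S₂ ∧ R'.A ⊆ O ∧ Disjoint R'.A F ∧ Disjoint F U ∧
      ∀ t, (nb G (grow G (U ∪ B ∪ O) R'.S₂ t) ∩ O).card ≤ 4 * (R'.ℓ + 1) + t := by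
    intro i
    by_cases hi : i ∈ (Finset.range (2 * Q)).filter (fun i => Good i)
    · obtain ⟨hi₁, hi₂⟩ := Finset.mem_filter.1 hi
      rw [Finset.mem_range] at hi₁
      obtain ⟨R', h⟩ := (P i).exists_link (hP i hi₁).1 hBU hBR
        (a := s + tb) (b := tb) (by
          rw [← grow_add]
          exact hlarge i hi₁ _ ((hGood i).1 hi₂)) (hlarge i hi₁ B hBT.ge)
      exact ⟨R', fun _ => h⟩
    · exact ⟨P i, fun h => absurd h hi⟩
  choose R hR using hlink
  choose! hRP O F hv₁ hBF hFO hFR hOS hAO hAF hFU hcon using hR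
  have hprop : ∀ i ∈ (Finset.range (2 * Q)).filter (fun i => Good i),
      (R i).S₂ ⊆ (P i).S₁ ∪ (P i).S₂ ∧ (P i).g = (R i).g ∧ (P i).ℓ = (R i).ℓ ∧
        (R i).A = (P i).A := by
    intro i hi
    rcases hRP i hi with h | h
    · rw [h]
      exact ⟨Finset.subset_union_right, rfl, rfl, rfl⟩
    · rw [h]
      exact ⟨Finset.subset_union_left, rfl, rfl, rfl⟩
  obtain ⟨i, hi, hc⟩ := hgrow _ (Finset.filter_subset _ _) hgood (fun i => (R i).S₂) O
    (fun i hi => ⟨(hprop i hi).1, by rw [(hprop i hi).2.1, (R i).card₂]⟩) (fun i hi t => by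
      rw [(hprop i hi).2.2.1]
      exact hcon i hi t)
  have hi₁ := Finset.mem_range.1 (Finset.mem_filter.1 hi).1
  have hℓ := (hP i hi₁).2
  have hd : Disjoint (grow G (U ∪ B ∪ O i) (R i).S₂ s) (U ∪ B ∪ O i) := by
    refine grow_disjoint (Finset.disjoint_union_right.2 ⟨?_, (hOS i hi).symm⟩) s
    exact (hP i hi₁).1.mono_left ((hprop i hi).1.trans (P i).sides_subset)
  simp only [Finset.disjoint_union_right] at hd
  have hℓ' := (hprop i hi).2.2.1
  refine (R i).gadget hM (hv₁ i hi) (subset_grow _ _ _ (R i).mem₂) (hAF i hi)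
    (hd.2.mono_right (hAO i hi)).symm ?_ ?_ (hFU i hi) hd.1.1
    (hMT.trans (hBT.ge.trans (Finset.card_le_card (hBF i hi)))) (hMT.trans hc)
    (rk_mono subset_rfl (by omega) (hFR i hi)) ?_ (by omega)
  · exact (Finset.disjoint_union_right.2 ⟨hd.2, hd.1.2⟩).symm.mono_left (hFO i hi)
  · rw [(hprop i hi).2.2.2]
    exact (hP i hi₁).1.mono Finset.subset_union_left Finset.subset_union_left
  · refine rk_mono subset_rfl (by omega)
      (rk_trans (subset_grow (U ∪ B ∪ O i) _ s) (R i).rk₂ (rk_grow _ _ _))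

end Sparse

section Chaining
open scoped Classical
variable {G : SimpleGraph V}

lemma IsGadget.swap {U : Finset V} {M ρ r : ℕ} {v₁ v₂ : V} {F₁ F₂ A : Finset V}
    (h : IsGadget G U M ρ r v₁ v₂ F₁ F₂ A) : IsGadget G U M ρ r v₂ v₁ F₂ F₁ A where
  mem₁ := h.mem₂
  mem₂ := h.mem₁
  disj₁ := h.disj₂
  disj₂ := h.disj₁
  disj := h.disj.symm
  avoid := h.avoid
  avoid₁ := h.avoid₂
  avoid₂ := h.avoid₁
  card₁ := h.card₂
  card₂ := h.card₁
  rk₁ := h.rk₂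
  rk₂ := h.rk₁
  paths := by
    obtain ⟨ℓ, h⟩ := h.paths
    refine ⟨ℓ, fun i hi => ?_⟩
    obtain ⟨p, h1, h2, h3⟩ := h i hi
    exact ⟨p.reverse, h1.reverse, by simpa using h2, fun x hx => by
      have := h3 x (by simpa using hx)
      tauto⟩

lemma IsGadget.append {U : Finset V} {M ρ r b : ℕ} {v₁ v₂ v₃ v₄ x y : V}
    {F₁ F₂ F₃ F₄ A A' P : Finset V} (h : IsGadget G U M ρ r v₁ v₂ F₁ F₂ A)
    (h' : IsGadget G (U ∪ A ∪ (F₁ ∪ F₂)) M ρ 1 v₃ v₄ F₃ F₄ A') (hx : x ∈ F₂) (hy : y ∈ F₃)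
    (hyP : y ∈ P) (hPW : Disjoint P (U ∪ A ∪ A')) (hPx : ∀ z ∈ P, z ∈ F₁ ∪ F₂ → z = x)
    (hPy : ∀ z ∈ P, z ∈ F₃ ∪ F₄ → z = y) (hP : Rk G {x} P b) (hPc : P.card ≤ b + 1) :
    Gadget G U M ρ (A.card + A'.card + (2 * (ρ + 1) + (b + 1))) (r + 1) := by
  obtain ⟨q₁, hq₁, hq₁l, hq₁s⟩ := exists_path_of_rk h.rk₂ hx
  obtain ⟨q₂, hq₂, -, hq₂s⟩ := exists_path_of_rk hP hyP
  obtain ⟨q₃, hq₃, hq₃l, hq₃s⟩ := exists_path_of_rk h'.rk₁ hy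
  have ha := h'.avoid
  have ha₁ := h'.avoid₁
  have ha₂ := h'.avoid₂
  simp only [Finset.disjoint_union_right] at ha ha₁ ha₂ hPW
  obtain ⟨⟨haU, haA⟩, ha₁', ha₂'⟩ := ha
  obtain ⟨⟨ha₁U, ha₁A⟩, ha₁₁, ha₁₂⟩ := ha₁
  obtain ⟨⟨ha₂U, ha₂A⟩, ha₂₁, ha₂₂⟩ := ha₂
  obtain ⟨⟨hPU, hPA⟩, hPA'⟩ := hPW
  have hd := h.disj
  have hd' := h'.disj
  have hA₁ := h.disj₁
  have hA₂ := h.disj₂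
  have hA'₁ := h'.disj₁
  have hA'₂ := h'.disj₂
  have hm₁ := h.mem₁
  have hm₂ := h.mem₂
  have hm₃ := h'.mem₁
  have hm₄ := h'.mem₂
  have hU := h.avoid
  have hU₂ := h.avoid₂
  simp only [Finset.disjoint_left] at haU haA ha₁' ha₂' ha₁U ha₁A ha₁₁ ha₁₂ ha₂U ha₂A ha₂₁ ha₂₂
  simp only [Finset.disjoint_left] at hPU hPA hPA' hd hd' hA₁ hA₂ hA'₁ hA'₂ hU hU₂
  simp only [Finset.mem_union] at hPx hPy
  have hc₀ : (q₂.append q₃.reverse).IsPath := isPath_append hq₂ hq₃.reverse fun z hz hz' =>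
    hPy z (hq₂s z hz) (Or.inl (hq₃s z (by simpa using hz')))
  have hc₀s : ∀ z ∈ (q₂.append q₃.reverse).support, z ∈ P ∨ z ∈ F₃ := fun z hz => by
    rcases (SimpleGraph.Walk.mem_support_append_iff _ _).1 hz with hz | hz
    · exact Or.inl (hq₂s z hz)
    · exact Or.inr (hq₃s z (by simpa using hz))
  have hc : (q₁.append (q₂.append q₃.reverse)).IsPath := isPath_append hq₁ hc₀ fun z hz hz' => by
    have h1 := hq₁s z hz
    rcases hc₀s z hz' with h2 | h2
    · exact hPx z h2 (Or.inr h1)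
    · exact absurd h1 (ha₁₂ h2)
  have hcs : ∀ z ∈ (q₁.append (q₂.append q₃.reverse)).support, z ∈ F₂ ∨ z ∈ P ∨ z ∈ F₃ :=
    fun z hz => by
      rcases (SimpleGraph.Walk.mem_support_append_iff _ _).1 hz with hz | hz
      · exact Or.inl (hq₁s z hz)
      · exact Or.inr (hc₀s z hz)
  have hcc : (q₁.append (q₂.append q₃.reverse)).support.toFinset.card ≤
      2 * (ρ + 1) + (b + 1) := by
    have hsub : (q₁.append (q₂.append q₃.reverse)).support.toFinset ⊆
        q₁.support.toFinset ∪ (P ∪ q₃.support.toFinset) := fun z hz => by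
      rw [List.mem_toFinset, SimpleGraph.Walk.mem_support_append_iff,
        SimpleGraph.Walk.mem_support_append_iff] at hz
      simp only [Finset.mem_union, List.mem_toFinset]
      rcases hz with hz | hz | hz
      · exact Or.inl hz
      · exact Or.inr (Or.inl (hq₂s z hz))
      · exact Or.inr (Or.inr (by simpa using hz))
    refine (Finset.card_le_card hsub).trans ((Finset.card_union_le _ _).trans ?_)
    have h1 := Finset.card_union_le P q₃.support.toFinset
    have h2 := List.toFinset_card_le q₁.support
    have h3 := List.toFinset_card_le q₃.support
    rw [SimpleGraph.Walk.length_support] at h2 h3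
    omega
  generalize q₁.append (q₂.append q₃.reverse) = c at hc hcs hcc
  have hcA : ∀ z ∈ c.support, z ∉ A := fun z hz hzA => by
    rcases hcs z hz with h1 | h1 | h1
    · exact hA₂ hzA h1
    · exact hPA h1 hzA
    · exact ha₁A h1 hzA
  have hcA' : ∀ z ∈ c.support, z ∉ A' := fun z hz hzA => by
    rcases hcs z hz with h1 | h1 | h1
    · exact ha₂' hzA h1
    · exact hPA' h1 hzA
    · exact hA'₁ hzA h1
  have hc₁ : ∀ z ∈ c.support, z ∉ F₁ := fun z hz hz₁ => by
    rcases hcs z hz with h1 | h1 | h1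
    · exact hd hz₁ h1
    · have := hPx z h1 (Or.inl hz₁)
      subst this
      exact hd hz₁ hx
    · exact ha₁₁ h1 hz₁
  have hc₄ : ∀ z ∈ c.support, z ∉ F₄ := fun z hz hz₁ => by
    rcases hcs z hz with h1 | h1 | h1
    · exact ha₂₂ hz₁ h1
    · have := hPy z h1 (Or.inr hz₁)
      subst this
      exact hd' hy hz₁
    · exact hd' h1 hz₁
  have hcU : ∀ z ∈ c.support, z ∉ U := fun z hz hzU => by
    rcases hcs z hz with h1 | h1 | h1
    · exact hU₂ h1 hzU
    · exact hPU h1 hzU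
    · exact ha₁U h1 hzU
  obtain ⟨ℓ, hp⟩ := h.paths
  obtain ⟨ℓ', hp'⟩ := h'.paths
  refine ⟨v₁, v₄, F₁, F₄, A ∪ (A' ∪ c.support.toFinset), ⟨hm₁, hm₄, ?_, ?_, ?_, ?_, h.avoid₁, ?_,
    h.card₁, h'.card₂, h.rk₁, h'.rk₂, ℓ + c.length + ℓ', fun i hi => ?_⟩, ?_⟩
  · simp only [Finset.disjoint_left, Finset.mem_union, List.mem_toFinset]
    rintro z (hz | hz | hz)
    · exact hA₁ hz
    · exact ha₁' hz
    · exact hc₁ z hz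
  · simp only [Finset.disjoint_left, Finset.mem_union, List.mem_toFinset]
    rintro z (hz | hz | hz) hz'
    · exact ha₂A hz' hz
    · exact hA'₂ hz hz'
    · exact hc₄ z hz hz'
  · exact Finset.disjoint_left.2 fun z hz hz' => ha₂₁ hz' hz
  · simp only [Finset.disjoint_left, Finset.mem_union, List.mem_toFinset]
    rintro z (hz | hz | hz)
    · exact hU hz
    · exact haU hz
    · exact hcU z hz
  · exact Finset.disjoint_left.2 fun z hz hz' => ha₂U hz hz'
  · obtain ⟨i₁, i₂, hi₁, hi₂, rfl⟩ : ∃ i₁ i₂, i₁ ≤ r ∧ i₂ ≤ 1 ∧ i = i₁ + i₂ := by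
      rcases Nat.lt_or_ge r i with hr | hr
      · exact ⟨r, 1, le_rfl, le_rfl, by omega⟩
      · exact ⟨i, 0, hr, by omega, rfl⟩
    obtain ⟨p, hpp, hpl, hps⟩ := hp i₁ hi₁
    obtain ⟨p', hpp', hpl', hps'⟩ := hp' i₂ hi₂
    have h1 : (p.append c).IsPath := isPath_append hpp hc fun z hz hz' => by
      rcases hps z hz with h | rfl | h
      · exact absurd h (hcA z hz')
      · exact absurd hm₁ (hc₁ _ hz')
      · exact h
    have h2 : ((p.append c).append p').IsPath := isPath_append h1 hpp' fun z hz hz' => by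
      rcases hps' z hz' with h | h | h
      · exfalso
        rcases (SimpleGraph.Walk.mem_support_append_iff _ _).1 hz with hz | hz
        · rcases hps z hz with h3 | h3 | h3
          · exact haA h h3
          · exact ha₁' h (h3 ▸ hm₁)
          · exact ha₂' h (h3 ▸ hm₂)
        · exact hcA' z hz h
      · exact h
      · exfalso
        have hz₄ : z ∈ F₄ := h ▸ hm₄
        rcases (SimpleGraph.Walk.mem_support_append_iff _ _).1 hz with hz | hz
        · rcases hps z hz with h3 | h3 | h3
          · exact ha₂A hz₄ h3
          · exact ha₂₁ hz₄ (h3 ▸ hm₁)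
          · exact ha₂₂ hz₄ (h3 ▸ hm₂)
        · exact hc₄ z hz hz₄
    refine ⟨_, h2, ?_, fun z hz => ?_⟩
    · rw [SimpleGraph.Walk.length_append, SimpleGraph.Walk.length_append, hpl, hpl']
      ring
    · simp only [Finset.mem_union, List.mem_toFinset]
      rw [SimpleGraph.Walk.mem_support_append_iff, SimpleGraph.Walk.mem_support_append_iff] at hz
      rcases hz with (hz | hz) | hz
      · rcases hps z hz with h3 | h3 | h3
        · exact Or.inl (Or.inl h3)
        · exact Or.inr (Or.inl h3)
        · exact Or.inl (Or.inr (Or.inr (h3 ▸ c.start_mem_support)))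
      · exact Or.inl (Or.inr (Or.inr hz))
      · rcases hps' z hz with h3 | h3 | h3
        · exact Or.inl (Or.inr (Or.inl h3))
        · exact Or.inl (Or.inr (Or.inr (h3 ▸ c.end_mem_support)))
        · exact Or.inr (Or.inr h3)
  · have h1 := Finset.card_union_le A (A' ∪ c.support.toFinset)
    have h2 := Finset.card_union_le A' c.support.toFinset
    omega

variable [Fintype V]

lemma exists_gadget_succ {U : Finset V} {M κ q w ρ a b r : ℕ}
    (hexp : Expands G κ (Fintype.card V / 2) q) (hq : 1 ≤ q) (hκ : κ ≤ M) (hqM : 4 * q ^ 2 ≤ M)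
    (hone : ∀ W : Finset V, W.card ≤ w → Gadget G W M ρ b 1) (hw : U.card + a + 2 * M ≤ w)
    (hcut : 2 * q * (U.card + a + b) ≤ M) (h : Gadget G U M ρ a r) :
    Gadget G U M ρ (a + b + (2 * (ρ + 1) + (2 * halfTime (Fintype.card V) q + 1))) (r + 1) := by
  obtain ⟨v₁, v₂, F₁, F₂, A, hA, hAc⟩ := h
  obtain ⟨v₃, v₄, F₃, F₄, A', hA', hAc'⟩ := hone (U ∪ A ∪ (F₁ ∪ F₂)) (by
    refine (Finset.card_union_le _ _).trans ?_
    have h1 := Finset.card_union_le U A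
    have h2 := Finset.card_union_le F₁ F₂
    have h3 := hA.card₁
    have h4 := hA.card₂
    omega)
  have hWc : (U ∪ A ∪ A').card ≤ U.card + a + b := by
    refine (Finset.card_union_le _ _).trans ?_
    have h1 := Finset.card_union_le U A
    omega
  have ha := hA'.avoid
  have ha₁ := hA'.avoid₁
  have ha₂ := hA'.avoid₂
  simp only [Finset.disjoint_union_right] at ha ha₁ ha₂
  have hd₁ : Disjoint (F₁ ∪ F₂) (U ∪ A ∪ A') := by
    simp only [Finset.disjoint_union_left, Finset.disjoint_union_right]
    exact ⟨⟨⟨hA.avoid₁, hA.avoid₂⟩, hA.disj₁.symm, hA.disj₂.symm⟩, ha.2.1.symm, ha.2.2.symm⟩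
  have hd₂ : Disjoint (F₃ ∪ F₄) (U ∪ A ∪ A') := by
    simp only [Finset.disjoint_union_left, Finset.disjoint_union_right]
    exact ⟨⟨⟨ha₁.1.1, ha₂.1.1⟩, ha₁.1.2, ha₂.1.2⟩, hA'.disj₁.symm, hA'.disj₂.symm⟩
  have hlarge : ∀ X : Finset V, M ≤ X.card →
      Fintype.card V / 2 + 1 ≤ (grow G (U ∪ A ∪ A') X (halfTime (Fintype.card V) q)).card :=
    fun X hX => half_lt_card_grow hexp hq (hκ.trans hX)
      ((Nat.mul_le_mul_left _ hWc).trans (hcut.trans hX)) (hqM.trans hX)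
  obtain ⟨x, hx, y, hy, P, -, hyP, hPW, hPx, hPy, hP, hPc, -⟩ := exists_link hd₁ hd₂
    (hlarge _ (hA.card₁.ge.trans (Finset.card_le_card Finset.subset_union_left)))
    (hlarge _ (hA'.card₁.ge.trans (Finset.card_le_card Finset.subset_union_left)))
  rw [← two_mul] at hP hPc
  have hfin : ∀ {r'}, Gadget G U M ρ
      (A.card + A'.card + (2 * (ρ + 1) + (2 * halfTime (Fintype.card V) q + 1))) r' →
      Gadget G U M ρ (a + b + (2 * (ρ + 1) + (2 * halfTime (Fintype.card V) q + 1))) r' := by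
    rintro r' ⟨v₁, v₂, F₁, F₂, B, hB, hBc⟩
    exact ⟨v₁, v₂, F₁, F₂, B, hB, hBc.trans (by omega)⟩
  have hA'' : IsGadget G (U ∪ A ∪ (F₂ ∪ F₁)) M ρ 1 v₃ v₄ F₃ F₄ A' := by
    rwa [Finset.union_comm F₂]
  refine hfin ?_
  rcases Finset.mem_union.1 hx with hx | hx <;> rcases Finset.mem_union.1 hy with hy | hy
  · exact hA.swap.append hA'' hx hy hyP hPW (by rwa [Finset.union_comm F₂]) hPy hP hPc
  · exact hA.swap.append hA''.swap hx hy hyP hPW (by rwa [Finset.union_comm F₂])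
      (by rwa [Finset.union_comm F₄]) hP hPc
  · exact hA.append hA' hx hy hyP hPW hPx hPy hP hPc
  · exact hA.append hA'.swap hx hy hyP hPW hPx (by rwa [Finset.union_comm F₄]) hP hPc

lemma exists_gadget_chain {U : Finset V} {M κ q w ρ b c r : ℕ}
    (hexp : Expands G κ (Fintype.card V / 2) q) (hq : 1 ≤ q) (hκ : κ ≤ M) (hqM : 4 * q ^ 2 ≤ M)
    (hone : ∀ W : Finset V, W.card ≤ w → Gadget G W M ρ b 1)
    (hc : b + (2 * (ρ + 1) + (2 * halfTime (Fintype.card V) q + 1)) ≤ c)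
    (hw : U.card + r * c + 2 * M ≤ w) (hcut : 2 * q * (U.card + r * c) ≤ M) (hr : 1 ≤ r) :
    Gadget G U M ρ (r * c) r := by
  have key : ∀ s, 1 ≤ s → s ≤ r → Gadget G U M ρ (s * c) s := by
    intro s hs
    induction s, hs using Nat.le_induction with
    | base =>
      intro _
      obtain ⟨v₁, v₂, F₁, F₂, A, hA, hAc⟩ := hone U (by omega)
      exact ⟨v₁, v₂, F₁, F₂, A, hA, by omega⟩
    | succ s hs ih =>
      intro hsr
      have h1 : (s + 1) * c ≤ r * c := Nat.mul_le_mul_right _ hsr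
      have h2 : (s + 1) * c = s * c + c := by ring
      obtain ⟨v₁, v₂, F₁, F₂, A, hA, hAc⟩ := exists_gadget_succ hexp hq hκ hqM hone
        (by omega) (le_trans (Nat.mul_le_mul_left _ (by omega)) hcut) (ih (by omega))
      exact ⟨v₁, v₂, F₁, F₂, A, hA, by omega⟩
  exact key r hr le_rfl

end Chaining

section Conversion
open scoped Classical
variable {G : SimpleGraph V}

lemma exists_walk_lift {W : Type*} {H : SimpleGraph W} {S : Set V} (f : ∀ x, x ∈ S → W)
    (hf : ∀ x y hx hy, G.Adj x y → H.Adj (f x hx) (f y hy)) {a b : V} (p : G.Walk a b)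
    (hp : ∀ x ∈ p.support, x ∈ S) :
    ∃ q : H.Walk (f a (hp a p.start_mem_support)) (f b (hp b p.end_mem_support)),
      q.length = p.length ∧ q.support = p.support.pmap f hp := by
  induction p with
  | nil => exact ⟨SimpleGraph.Walk.nil, rfl, by simp⟩
  | @cons u v w h p ih =>
    obtain ⟨q, hq, hqs⟩ := ih fun x hx => hp x (by simp [hx])
    exact ⟨SimpleGraph.Walk.cons (hf _ _ _ _ h) q, by simp [hq], by simp [hqs]⟩

lemma ncard_preimage_val {U : Set V} {F : Finset V} (hF : ∀ x ∈ F, x ∉ U) :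
    {x : ↥Uᶜ | (x : V) ∈ F}.ncard = F.card := by
  rw [← Set.ncard_image_of_injective _ Subtype.val_injective, ← Set.ncard_coe_finset]
  congr 1
  ext x
  simp only [Set.mem_image, Set.mem_ofPred_eq, Subtype.exists, Finset.mem_coe]
  exact ⟨fun ⟨y, _, h, h'⟩ => h' ▸ h, fun h => ⟨x, hF x h, h, rfl⟩⟩

lemma isExpansion_of_rk {U : Set V} {F : Finset V} (hF : ∀ x ∈ F, x ∉ U) {v : V} (hv : v ∈ F)
    {ρ : ℕ} (h : Rk G {v} F ρ) {m : ℝ} (hm : (ρ : ℝ) ≤ m) :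
    IsExpansion (G.induce Uᶜ) ((⊤ : (G.induce Uᶜ).Subgraph).induce {x | (x : V) ∈ F})
      ⟨v, hF v hv⟩ F.card m := by
  refine ⟨hv, by rw [SimpleGraph.Subgraph.induce_verts, ncard_preimage_val hF], ?_⟩
  rintro ⟨u, huU⟩ hu
  obtain ⟨p, -, hl, hp⟩ := exists_path_of_rk h (x := u) hu
  obtain ⟨q, hq, -⟩ := exists_walk_lift (S := (F : Set V))
    (H := ((⊤ : (G.induce Uᶜ).Subgraph).induce {x | (x : V) ∈ F}).coe)
    (fun x hx => ⟨⟨x, hF x hx⟩, hx⟩) (fun x y hx hy hxy => by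
      simp only [SimpleGraph.Subgraph.coe_adj, SimpleGraph.Subgraph.induce_adj]
      exact ⟨hx, hy, hxy⟩) p hp
  exact ⟨q, le_trans (by rw [hq]; exact_mod_cast hl) hm⟩

lemma hasAdjuster_of_gadget {U : Set V} {U' : Finset V} (hU : ∀ x, x ∈ U' ↔ x ∈ U)
    {M ρ a r D : ℕ} (hD : 1 ≤ D) (hDM : D ≤ M) (h : Gadget G U' M ρ a r) {m : ℝ}
    (hm : (ρ : ℝ) ≤ m) (ha : (a : ℝ) ≤ 10 * m * r) : HasAdjuster (G.induce Uᶜ) D m r := by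
  obtain ⟨v₁, v₂, F₁, F₂, A, h, hA⟩ := h
  obtain ⟨E₁, hE₁, hv₁, hc₁, hr₁⟩ := exists_rk_trim h.rk₁ h.mem₁ hD (hDM.trans h.card₁.ge)
  obtain ⟨E₂, hE₂, hv₂, hc₂, hr₂⟩ := exists_rk_trim h.rk₂ h.mem₂ hD (hDM.trans h.card₂.ge)
  have hAU : ∀ x ∈ A, x ∉ U := fun x hx hxU =>
    Finset.disjoint_left.1 h.avoid hx ((hU x).2 hxU)
  have hU₁ : ∀ x ∈ E₁, x ∉ U := fun x hx hxU =>
    Finset.disjoint_left.1 h.avoid₁ (hE₁ hx) ((hU x).2 hxU)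
  have hU₂ : ∀ x ∈ E₂, x ∉ U := fun x hx hxU =>
    Finset.disjoint_left.1 h.avoid₂ (hE₂ hx) ((hU x).2 hxU)
  refine ⟨⟨v₁, hU₁ v₁ hv₁⟩, ⟨v₂, hU₂ v₂ hv₂⟩,
    (⊤ : (G.induce Uᶜ).Subgraph).induce {x | (x : V) ∈ E₁},
    (⊤ : (G.induce Uᶜ).Subgraph).induce {x | (x : V) ∈ E₂}, {x | (x : V) ∈ A}, ?_, ?_, ?_,
    hc₁ ▸ isExpansion_of_rk hU₁ hv₁ hr₁ hm, hc₂ ▸ isExpansion_of_rk hU₂ hv₂ hr₂ hm, ?_, ?_⟩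
  · exact Set.disjoint_left.2 fun x hx hx' => Finset.disjoint_left.1 h.disj₁ hx (hE₁ hx')
  · exact Set.disjoint_left.2 fun x hx hx' => Finset.disjoint_left.1 h.disj₂ hx (hE₂ hx')
  · exact Set.disjoint_left.2 fun x hx hx' => Finset.disjoint_left.1 h.disj (hE₁ hx) (hE₂ hx')
  · rw [ncard_preimage_val hAU]
    exact le_trans (by exact_mod_cast hA) ha
  · obtain ⟨ℓ, hp⟩ := h.paths
    refine ⟨ℓ, fun i hi => ?_⟩
    obtain ⟨p, hp, hl, hs⟩ := hp i hi
    obtain ⟨q, hq, hqs⟩ := exists_walk_lift (S := Uᶜ) (H := G.induce Uᶜ)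
      (fun x hx => ⟨x, hx⟩) (fun x y hx hy hxy => hxy) p (fun x hx => by
        rcases hs x hx with h | rfl | rfl
        · exact hAU x h
        · exact hU₁ _ hv₁
        · exact hU₂ _ hv₂)
    refine ⟨q, ?_, by rw [hq, hl], fun x hx => ?_⟩
    · rw [SimpleGraph.Walk.isPath_def, hqs]
      exact hp.support_nodup.pmap fun _ _ _ _ h => congrArg Subtype.val h
    · rw [hqs, List.mem_pmap] at hx
      obtain ⟨y, hy, rfl⟩ := hx
      rcases hs y hy with h | rfl | rfl
      · exact Or.inl h
      · exact Or.inr (Or.inl rfl)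
      · exact Or.inr (Or.inr rfl)

variable [Fintype V]

lemma exists_gadget_of_large_degree (hbip : IsBip G) [Nonempty V] {e M : ℕ}
    (hdeg : ∀ v, e ≤ degIn G Finset.univ v) (hM : 1 ≤ M) {U : Finset V}
    (hU : U.card + (2 * M + 2 * (Nat.log 2 (Fintype.card V) + 1) + 5) ≤ e) :
    Gadget G U M (Nat.log 2 (Fintype.card V) + 1) (2 * (Nat.log 2 (Fintype.card V) + 1)) 1 := by
  have hne : (Finset.univ \ U).Nonempty := by
    rw [← Finset.card_pos]
    have h1 := Finset.le_card_sdiff U Finset.univ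
    have h2 := hdeg (Classical.arbitrary V)
    have h3 := degIn_le_card (G := G) Finset.univ (Classical.arbitrary V)
    omega
  obtain ⟨ℓ, -, hℓ, h⟩ := exists_piece hbip hne
    (δ := 2 * M + 2 * (Nat.log 2 (Fintype.card V) + 1) + 5) (by omega) fun x _ => by
      have h1 := degIn_univ_le (G := G) U x
      have h2 := degIn_le_card (G := G) U x
      have h3 := hdeg x
      omega
  obtain ⟨P, hPℓ, hPg, hP⟩ := h M hM (Or.inl (by omega))
  have hd : Disjoint P.verts U := Finset.disjoint_of_subset_left hP Finset.sdiff_disjoint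
  have hS := hd.mono_left P.sides_subset
  rw [Finset.disjoint_union_left] at hS
  exact P.gadget hM P.mem₁ P.mem₂ P.disj₁ P.disj₂ P.disj
    (hd.mono_left Finset.subset_union_left) hS.1 hS.2 (by rw [P.card₁, hPg])
    (by rw [P.card₂, hPg]) (rk_mono subset_rfl (by omega) P.rk₁)
    (rk_mono subset_rfl (by omega) P.rk₂) (by omega)

end Conversion

section Assembly
open scoped Classical
variable [Fintype V] {G : SimpleGraph V}

omit [Fintype V] in
lemma Gadget.mono {U : Finset V} {M ρ ρ' a r : ℕ} (h : Gadget G U M ρ a r) (hρ : ρ ≤ ρ') :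
    Gadget G U M ρ' a r := by
  obtain ⟨v₁, v₂, F₁, F₂, A, h, hA⟩ := h
  exact ⟨v₁, v₂, F₁, F₂, A, { h with
    rk₁ := rk_mono subset_rfl hρ h.rk₁
    rk₂ := rk_mono subset_rfl hρ h.rk₂ }, hA⟩

lemma exists_piece_avoiding (hbip : IsBip G) {k e w : ℕ} (hfree : ¬ ContainsBalSub G k 2)
    (hk : 2 * k ≤ e + 1) (hdeg : ∀ v, e ≤ degIn G Finset.univ v) (he : 40 ≤ e)
    (hn : 2 * (w + w ^ 2) < Fintype.card V) {W : Finset V} (hW : W.card ≤ w) :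
    ∃ ℓ, ℓ ≤ Nat.log 2 (Fintype.card V) + 1 ∧ ∀ g, 1 ≤ g →
      (2 * g + 2 * ℓ ≤ e / 8 ∨ g ≤ 2 ^ (ℓ / 2)) →
        ∃ P : Piece G, P.ℓ = ℓ ∧ P.g = g ∧ Disjoint P.verts W := by
  obtain ⟨Z, hZW, hZ, hZd⟩ := exists_minDeg_avoiding hfree hk hdeg (δ := e / 8) (by omega)
    (by omega) (W := W) (by
      have := Nat.pow_le_pow_left hW 2
      omega)
  obtain ⟨ℓ, -, hℓ, h⟩ := exists_piece hbip hZ (by omega) hZd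
  refine ⟨ℓ, hℓ, fun g hg hor => ?_⟩
  obtain ⟨P, h1, h2, h3⟩ := h g hg hor
  exact ⟨P, h1, h2, hZW.mono_left h3⟩

/-- The radius of the adjusters in a graph on `n` vertices. -/
def radius (n μ q : ℕ) : ℕ :=
  Nat.log 2 n + 1 + (μ ^ 4 + 2 * halfTime n q) + 2 * (Nat.log 2 n + 1 + μ ^ 4)

/-- The number of vertices that each further step of adjustment costs. -/
def stepCost (n μ q : ℕ) : ℕ :=
  2 * (Nat.log 2 n + 1) + (2 * (radius n μ q + 1) + (2 * halfTime n q + 1))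

theorem exists_gadget {μ u κ q k e r : ℕ} (hs : Scale μ u) (hbip : IsBip G)
    (hfree : ¬ ContainsBalSub G k 2) (hk : 2 * k ≤ e + 1)
    (hdeg : ∀ v, e ≤ degIn G Finset.univ v) (he : 12696 ≤ e)
    (hn : 2 * (u ^ (μ ^ 14) + (u ^ (μ ^ 14)) ^ 2) < Fintype.card V)
    (hsmall : Expands G κ (u ^ 20) μ) (hbig : Expands G κ (Fintype.card V / 2) q) (hq : 1 ≤ q)
    (hκ : 8 * κ ≤ e)
    (hloc : e ≤ μ ^ 5 → ∀ s, e / 8 / 3 ≤ s → ∀ X : Finset V, X.card = s * (s * e) →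
      X.card ≤ u ^ 20 → s * e * (1 + Nat.sqrt (64 * s)) < (nb G X).card)
    (hlog : Nat.log 2 (Fintype.card V) + 2 ≤ u) (hqu : 8 * q ≤ u)
    (hr : 1 ≤ r) (hcost : r * stepCost (Fintype.card V) μ q ≤ u) {U : Finset V}
    (hU : U.card ≤ u) :
    ∃ M, u ≤ M ∧
      Gadget G U M (radius (Fintype.card V) μ q) (r * stepCost (Fintype.card V) μ q) r := by
  have hu := hs.le_u
  set lmax := Nat.log 2 (Fintype.card V) + 1 with hlmax
  have huu : u * 64 ≤ u * u := Nat.mul_le_mul_left _ hu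
  have hqq : 4 * q ^ 2 ≤ u * u := by
    have := Nat.mul_le_mul hqu hqu
    nlinarith
  have hcut : 2 * q * (U.card + r * stepCost (Fintype.card V) μ q) ≤ u * u := by
    calc _ ≤ 2 * q * (u + u) := Nat.mul_le_mul_left _ (by omega)
      _ = 4 * q * u := by ring
      _ ≤ u * u := Nat.mul_le_mul_right _ (by omega)
  rcases Nat.lt_or_ge e (8 * (u * u)) with hlt | hge
  · have h3 : u * u * 64 ≤ u * u * u := Nat.mul_le_mul_left _ hu
    have h4 : u * u * u * 64 ≤ u * u * u * u := Nat.mul_le_mul_left _ hu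
    have h5 : u * u * u * u * 64 ≤ u * u * u * u * u := Nat.mul_le_mul_left _ hu
    have e5 : u ^ 5 = u * u * u * u * u := by ring
    have e4 : u ^ 4 = u * u * u * u := by ring
    have hκu : κ ≤ u ^ 2 := by rw [pow_two]; omega
    refine ⟨u * u, Nat.le_mul_self u, exists_gadget_chain (w := u * u * u) (κ := κ) hbig hq
      (by omega) hqq (b := 2 * lmax) (fun W hW => ?_) le_rfl (by omega) hcut hr⟩
    refine exists_gadget_of_growingFamily (κ := κ) (q := q) (w := u * u * u) (Q := u ^ (μ ^ 12))
      (T := u ^ 4) (s := μ ^ 4) hbig hq (by omega) ?_ (by omega)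
      (Nat.pow_pos (by omega)) (by omega) (by omega) (fun W hW => ?_) hW
    · calc 2 * q * (u * u * u + 2 * lmax) ≤ 2 * q * (u * u * u + u * u * u) :=
            Nat.mul_le_mul_left _ (by omega)
        _ = 4 * q * (u * u * u) := by ring
        _ ≤ u * (u * u * u) := Nat.mul_le_mul_right _ (by omega)
        _ = u ^ 4 := by ring
    · exact exists_growing_family hs hsmall hκu hfree (by omega) he (by omega) hloc
        (fun W hW => exists_piece_avoiding hbip hfree hk hdeg (by omega) hn hW) (by omega)
  · have : Nonempty V := Fintype.card_pos_iff.1 (by omega)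
    refine ⟨e / 8, by omega, exists_gadget_chain
      (w := U.card + r * stepCost (Fintype.card V) μ q + 2 * (e / 8)) (κ := κ) hbig hq
      (by omega) (by omega) (b := 2 * lmax) (fun W hW => ?_) le_rfl le_rfl (by omega) hr⟩
    refine (exists_gadget_of_large_degree hbip hdeg (by omega) (by omega)).mono ?_
    unfold radius
    omega

end Assembly

section Parameters

lemma eventually_const_mul_pow_le_exp (C : ℝ) (k : ℕ) :
    ∀ᶠ a : ℝ in Filter.atTop, C * a ^ k ≤ Real.exp a := by
  have h := (isLittleO_pow_exp_atTop (n := k)).bound (c := 1 / (|C| + 1)) (by positivity)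
  filter_upwards [h, Filter.eventually_ge_atTop 0] with a ha ha0
  rw [Real.norm_of_nonneg (by positivity), Real.norm_of_nonneg (Real.exp_nonneg a),
    div_mul_eq_mul_div, one_mul, le_div_iff₀ (by positivity)] at ha
  have : 0 ≤ a ^ k := by positivity
  nlinarith [le_abs_self C]

lemma eventually_log_sq_mul_lt {ε : ℝ} (hε : 0 < ε) :
    ∀ᶠ s : ℕ in Filter.atTop, 1 ≤ 30 * (s : ℝ) ^ 2 / ε ∧
      Real.log (30 * (s : ℝ) ^ 2 / ε) ^ 2 * (1 + 8 * √s) < s := by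
  have h1 := (isLittleO_log_rpow_atTop (r := 1 / 8) (by norm_num)).bound (c := 1) one_pos
  have h2 := (tendsto_rpow_atTop (y := 1 / 8) (by norm_num)).eventually_ge_atTop
    (max 10 (Real.log (30 / ε)))
  have key : ∀ᶠ s : ℝ in Filter.atTop, 1 ≤ 30 * s ^ 2 / ε ∧
      Real.log (30 * s ^ 2 / ε) ^ 2 * (1 + 8 * √s) < s := by
    filter_upwards [h1, h2, Filter.eventually_ge_atTop 1, Filter.eventually_ge_atTop ε]
      with s hs1 hs2 hs3 hs4
    have hs0 : 0 < s := by linarith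
    set v := s ^ (1 / 8 : ℝ) with hv
    have hv10 : 10 ≤ v := (le_max_left _ _).trans hs2
    have hlogε : Real.log (30 / ε) ≤ v := (le_max_right _ _).trans hs2
    have hlog : Real.log s ≤ v := by
      have := (le_abs_self _).trans hs1
      rwa [one_mul, Real.norm_of_nonneg (by linarith)] at this
    have hv8 : v ^ 8 = s := by
      rw [hv, ← Real.rpow_natCast, ← Real.rpow_mul hs0.le]
      norm_num
    have hsq : √s = v ^ 4 := by
      rw [← hv8, show v ^ 8 = (v ^ 4) ^ 2 by ring, Real.sqrt_sq (by positivity)]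
    have h3 : 1 ≤ 30 * s ^ 2 / ε := by
      rw [le_div_iff₀ hε]
      nlinarith
    refine ⟨h3, ?_⟩
    have h4 : Real.log (30 * s ^ 2 / ε) ≤ 3 * v := by
      rw [show 30 * s ^ 2 / ε = 30 / ε * s ^ 2 by ring,
        Real.log_mul (by positivity) (by positivity), Real.log_pow]
      push_cast
      linarith
    have h5 : Real.log (30 * s ^ 2 / ε) ^ 2 ≤ (3 * v) ^ 2 :=
      pow_le_pow_left₀ (Real.log_nonneg h3) h4 2
    rw [hsq]
    have hv0 : 0 ≤ v := by linarith
    have hv4 : 1 ≤ v ^ 4 := one_le_pow₀ (by linarith)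
    calc Real.log (30 * s ^ 2 / ε) ^ 2 * (1 + 8 * v ^ 4)
        ≤ (3 * v) ^ 2 * (9 * v ^ 4) := mul_le_mul h5 (by linarith) (by positivity) (by positivity)
      _ = v ^ 6 * 81 := by ring
      _ < v ^ 6 * v ^ 2 := mul_lt_mul_of_pos_left (by nlinarith) (by positivity)
      _ = s := by rw [← hv8]; ring
  exact tendsto_natCast_atTop_atTop.eventually key

/-- The asymptotic relations between the parameters, in terms of `a = log log n`. -/
structure Large (a : ℝ) : Prop where
  ge : 10 ≤ a
  pow_le : (1601 * a ^ 200) ^ 30 ≤ Real.exp (a ^ 100)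
  lt_exp : 2 + 2 * ((1601 * a ^ 200) ^ 14 * (2 * a ^ 100)) < Real.exp a

lemma eventually_large : ∀ᶠ a : ℝ in Filter.atTop, Large a := by
  filter_upwards [Filter.eventually_ge_atTop 10, eventually_const_mul_pow_le_exp (1601 ^ 30) 6000,
    eventually_const_mul_pow_le_exp (4 * 1601 ^ 14 + 3) 2900] with a ha h1 h2
  have ha1 : 1 ≤ a := by linarith
  refine ⟨ha, ?_, ?_⟩
  · calc (1601 * a ^ 200) ^ 30 = 1601 ^ 30 * a ^ 6000 := by rw [mul_pow, ← pow_mul]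
      _ ≤ Real.exp a := h1
      _ ≤ Real.exp (a ^ 100) := Real.exp_le_exp.2 (le_self_pow₀ ha1 (by norm_num))
  · refine lt_of_lt_of_le ?_ h2
    have h3 : 1 ≤ a ^ 2900 := one_le_pow₀ ha1
    have h4 : 2 * ((1601 * a ^ 200) ^ 14 * (2 * a ^ 100)) = 4 * 1601 ^ 14 * a ^ 2900 := by
      rw [mul_pow, ← pow_mul, show (2900 : ℕ) = 200 * 14 + 100 from rfl, pow_add]
      ring
    rw [h4, add_mul]
    linarith

/-- The size of the sets to be avoided. -/
noncomputable def avoidSize (a : ℝ) : ℕ := ⌈Real.exp (a ^ 100)⌉₊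

/-- The polylogarithmic scale attached to `avoidSize`. -/
noncomputable def logScale (a : ℝ) : ℕ := ⌈1600 * a ^ 200⌉₊

variable {a : ℝ}

lemma Large.one_le_pow (h : Large a) (k : ℕ) : 1 ≤ a ^ k :=
  one_le_pow₀ (by linarith [h.ge])

lemma Large.logScale_le (h : Large a) : (logScale a : ℝ) ≤ 1601 * a ^ 200 := by
  have := h.one_le_pow 200
  have := (Nat.ceil_lt_add_one (show 0 ≤ 1600 * a ^ 200 by linarith)).le
  rw [logScale]
  linarith

lemma Large.le_logScale : 1600 * a ^ 200 ≤ logScale a := Nat.le_ceil _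

lemma Large.exp_le_avoidSize : Real.exp (a ^ 100) ≤ avoidSize a := Nat.le_ceil _

lemma Large.avoidSize_pos : (0 : ℝ) < avoidSize a :=
  (Real.exp_pos _).trans_le Large.exp_le_avoidSize

lemma Large.log_avoidSize_le (h : Large a) : Real.log (avoidSize a) ≤ 2 * a ^ 100 := by
  have h1 := h.one_le_pow 100
  have h2 : (avoidSize a : ℝ) ≤ 2 * Real.exp (a ^ 100) := by
    have := (Nat.ceil_lt_add_one (Real.exp_nonneg (a ^ 100))).le
    have := Real.add_one_le_exp (a ^ 100)
    rw [avoidSize]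
    linarith
  calc Real.log (avoidSize a) ≤ Real.log (2 * Real.exp (a ^ 100)) :=
        Real.log_le_log Large.avoidSize_pos h2
    _ = Real.log 2 + a ^ 100 := by
        rw [Real.log_mul (by norm_num) (Real.exp_pos _).ne', Real.log_exp]
    _ ≤ 2 * a ^ 100 := by linarith [Real.log_two_lt_d9]

lemma Large.scale (h : Large a) : Scale (logScale a) (avoidSize a) where
  le_μ := by
    have := h.one_le_pow 200
    have h1 := Large.le_logScale (a := a)
    have : ((64 : ℕ) : ℝ) ≤ logScale a := by push_cast; linarith
    exact_mod_cast this
  pow_le := by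
    have h1 : (logScale a : ℝ) ^ 30 ≤ avoidSize a :=
      (pow_le_pow_left₀ (Nat.cast_nonneg _) h.logScale_le 30).trans
        (h.pow_le.trans Large.exp_le_avoidSize)
    exact_mod_cast h1
  pow_le_two_pow := by
    have h1 : (avoidSize a : ℝ) ^ 20 ≤ 2 ^ logScale a := by
      rw [← Real.log_le_log_iff (pow_pos Large.avoidSize_pos _) (by positivity), Real.log_pow,
        Real.log_pow]
      have h2 := h.log_avoidSize_le
      have h3 : a ^ 100 ≤ a ^ 200 :=
        pow_le_pow_right₀ (by linarith [h.ge]) (by norm_num)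
      have h4 := Large.le_logScale (a := a)
      have h5 := h.one_le_pow 200
      push_cast
      nlinarith [Real.log_two_gt_d9]
    exact_mod_cast h1

lemma Large.exp_mul_le_avoidSize (h : Large a) : Real.exp a ^ 20 ≤ avoidSize a := by
  refine le_trans ?_ Large.exp_le_avoidSize
  rw [← Real.exp_nat_mul]
  refine Real.exp_le_exp.2 ?_
  push_cast
  have h1 : (10 : ℝ) ^ 99 ≤ a ^ 99 := pow_le_pow_left₀ (by norm_num) h.ge 99
  have : (20 : ℝ) ≤ a ^ 99 := by linarith [show (20 : ℝ) ≤ 10 ^ 99 by norm_num]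
  calc 20 * a ≤ a ^ 99 * a := mul_le_mul_of_nonneg_right this (by linarith [h.ge])
    _ = a ^ 100 := by ring

lemma Large.pow_card_lt (h : Large a) {n : ℕ} (hn : Real.log n = Real.exp a) :
    2 * (avoidSize a ^ logScale a ^ 14 + (avoidSize a ^ logScale a ^ 14) ^ 2) < n := by
  have hpos : 0 < avoidSize a := by exact_mod_cast Large.avoidSize_pos (a := a)
  set w := avoidSize a ^ logScale a ^ 14 with hw
  have hw1 : 1 ≤ w := Nat.one_le_pow _ _ hpos
  have h0 : 2 * (w + w ^ 2) ≤ 4 * w ^ 2 := by nlinarith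
  refine lt_of_le_of_lt h0 ?_
  have hn0 : (0 : ℝ) < n := by
    rcases Nat.eq_zero_or_pos n with rfl | h
    · simp at hn
      exact absurd hn.symm (Real.exp_pos a).ne'
    · exact_mod_cast h
  have hw0 : (0 : ℝ) < w := by exact_mod_cast hw1
  have h1 : (4 : ℝ) * (w : ℝ) ^ 2 < n := by
    rw [← Real.log_lt_log_iff (by positivity) hn0, hn,
      Real.log_mul (by norm_num) (by positivity), Real.log_pow]
    have h4 : Real.log 4 ≤ 2 := by
      rw [show (4 : ℝ) = 2 ^ 2 by norm_num, Real.log_pow]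
      push_cast
      linarith [Real.log_two_lt_d9]
    have h2 : Real.log w ≤ (1601 * a ^ 200) ^ 14 * (2 * a ^ 100) := by
      rw [hw, Nat.cast_pow, Real.log_pow, Nat.cast_pow]
      have hl : 0 ≤ Real.log (avoidSize a) := Real.log_natCast_nonneg _
      exact mul_le_mul (pow_le_pow_left₀ (Nat.cast_nonneg _) h.logScale_le 14)
        h.log_avoidSize_le hl (by have := h.one_le_pow 200; positivity)
    push_cast
    linarith [h.lt_exp]
  exact_mod_cast h1

lemma Large.logScale_pow_le (h : Large a) : (logScale a : ℝ) ^ 4 ≤ Real.exp a := by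
  have h1 : (1 : ℝ) ≤ logScale a := by
    have := h.one_le_pow 200
    have := Large.le_logScale (a := a)
    linarith
  have h2 := h.one_le_pow 100
  have h3 : (logScale a : ℝ) ^ 4 ≤ (1601 * a ^ 200) ^ 14 :=
    (pow_le_pow_right₀ h1 (by norm_num)).trans
      (pow_le_pow_left₀ (Nat.cast_nonneg _) h.logScale_le 14)
  have h4 : 0 ≤ (1601 * a ^ 200) ^ 14 := pow_nonneg (by linarith [h.one_le_pow 200]) 14
  have h5 := mul_le_mul_of_nonneg_left h2 h4
  linarith [h.lt_exp]

lemma Large.le_exp (h : Large a) : 10000000 ≤ Real.exp a := by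
  have h1 := h.one_le_pow 200
  have h2 : (1601 : ℝ) ^ 14 ≤ (1601 * a ^ 200) ^ 14 :=
    pow_le_pow_left₀ (by norm_num) (by linarith) 14
  have h3 := mul_le_mul h2 (h.one_le_pow 100) zero_le_one (by linarith)
  linarith [h.lt_exp]

lemma natLog_add_one_le {n : ℕ} (h : 10000 ≤ Real.log n) :
    (Nat.log 2 n : ℝ) + 1 ≤ 2 * Real.log n := by
  have hn : n ≠ 0 := by
    rintro rfl
    simp at h
    linarith
  have h1 : ((2 ^ Nat.log 2 n : ℕ) : ℝ) ≤ n := by exact_mod_cast Nat.pow_log_le_self 2 hn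
  have h2 := Real.log_le_log (by positivity) h1
  push_cast at h2
  rw [Real.log_pow] at h2
  have h3 : (0 : ℝ) ≤ Nat.log 2 n := Nat.cast_nonneg _
  nlinarith [Real.log_two_gt_d9]

/-- Numerical bounds for the construction when `log n = L`, `q ≈ L²` and `μ⁴ ≤ L`. -/
lemma radius_stepCost_le {n μ q : ℕ} (hL : 10000 ≤ Real.log n)
    (hμ : (μ : ℝ) ^ 4 ≤ Real.log n) (hq : (q : ℝ) ≤ Real.log n ^ 2 + 1) :
    (radius n μ q : ℝ) ≤ 26 * Real.log n ^ 3 ∧ (stepCost n μ q : ℝ) ≤ 75 * Real.log n ^ 3 := by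
  have hl := natLog_add_one_le hL
  set L := Real.log n
  have hh : (halfTime n q : ℝ) ≤ 5 * L ^ 3 := by
    have h1 : (q : ℝ) * ((Nat.log 2 n : ℝ) + 1) ≤ (L ^ 2 + 1) * (2 * L) :=
      mul_le_mul hq hl (by positivity) (by positivity)
    rw [halfTime]
    push_cast
    nlinarith
  have h2 : 10000 ^ 2 * L ≤ L ^ 3 := by nlinarith
  have hr : (radius n μ q : ℝ) ≤ 26 * L ^ 3 := by
    rw [radius]
    push_cast
    linarith
  refine ⟨hr, ?_⟩
  rw [stepCost]
  push_cast
  linarith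

end Parameters

section Main
open scoped Classical
variable [Fintype V] {G : SimpleGraph V}

lemma le_degIn_of_minDegGE {d : ℝ} (h : MinDegGE G d) (v : V) :
    ⌈d⌉₊ ≤ degIn G Finset.univ v := by
  refine Nat.ceil_le.2 ((h v).trans ?_)
  rw [degIn, ← Set.ncard_coe_finset]
  refine le_of_eq (congrArg _ (congrArg Set.ncard ?_))
  ext
  simp

lemma nb_large_of_expander {ε d : ℝ} (hε : 0 < ε) (hε1 : ε < 1 / 5) (hd : 1 ≤ d)
    (hG : IsExpander G 1 (ε * d)) {s : ℕ} (hs : 1 ≤ s)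
    (hlog : 1 ≤ 30 * (s : ℝ) ^ 2 / ε ∧ Real.log (30 * (s : ℝ) ^ 2 / ε) ^ 2 * (1 + 8 * √s) < s)
    {X : Finset V} (hX : X.card = s * (s * ⌈d⌉₊)) (hcard : 2 * X.card ≤ Fintype.card V) :
    s * ⌈d⌉₊ * (1 + Nat.sqrt (64 * s)) < (nb G X).card := by
  have hd0 : 0 < d := by linarith
  have he1 : d ≤ ⌈d⌉₊ := Nat.le_ceil d
  have he2 : (⌈d⌉₊ : ℝ) ≤ 2 * d := by linarith [Nat.ceil_lt_add_one hd0.le]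
  have hs1 : (1 : ℝ) ≤ s := by exact_mod_cast hs
  have hXr : (X.card : ℝ) = s ^ 2 * ⌈d⌉₊ := by rw [hX]; push_cast; ring
  have hXd : d ≤ X.card := by
    rw [hXr]
    nlinarith [one_le_pow₀ (n := 2) hs1]
  have hεd : ε * d ≤ d := by nlinarith
  have hX2 : (X.card : ℝ) ≤ (Fintype.card V : ℝ) / 2 := by
    have : (2 : ℝ) * X.card ≤ Fintype.card V := by exact_mod_cast hcard
    linarith
  have h := card_le_log_sq_mul_nb (by positivity) hG (by linarith) hX2
  have hεd0 : 0 < ε * d := by positivity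
  have harg : 15 * (X.card : ℝ) / (ε * d) ≤ 30 * (s : ℝ) ^ 2 / ε := by
    rw [div_le_div_iff₀ hεd0 hε, hXr]
    have : (s : ℝ) ^ 2 * ⌈d⌉₊ ≤ s ^ 2 * (2 * d) := mul_le_mul_of_nonneg_left he2 (by positivity)
    nlinarith
  have harg1 : 1 ≤ 15 * (X.card : ℝ) / (ε * d) := by
    rw [le_div_iff₀ hεd0]
    linarith
  have hsq : Real.log (15 * X.card / (ε * d)) ^ 2 ≤ Real.log (30 * (s : ℝ) ^ 2 / ε) ^ 2 :=
    pow_le_pow_left₀ (Real.log_nonneg harg1) (Real.log_le_log (by linarith) harg) 2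
  by_contra hcon
  push Not at hcon
  have hsqrt : (Nat.sqrt (64 * s) : ℝ) ≤ 8 * √s := by
    refine Real.nat_sqrt_le_real_sqrt.trans ?_
    push_cast
    rw [show (64 : ℝ) * s = 8 ^ 2 * s by norm_num, Real.sqrt_mul (by norm_num),
      Real.sqrt_sq (by norm_num)]
  have hnb : ((nb G X).card : ℝ) ≤ s * ⌈d⌉₊ * (1 + 8 * √s) := by
    have : ((nb G X).card : ℝ) ≤ s * ⌈d⌉₊ * (1 + Nat.sqrt (64 * s)) := by exact_mod_cast hcon
    refine this.trans (mul_le_mul_of_nonneg_left (by linarith) (by positivity))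
  have hse : (0 : ℝ) < s * ⌈d⌉₊ := by
    have : (0 : ℝ) < ⌈d⌉₊ := by linarith
    positivity
  have : (X.card : ℝ) ≤ Real.log (30 * (s : ℝ) ^ 2 / ε) ^ 2 * (s * ⌈d⌉₊ * (1 + 8 * √s)) :=
    h.trans (mul_le_mul hsq hnb (by positivity) (by positivity))
  have h2 : (s : ℝ) * ⌈d⌉₊ * (Real.log (30 * (s : ℝ) ^ 2 / ε) ^ 2 * (1 + 8 * √s)) <
      s * ⌈d⌉₊ * s := mul_lt_mul_of_pos_left hlog.2 hse
  rw [hXr] at this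
  nlinarith

lemma hasAdjuster_of_large {ε d : ℝ} (hε : 0 < ε) (hε1 : ε < 1 / 5) {n : ℕ}
    (hn : Fintype.card V = n) (hd : 12696 ≤ d) (hεd : 15 ≤ ε * d)
    (hlarge : Large (Real.log (Real.log n)))
    (hlog : ∀ s : ℕ, ⌈d⌉₊ / 8 / 3 ≤ s → 1 ≤ s ∧ 1 ≤ 30 * (s : ℝ) ^ 2 / ε ∧
      Real.log (30 * (s : ℝ) ^ 2 / ε) ^ 2 * (1 + 8 * √s) < s)
    (hfree : ¬ ContainsBalSub G ⌈d / 2⌉₊ 2) (hbip : IsBip G) (hG : IsExpander G 1 (ε * d))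
    (hdeg : MinDegGE G d) {D : ℕ} (hD : Real.log n ^ 10 ≤ D)
    (hD' : (D : ℝ) ≤ Real.exp (Real.log (Real.log n) ^ 100)) {r : ℕ} (hr : 1 ≤ r)
    (hr' : (r : ℝ) ≤ 20 * (800 * Real.log n ^ 3)) {U : Set V}
    (hU : (U.ncard : ℝ) ≤ Real.exp (Real.log (Real.log n) ^ 100)) :
    HasAdjuster (G.induce Uᶜ) D (800 * Real.log n ^ 3) r := by
  have hL0 : 0 < Real.log n := by
    rcases (Real.log_natCast_nonneg n).eq_or_lt with h | h
    · have := hlarge.ge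
      rw [← h, Real.log_zero] at this
      linarith
    · exact h
  have hexp : Real.exp (Real.log (Real.log n)) = Real.log n := Real.exp_log hL0
  have hL' : 10000000 ≤ Real.log n := hexp ▸ hlarge.le_exp
  have hL : 10000 ≤ Real.log n := by linarith
  have hμL : (logScale (Real.log (Real.log n)) : ℝ) ^ 4 ≤ Real.log n := by
    simpa only [hexp] using hlarge.logScale_pow_le
  have hLu : Real.log n ^ 20 ≤ avoidSize (Real.log (Real.log n)) := by
    simpa only [hexp] using hlarge.exp_mul_le_avoidSize
  have hcard := hlarge.pow_card_lt hexp.symm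
  have hscale := hlarge.scale
  have hDu := hD'.trans Large.exp_le_avoidSize
  have hUu := hU.trans Large.exp_le_avoidSize
  have hlogu := hlarge.log_avoidSize_le
  have hμ := Large.le_logScale (a := Real.log (Real.log n))
  set a := Real.log (Real.log n)
  set μ := logScale a
  set u := avoidSize a
  set L := Real.log n
  set q := ⌈L ^ 2⌉₊
  have hq1 : L ^ 2 ≤ q := Nat.le_ceil _
  have hq2 : (q : ℝ) ≤ L ^ 2 + 1 := (Nat.ceil_lt_add_one (by positivity)).le
  have hq : 1 ≤ q := by
    have : (1 : ℝ) ≤ q := by nlinarith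
    exact_mod_cast this
  obtain ⟨hρ, hc⟩ := radius_stepCost_le (n := n) (μ := μ) hL hμL hq2
  have hD0 : 1 ≤ D := by
    have : (0 : ℝ) < D := lt_of_lt_of_le (by positivity) hD
    exact_mod_cast this
  have hL3 : 0 < L ^ 3 := by positivity
  have hL7 : L ^ 7 ≤ u := le_trans (pow_le_pow_right₀ (by linarith) (by norm_num)) hLu
  have hL3u : L ^ 3 ≤ u := le_trans (pow_le_pow_right₀ (by linarith) (by norm_num)) hLu
  have hu1 : 1 ≤ u := by
    have : (0 : ℝ) < u := Large.avoidSize_pos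
    exact_mod_cast this
  have hu20 : 2 * u ^ 20 ≤ Fintype.card V := by
    have h1 : u ^ 20 ≤ u ^ μ ^ 14 :=
      Nat.pow_le_pow_right hu1 (le_trans (by have := hscale.le_μ; omega)
        (Nat.le_self_pow (by norm_num) μ))
    omega
  have hcut : r * stepCost n μ q ≤ u := by
    have h1 : (r : ℝ) * stepCost n μ q ≤ 16000 * L ^ 3 * (75 * L ^ 3) :=
      mul_le_mul (by linarith) hc (by positivity) (by positivity)
    have h2 : 16000 * L ^ 3 * (75 * L ^ 3) ≤ L ^ 7 := by
      have : 1200000 * L ^ 6 ≤ L * L ^ 6 :=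
        mul_le_mul_of_nonneg_right (by linarith) (by positivity)
      linarith [this]
    have h3 : (r : ℝ) * stepCost n μ q ≤ u := by linarith
    exact_mod_cast h3
  have hUfin : U.toFinset.card ≤ u := by
    have : U.ncard ≤ u := by exact_mod_cast hUu
    rwa [Set.ncard_eq_toFinset_card'] at this
  have hsmall : Expands G ⌈ε * d / 2⌉₊ (u ^ 20) μ := by
    intro X h1 h2
    have h3 : (X.card : ℝ) ≤ (Fintype.card V : ℝ) / 2 := by
      have : (2 : ℝ) * X.card ≤ Fintype.card V := by exact_mod_cast (by omega)
      linarith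
    have hX0 : ε * d / 2 ≤ X.card := Nat.ceil_le.1 h1
    refine card_le_mul_nb hεd hG hX0 h3 ?_
    have h4 : Real.log X.card ≤ 20 * Real.log u := by
      have : (X.card : ℝ) ≤ (u : ℝ) ^ 20 := by exact_mod_cast h2
      have := Real.log_le_log (by linarith) this
      rw [Real.log_pow] at this
      exact_mod_cast this
    calc Real.log X.card ^ 2 ≤ (40 * a ^ 100) ^ 2 :=
          pow_le_pow_left₀ (Real.log_natCast_nonneg _) (by linarith) 2
      _ = 1600 * a ^ 200 := by ring
      _ ≤ μ := hμ
  have hbig : Expands G ⌈ε * d / 2⌉₊ (Fintype.card V / 2) q := by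
    intro X h1 h2
    have h3 : (X.card : ℝ) ≤ (Fintype.card V : ℝ) / 2 := by
      have : (2 : ℝ) * X.card ≤ Fintype.card V := by exact_mod_cast (by omega)
      linarith
    have hX0 : ε * d / 2 ≤ X.card := Nat.ceil_le.1 h1
    refine card_le_mul_nb hεd hG hX0 h3 (le_trans ?_ hq1)
    refine pow_le_pow_left₀ (Real.log_natCast_nonneg _)
      (Real.log_le_log (by linarith) ?_) 2
    rw [← hn]
    exact_mod_cast (by omega : X.card ≤ Fintype.card V)
  have he1 : d ≤ ⌈d⌉₊ := Nat.le_ceil d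
  have hk : 2 * ⌈d / 2⌉₊ ≤ ⌈d⌉₊ + 1 := by
    have h1 := Nat.ceil_lt_add_one (show 0 ≤ d / 2 by linarith)
    have : (2 : ℝ) * ⌈d / 2⌉₊ < ⌈d⌉₊ + 2 := by linarith
    have : 2 * ⌈d / 2⌉₊ < ⌈d⌉₊ + 2 := by exact_mod_cast this
    omega
  have he : 12696 ≤ ⌈d⌉₊ := by exact_mod_cast hd.trans he1
  have hκ : 8 * ⌈ε * d / 2⌉₊ ≤ ⌈d⌉₊ := by
    have h1 := Nat.ceil_lt_add_one (show 0 ≤ ε * d / 2 by linarith)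
    have : (8 : ℝ) * ⌈ε * d / 2⌉₊ ≤ ⌈d⌉₊ := by nlinarith
    exact_mod_cast this
  have hlogn : Nat.log 2 (Fintype.card V) + 2 ≤ u := by
    rw [hn]
    have h1 := natLog_add_one_le hL
    have : (Nat.log 2 n : ℝ) + 2 ≤ u := by nlinarith
    exact_mod_cast this
  have hqu : 8 * q ≤ u := by
    have : (8 : ℝ) * q ≤ u := by nlinarith
    exact_mod_cast this
  obtain ⟨M, hM, hgad⟩ := exists_gadget (r := r) (U := U.toFinset) hscale hbip hfree hk
    (le_degIn_of_minDegGE hdeg) he (hn ▸ hcard) hsmall hbig hq hκ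
    (fun _ s hs X hX hXu => nb_large_of_expander hε hε1 (by linarith) hG (hlog s hs).1
      (hlog s hs).2 hX (by omega)) hlogn hqu hr (hn ▸ hcut) hUfin
  refine hasAdjuster_of_gadget (by simp) hD0 (le_trans (by exact_mod_cast hDu) hM) hgad
    (by rw [hn]; linarith) ?_
  rw [hn, Nat.cast_mul]
  have hr0 : (0 : ℝ) ≤ r := Nat.cast_nonneg r
  calc (r : ℝ) * stepCost n μ q ≤ r * (10 * (800 * L ^ 3)) :=
        mul_le_mul_of_nonneg_left (by linarith) hr0
    _ = 10 * (800 * L ^ 3) * r := by ring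

end Main

/-- `(D, m, r)`-adjusters robustly in sparse expanders (Lemma 2.10). -/
theorem statement14 :
    ∃ ε₁ : ℝ, 0 < ε₁ ∧
      ∀ ε₂ : ℝ, 0 < ε₂ → ε₂ < 1 / 5 →
        ∃ d₀ : ℝ, ∀ (n : ℕ) (d : ℝ), d₀ ≤ d → d ≤ n →
          ∀ (V : Type) [Fintype V] (G : SimpleGraph V), Nat.card V = n →
            ¬ ContainsBalSub G ⌈d / 2⌉₊ 2 →
            IsBip G → IsExpander G ε₁ (ε₂ * d) → MinDegGE G d →
              ∀ D : ℕ, Real.log n ^ 10 ≤ (D : ℝ) →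
                (D : ℝ) ≤ Real.exp (Real.log (Real.log n) ^ 100) →
                ∀ r : ℕ, 1 ≤ r → (r : ℝ) ≤ 20 * (800 / ε₁ * Real.log n ^ 3) →
                  ∀ U : Set V, (U.ncard : ℝ) ≤ Real.exp (Real.log (Real.log n) ^ 100) →
                    HasAdjuster (G.induce Uᶜ) (D : ℝ)
                      (800 / ε₁ * Real.log n ^ 3) r := by
  refine ⟨1, one_pos, fun ε hε hε1 => ?_⟩
  obtain ⟨a₀, ha₀⟩ := Filter.eventually_atTop.1 eventually_large
  obtain ⟨s₀, hs₀⟩ := Filter.eventually_atTop.1 (eventually_log_sq_mul_lt hε)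
  refine ⟨max (max 12696 (15 / ε)) (max (Real.exp (Real.exp a₀)) (24 * (s₀ + 1))),
    fun n d hd hdn V _ G hn hfree hbip hG hdeg D hD hD' r hr hr' U hU => ?_⟩
  have hd1 : 12696 ≤ d := (le_max_left _ _).trans ((le_max_left _ _).trans hd)
  have hd2 : 15 / ε ≤ d := (le_max_right _ _).trans ((le_max_left _ _).trans hd)
  have hd3 : Real.exp (Real.exp a₀) ≤ d := (le_max_left _ _).trans ((le_max_right _ _).trans hd)
  have hd4 : 24 * ((s₀ : ℝ) + 1) ≤ d := (le_max_right _ _).trans ((le_max_right _ _).trans hd)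
  have hn0 : (0 : ℝ) < n := by linarith
  have hL : Real.exp a₀ ≤ Real.log n := (Real.le_log_iff_exp_le hn0).2 (hd3.trans hdn)
  have ha : a₀ ≤ Real.log (Real.log n) :=
    (Real.le_log_iff_exp_le ((Real.exp_pos _).trans_le hL)).2 hL
  rw [div_one] at hr' ⊢
  refine hasAdjuster_of_large hε hε1 (by rw [← hn, Nat.card_eq_fintype_card]) hd1
    (by rwa [div_le_iff₀' hε] at hd2) (ha₀ _ ha) (fun s hs => ?_)
    hfree hbip hG hdeg hD hD' hr hr' hU
  have he : 24 * (s₀ + 1) ≤ ⌈d⌉₊ := by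
    have : (24 : ℝ) * (s₀ + 1) ≤ ⌈d⌉₊ := hd4.trans (Nat.le_ceil d)
    exact_mod_cast this
  exact ⟨by omega, hs₀ s (by omega)⟩

end Balanced
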